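/- Let M be a surface and let k ≥ 2 be an integer. There exist constants c₁ > 0 and c₂ ≥ 0, depending only on k and M, such that for every finite family 𝒜 = {A_1, …, A_n} of subsets of M satisfying (i) f_{k+1}(𝒜) = 0 and (ii) for every σ ⊆ {1, …, n} with |σ| ∈ {k, k+1} the set A_σ is empty, or a single point, or both open and path-connected, one has f_k(𝒜) ≤ c₁ · f^{ind}_{k-1}(𝒜) + c₂. -/

import Mathlib

/-- `fNum A k` is `f_k(𝒜)`: the number of subsets `σ` of the index set with
`|σ| = k+1` such that `⋂ i ∈ σ, A i` is nonempty. -/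
noncomputable def fNum {α : Type*} {n : ℕ} (A : Fin n → Set α) (k : ℕ) : ℕ :=
  Nat.card {σ : Finset (Fin n) // σ.card = k + 1 ∧ (⋂ i ∈ σ, A i).Nonempty}

/-- `fInd A k` is `f_k^{ind}(𝒜)`: the number of subsets `τ` with `|τ| = k+1` and
`⋂ i ∈ τ, A i ≠ ∅` for which there is `σ ⊃ τ` with `|σ| = k+2` and `⋂ i ∈ σ, A i ≠ ∅`. -/
noncomputable def fInd {α : Type*} {n : ℕ} (A : Fin n → Set α) (k : ℕ) : ℕ :=
  Nat.card {τ : Finset (Fin n) // τ.card = k + 1 ∧ (⋂ i ∈ τ, A i).Nonempty ∧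
    ∃ σ : Finset (Fin n), τ ⊂ σ ∧ σ.card = k + 2 ∧ (⋂ i ∈ σ, A i).Nonempty}


namespace SurfUB
open Set Filter Topology

/-- Locally Euclidean of dimension two, in a convenient form. -/
def Surf (X : Type*) [TopologicalSpace X] : Prop :=
  ∀ x : X, ∀ O ∈ 𝓝 x, ∃ ι : ℂ → X, IsOpenEmbedding ι ∧ ι 0 = x ∧ range ι ⊆ O

theorem surf_complex : Surf ℂ := by
  intro x O hO
  obtain ⟨r, hr, hrO⟩ := Metric.mem_nhds_iff.1 hO
  refine ⟨OpenPartialHomeomorph.univBall x r,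
    OpenPartialHomeomorph.isOpenEmbedding _ (OpenPartialHomeomorph.univBall_source x r),
    OpenPartialHomeomorph.univBall_apply_zero x r, ?_⟩
  rw [← image_univ, ← OpenPartialHomeomorph.univBall_source x r,
    OpenPartialHomeomorph.image_source_eq_target, OpenPartialHomeomorph.univBall_target x hr]
  exact hrO

theorem surf_of_charted (M : Type*) [TopologicalSpace M]
    [ChartedSpace (EuclideanSpace ℝ (Fin 2)) M] : Surf M := by
  intro x O hO
  let e := chartAt (EuclideanSpace ℝ (Fin 2)) x
  let L : ℂ ≃ₜ EuclideanSpace ℝ (Fin 2) := Complex.orthonormalBasisOneI.repr.toHomeomorph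
  have hx : x ∈ e.source := mem_chart_source _ x
  let c : ℂ := L.symm (e x)
  have hLc : L c = e x := L.apply_symm_apply _
  have hc : L ⁻¹' (e.target ∩ e.symm ⁻¹' O) ∈ 𝓝 c := by
    apply L.continuous.continuousAt.preimage_mem_nhds
    rw [hLc]
    refine inter_mem (e.open_target.mem_nhds (e.map_source hx)) ?_
    apply (e.continuousAt_symm (e.map_source hx)).preimage_mem_nhds
    rw [e.left_inv hx]; exact hO
  obtain ⟨ι, hι, h0, hr⟩ := surf_complex c _ hc
  refine ⟨e.symm ∘ L ∘ ι, ?_, ?_, ?_⟩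
  · have hmem : ∀ z, (L (ι z)) ∈ e.target := fun z => (hr ⟨z, rfl⟩).1
    have hLι : IsOpenEmbedding (L ∘ ι) := L.isOpenEmbedding.comp hι
    refine IsOpenEmbedding.of_continuous_injective_isOpenMap ?_ ?_ ?_
    · rw [← continuousOn_univ]
      exact e.continuousOn_symm.comp hLι.continuous.continuousOn (fun z _ => hmem z)
    · intro a b hab
      exact hLι.injective (e.symm.injOn (hmem a) (hmem b) hab)
    · intro U hU
      rw [image_comp]
      apply e.symm.isOpen_image_of_subset_source (hLι.isOpenMap U hU)
      rintro _ ⟨z, _, rfl⟩; exact hmem z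
  · simp only [Function.comp, h0, hLc]; exact e.left_inv hx
  · rintro _ ⟨z, rfl⟩
    exact (hr ⟨z, rfl⟩).2

section basics
variable {X : Type*} [TopologicalSpace X]

theorem preconn_aux {Ω D u v : Set X} {x : X} {W : Set X} [T1Space X] (hΩ : IsPreconnected Ω)
    (hu : IsOpen u) (hv : IsOpen v) (hW : IsOpen W) (hxW : x ∈ W) (hWΩ : W ⊆ Ω)
    (hD : D = W \ {x})
    (hc : Ω \ {x} ⊆ u ∪ v) (hd : (Ω \ {x}) ∩ (u ∩ v) = ∅) (hDu : D ⊆ u) :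
    Ω \ {x} ⊆ u ∨ Ω \ {x} ⊆ v := by
  subst hD
  have hdd : ∀ y ∈ Ω, y ≠ x → y ∈ u → y ∈ v → False := fun y h1 h2 h3 h4 => by
    have : y ∈ (Ω \ {x}) ∩ (u ∩ v) := ⟨⟨h1, h2⟩, h3, h4⟩
    rw [hd] at this; exact this
  have hc' : Ω ⊆ (u ∪ W) ∪ (v \ {x}) := by
    intro y hy
    by_cases hyx : y = x
    · subst hyx; exact Or.inl (Or.inr hxW)
    · rcases hc ⟨hy, hyx⟩ with h | h
      · exact Or.inl (Or.inl h)
      · exact Or.inr ⟨h, hyx⟩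
  have hd' : Ω ∩ ((u ∪ W) ∩ (v \ {x})) = ∅ := by
    ext y
    simp only [mem_inter_iff, mem_empty_iff_false, iff_false]
    rintro ⟨hy, h1, h2, h3⟩
    rcases h1 with h1 | h1
    · exact hdd y hy h3 h1 h2
    · exact hdd y hy h3 (hDu ⟨h1, h3⟩) h2
  rcases isPreconnected_iff_subset_of_disjoint.1 hΩ (u ∪ W) (v \ {x}) (hu.union hW)
    (hv.sdiff isClosed_singleton) hc' hd' with h | h
  · left
    rintro y ⟨hy, hyx⟩
    rcases h hy with h | h
    · exact h
    · exact hDu ⟨h, hyx⟩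
  · right
    rintro y ⟨hy, hyx⟩
    exact (h hy).1

theorem preconn_diff_point [T2Space X] (hS : Surf X) {Ω : Set X} (hΩo : IsOpen Ω)
    (hΩ : IsPreconnected Ω) (x : X) : IsPreconnected (Ω \ {x}) := by
  by_cases hx : x ∈ Ω
  swap
  · rwa [sdiff_singleton_eq_self hx]
  obtain ⟨ι, hι, h0, hr⟩ := hS x Ω (hΩo.mem_nhds hx)
  have hD : IsPreconnected (range ι \ {x}) := by
    have : range ι \ {x} = ι '' {0}ᶜ := by
      rw [image_compl_eq_range_sdiff_image hι.injective, image_singleton, h0]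
    rw [this]
    exact (isConnected_compl_singleton_of_one_lt_rank (by simp) (0 : ℂ)).isPreconnected.image _
      hι.continuous.continuousOn
  have hxr : x ∈ range ι := ⟨0, h0⟩
  rw [isPreconnected_iff_subset_of_disjoint]
  intro u v hu hv hc hd
  have hsub : range ι \ {x} ⊆ Ω \ {x} := sdiff_subset_sdiff_left hr
  rcases isPreconnected_iff_subset_of_disjoint.1 hD u v hu hv (hsub.trans hc)
    (by rw [← subset_empty_iff, ← hd]; exact inter_subset_inter_left _ hsub) with h | h
  · exact preconn_aux hΩ hu hv hι.isOpen_range hxr hr rfl hc hd h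
  · exact (preconn_aux hΩ hv hu hι.isOpen_range hxr hr rfl (by rwa [union_comm])
      (by rwa [inter_comm v u]) h).symm

theorem preconn_diff_finite [T2Space X] (hS : Surf X) {Ω Z : Set X} (hΩo : IsOpen Ω)
    (hΩ : IsPreconnected Ω) (hZ : Z.Finite) : IsPreconnected (Ω \ Z) := by
  induction Z, hZ using Set.Finite.induction_on with
  | empty => simpa
  | @insert a s _ hs ih =>
    have := preconn_diff_point hS (hΩo.sdiff hs.isClosed) ih a
    rwa [sdiff_sdiff, union_comm, ← insert_eq] at this

theorem Surf.neBot [T2Space X] (hS : Surf X) (x : X) : (𝓝[≠] x).NeBot := by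
  rw [← mem_closure_iff_nhdsWithin_neBot, mem_closure_iff_nhds]
  intro O hO
  obtain ⟨ι, hι, h0, hr⟩ := hS x O hO
  exact ⟨ι 1, hr ⟨1, rfl⟩, fun h => one_ne_zero (hι.injective (h.trans h0.symm))⟩

theorem subset_closure_diff_finite [T2Space X] (hS : Surf X) {Ω Z : Set X} (hΩo : IsOpen Ω)
    (hZ : Z.Finite) : Ω ⊆ closure (Ω \ Z) := by
  intro x hx
  rw [mem_closure_iff_nhds]
  intro O hO
  have := hS.neBot x
  have h1 : O ∩ Ω ∈ 𝓝 x := inter_mem hO (hΩo.mem_nhds hx)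
  have h2 : (Z \ {x})ᶜ ∈ 𝓝 x := (hZ.subset sdiff_subset).isClosed.isOpen_compl.mem_nhds (by simp)
  have h3 : (O ∩ Ω) ∩ (Z \ {x})ᶜ ∩ {x}ᶜ ∈ 𝓝[≠] x :=
    inter_mem (mem_nhdsWithin_of_mem_nhds (inter_mem h1 h2)) self_mem_nhdsWithin
  obtain ⟨y, ⟨⟨h4, h5⟩, h6⟩, h7⟩ := Filter.nonempty_of_mem h3
  refine ⟨y, h4, h5, fun hz => h6 ⟨hz, h7⟩⟩

/-- L0 rigidity of square roots -/
theorem rigid [T2Space X] (hS : Surf X) {Ω Z : Set X} (hΩo : IsOpen Ω)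
    (hΩ : IsPreconnected Ω) (hZ : Z.Finite) {s t : X → ℂ} (hs : ContinuousOn s Ω)
    (ht : ContinuousOn t Ω) (hst : ∀ y ∈ Ω, s y ^ 2 = t y ^ 2) (h0 : ∀ y ∈ Ω, t y = 0 → y ∈ Z) :
    (∀ y ∈ Ω, s y = t y) ∨ (∀ y ∈ Ω, s y = - t y) := by
  have hext : ∀ f g : X → ℂ, ContinuousOn f Ω → ContinuousOn g Ω → EqOn f g (Ω \ Z) →
      ∀ y ∈ Ω, f y = g y := by
    intro f g hf hg hfg
    exact hfg.of_subset_closure hf hg sdiff_subset (subset_closure_diff_finite hS hΩo hZ)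
  rcases (preconn_diff_finite hS hΩo hΩ hZ).eq_or_eq_neg_of_sq_eq (hs.mono sdiff_subset)
    (ht.mono sdiff_subset) (fun y hy => by simpa using hst y hy.1)
    (fun {y} hy h => hy.2 (h0 y hy.1 h)) with h | h
  · exact Or.inl (hext s t hs ht h)
  · exact Or.inr (hext s (-t) hs ht.neg h)

def Sq (φ : X → ℂ) (U : Set X) : Prop :=
  ∃ s : X → ℂ, ContinuousOn s U ∧ ∀ y ∈ U, s y ^ 2 = φ y

def EvenAt (φ : X → ℂ) (x : X) : Prop := ∃ U ∈ 𝓝 x, Sq φ U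

def Good (φ : X → ℂ) : Prop := Continuous φ ∧ {x | φ x = 0}.Finite

theorem Sq.mono {φ : X → ℂ} {U V : Set X} (h : Sq φ V) (hUV : U ⊆ V) : Sq φ U := by
  obtain ⟨s, h1, h2⟩ := h
  exact ⟨s, h1.mono hUV, fun y hy => h2 y (hUV hy)⟩

theorem Sq.evenAt {φ : X → ℂ} {U : Set X} (h : Sq φ U) {x : X} (hU : U ∈ 𝓝 x) : EvenAt φ x :=
  ⟨U, hU, h⟩

theorem sq_glue [T2Space X] (hS : Surf X) {φ : X → ℂ} (hφ : Good φ) {U V : Set X}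
    (hU : IsOpen U) (hV : IsOpen V) (hUV : IsPreconnected (U ∩ V)) (h1 : Sq φ U) (h2 : Sq φ V) :
    Sq φ (U ∪ V) := by
  classical
  obtain ⟨s, hs, hs2⟩ := h1
  obtain ⟨t, ht, ht2⟩ := h2
  have key : ∃ t : X → ℂ, ContinuousOn t V ∧ (∀ y ∈ V, t y ^ 2 = φ y) ∧
      ∀ y ∈ U ∩ V, s y = t y := by
    rcases rigid hS (hU.inter hV) hUV hφ.2 (hs.mono inter_subset_left)
      (ht.mono inter_subset_right) (fun y hy => by rw [hs2 y hy.1, ht2 y hy.2])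
      (fun y hy h => by simp [← ht2 y hy.2, h]) with h | h
    · exact ⟨t, ht, ht2, h⟩
    · exact ⟨-t, ht.neg, fun y hy => by simpa using ht2 y hy, h⟩
  obtain ⟨t, ht, ht2, hst⟩ := key
  refine ⟨fun y => if y ∈ U then s y else t y, ?_, ?_⟩
  · intro x hx
    apply ContinuousAt.continuousWithinAt
    rcases hx with hx | hx
    · refine (hs.continuousAt (hU.mem_nhds hx)).congr ?_
      filter_upwards [hU.mem_nhds hx] with y hy
      simp [hy]
    · refine (ht.continuousAt (hV.mem_nhds hx)).congr ?_
      filter_upwards [hV.mem_nhds hx] with y hy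
      by_cases h : y ∈ U
      · simp [h, hst y ⟨h, hy⟩]
      · simp [h]
  · intro y hy
    by_cases h : y ∈ U
    · simp [h, hs2 y h]
    · simp [h, ht2 y (hy.resolve_left h)]

end basics

theorem ladder (Q : ℝ → ℝ → Prop) (mono : ∀ a b a' b', Q a b → a ≤ a' → b' ≤ b → Q a' b')
    (glue : ∀ a b c d, Q a b → Q c d → a ≤ c → c < b → b ≤ d → Q a d)
    (loc : ∀ x, ∃ ε > 0, Q (x - ε) (x + ε)) (a b : ℝ) : Q a b := by
  by_contra hab
  have hne : {b | Q a b}.Nonempty := by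
    obtain ⟨ε, hε, h⟩ := loc a
    exact ⟨a + ε, mono _ _ _ _ h (by linarith) le_rfl⟩
  have hbd : BddAbove {b | Q a b} := by
    refine ⟨b, fun c hc => ?_⟩
    by_contra h
    exact hab (mono _ _ _ _ hc le_rfl (by linarith))
  obtain ⟨ε, hε, h⟩ := loc (sSup {b | Q a b})
  set c := sSup {b | Q a b} with hc
  obtain ⟨d, hd, hdc⟩ := exists_lt_of_lt_csSup hne (show c - ε < c by linarith)
  have hdc' : d ≤ c := le_csSup hbd hd
  have : Q a (c + ε) := by
    rcases le_total a (c - ε) with h' | h'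
    · exact glue _ _ _ _ hd h h' hdc (by linarith)
    · exact mono _ _ _ _ h h' le_rfl
  have := le_csSup hbd this
  linarith

/-- open rectangle -/
def Rect (a b c d : ℝ) : Set ℂ := {z | (a < z.re ∧ z.re < b) ∧ (c < z.im ∧ z.im < d)}

theorem rect_isOpen (a b c d : ℝ) : IsOpen (Rect a b c d) := by
  have h1 := Complex.continuous_re
  have h2 := Complex.continuous_im
  exact ((isOpen_lt continuous_const h1).inter (isOpen_lt h1 continuous_const)).inter
    ((isOpen_lt continuous_const h2).inter (isOpen_lt h2 continuous_const))

theorem rect_convex (a b c d : ℝ) : Convex ℝ (Rect a b c d) := by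
  have : Rect a b c d = (Complex.reLm ⁻¹' (Ioo a b)) ∩ (Complex.imLm ⁻¹' (Ioo c d)) := by
    ext; simp [Rect]
  rw [this]
  exact ((convex_Ioo a b).linear_preimage _).inter ((convex_Ioo c d).linear_preimage _)

theorem rect_preconn (a b c d : ℝ) : IsPreconnected (Rect a b c d) :=
  (rect_convex a b c d).isPreconnected

theorem rect_nhds {z : ℂ} {U : Set ℂ} (hU : U ∈ 𝓝 z) :
    ∃ ε > 0, Rect (z.re - ε) (z.re + ε) (z.im - ε) (z.im + ε) ⊆ U := by
  obtain ⟨r, hr, h⟩ := Metric.mem_nhds_iff.1 hU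
  refine ⟨r / 2, by positivity, fun w hw => h ?_⟩
  rw [Metric.mem_ball, Complex.dist_eq]
  refine (Complex.norm_le_abs_re_add_abs_im _).trans_lt ?_
  obtain ⟨⟨h1, h2⟩, h3, h4⟩ := hw
  have : |(w - z).re| < r / 2 := by rw [abs_lt, Complex.sub_re]; constructor <;> linarith
  have : |(w - z).im| < r / 2 := by rw [abs_lt, Complex.sub_im]; constructor <;> linarith
  linarith

theorem sq_rect {φ : ℂ → ℂ} (hφ : Good φ) (he : ∀ z, EvenAt φ z) (a b c d : ℝ) :
    Sq φ (Rect a b c d) := by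
  have st1 : ∀ y a b : ℝ, ∃ ε > 0, Sq φ (Rect a b (y - ε) (y + ε)) := by
    intro y
    refine ladder _ ?_ ?_ ?_
    · rintro a b a' b' ⟨ε, hε, h⟩ h1 h2
      exact ⟨ε, hε, h.mono fun z hz => ⟨⟨by linarith [hz.1.1], by linarith [hz.1.2]⟩, hz.2⟩⟩
    · rintro a b c d ⟨ε, hε, h⟩ ⟨ε', hε', h'⟩ h1 h2 h3
      refine ⟨min ε ε', lt_min hε hε', ?_⟩
      have m1 := min_le_left ε ε'
      have m2 := min_le_right ε ε'
      have := sq_glue surf_complex hφ (rect_isOpen a b (y - min ε ε') (y + min ε ε'))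
        (rect_isOpen c d (y - min ε ε') (y + min ε ε')) ?_
        (h.mono fun z hz => ⟨hz.1, by linarith [hz.2.1], by linarith [hz.2.2]⟩)
        (h'.mono fun z hz => ⟨hz.1, by linarith [hz.2.1], by linarith [hz.2.2]⟩)
      · refine this.mono fun z hz => ?_
        rcases lt_or_ge z.re b with h | h
        · exact Or.inl ⟨⟨hz.1.1, h⟩, hz.2⟩
        · exact Or.inr ⟨⟨by linarith, hz.1.2⟩, hz.2⟩
      · convert rect_preconn c b (y - min ε ε') (y + min ε ε') using 1
        ext z
        simp only [Rect, mem_inter_iff, mem_ofPred_eq]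
        constructor
        · rintro ⟨⟨⟨_, _⟩, _⟩, ⟨⟨_, _⟩, _⟩⟩
          exact ⟨⟨by linarith, by linarith⟩, by assumption⟩
        · rintro ⟨⟨_, _⟩, _⟩
          exact ⟨⟨⟨by linarith, by linarith⟩, by assumption⟩,
            ⟨⟨by linarith, by linarith⟩, by assumption⟩⟩
    · intro x
      obtain ⟨U, hU, h⟩ := he ⟨x, y⟩
      obtain ⟨ε, hε, h'⟩ := rect_nhds hU
      exact ⟨ε, hε, ε, hε, h.mono h'⟩
  refine ladder (fun c d => Sq φ (Rect a b c d)) ?_ ?_ ?_ c d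
  · rintro c d c' d' h h1 h2
    exact h.mono fun z hz => ⟨hz.1, by linarith [hz.2.1], by linarith [hz.2.2]⟩
  · rintro a' b' c d h h' h1 h2 h3
    have := sq_glue surf_complex hφ (rect_isOpen _ _ _ _) (rect_isOpen _ _ _ _) ?_ h h'
    · refine this.mono fun z hz => ?_
      rcases lt_or_ge z.im b' with h | h
      · exact Or.inl ⟨hz.1, hz.2.1, h⟩
      · exact Or.inr ⟨hz.1, by linarith, hz.2.2⟩
    · convert rect_preconn a b c b' using 1
      ext z
      simp only [Rect, mem_inter_iff, mem_ofPred_eq]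
      constructor
      · rintro ⟨⟨_, _, _⟩, ⟨_, _, _⟩⟩
        exact ⟨by assumption, by linarith, by linarith⟩
      · rintro ⟨_, _, _⟩
        exact ⟨⟨by assumption, by linarith, by linarith⟩, ⟨by assumption, by linarith, by linarith⟩⟩
  · intro y; exact st1 y a b

/-- P1: an everywhere even function on the plane has a global square root. -/
theorem sq_plane {φ : ℂ → ℂ} (hφ : Good φ) (he : ∀ z, EvenAt φ z) :
    ∃ s : ℂ → ℂ, Continuous s ∧ ∀ z, s z ^ 2 = φ z := by
  let R : ℕ → Set ℂ := fun n => Rect (-(n + 1)) (n + 1) (-(n + 1)) (n + 1)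
  have hRmono : ∀ n m, n ≤ m → R n ⊆ R m := by
    intro n m h z hz
    have : (n : ℝ) ≤ m := by exact_mod_cast h
    exact ⟨⟨by linarith [hz.1.1], by linarith [hz.1.2]⟩, by linarith [hz.2.1], by linarith [hz.2.2]⟩
  have hRo : ∀ n, IsOpen (R n) := fun n => rect_isOpen _ _ _ _
  obtain ⟨z0, hz0, hz0'⟩ : ∃ z0 ∈ R 0, φ z0 ≠ 0 := by
    have h0 : (0 : ℂ) ∈ R 0 := by simp [R, Rect]
    obtain ⟨z, -, hz⟩ := mem_closure_iff_nhds.1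
      (subset_closure_diff_finite surf_complex (hRo 0) hφ.2 h0) univ univ_mem
    exact ⟨z, hz.1, hz.2⟩
  obtain ⟨w0, hw0⟩ : ∃ w0 : ℂ, w0 ^ 2 = φ z0 :=
    IsAlgClosed.exists_pow_nat_eq _ (by norm_num)
  have hw : w0 ≠ 0 := by rintro rfl; exact hz0' (by simp [← hw0])
  have key : ∀ n, ∃ s : ℂ → ℂ, ContinuousOn s (R n) ∧ (∀ z ∈ R n, s z ^ 2 = φ z) ∧ s z0 = w0 := by
    intro n
    obtain ⟨s, h1, h2⟩ := sq_rect hφ he (-(n + 1)) (n + 1) (-(n + 1)) (n + 1)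
    have : s z0 ^ 2 = w0 ^ 2 := by rw [h2 z0 (hRmono 0 n (Nat.zero_le _) hz0), hw0]
    rcases sq_eq_sq_iff_eq_or_eq_neg.1 this with h | h
    · exact ⟨s, h1, h2, h⟩
    · exact ⟨-s, h1.neg, fun z hz => by simpa using h2 z hz, by simp [h]⟩
  choose s hs hs2 hs0 using key
  have hcomp : ∀ n m, n ≤ m → ∀ z ∈ R n, s m z = s n z := by
    intro n m hnm
    rcases rigid surf_complex (hRo n) (rect_preconn _ _ _ _) hφ.2 ((hs m).mono (hRmono n m hnm))
      (hs n) (fun y hy => by rw [hs2 m y (hRmono n m hnm hy), hs2 n y hy])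
      (fun y hy h => by simp [← hs2 n y hy, h]) with h | h
    · exact h
    · have := h z0 (hRmono 0 n (Nat.zero_le _) hz0)
      rw [hs0, hs0, self_eq_neg] at this
      exact absurd this hw
  have hin : ∀ z : ℂ, z ∈ R ⌈‖z‖⌉₊ := by
    intro z
    have h1 := Nat.le_ceil ‖z‖
    have h2 := abs_le.1 (Complex.abs_re_le_norm z)
    have h3 := abs_le.1 (Complex.abs_im_le_norm z)
    exact ⟨⟨by linarith, by linarith⟩, by linarith, by linarith⟩
  have hall : ∀ n z, z ∈ R n → s ⌈‖z‖⌉₊ z = s n z := by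
    intro n z hz
    rcases le_total n ⌈‖z‖⌉₊ with h | h
    · exact hcomp _ _ h z hz
    · exact (hcomp _ _ h z (hin z)).symm
  refine ⟨fun z => s ⌈‖z‖⌉₊ z, ?_, fun z => hs2 _ z (hin z)⟩
  rw [continuous_iff_continuousAt]
  intro z
  refine ((hs ⌈‖z‖⌉₊).continuousAt ((hRo _).mem_nhds (hin z))).congr ?_
  filter_upwards [(hRo _).mem_nhds (hin z)] with y hy
  exact (hall _ y hy).symm

end SurfUB

namespace SurfUB
open Set Filter Topology

section parity
variable {X : Type*} [TopologicalSpace X]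

theorem EvenAt.exists_open {φ : X → ℂ} {x : X} (h : EvenAt φ x) :
    ∃ U, IsOpen U ∧ x ∈ U ∧ Sq φ U := by
  obtain ⟨U, hU, h⟩ := h
  obtain ⟨V, hVU, hV, hx⟩ := mem_nhds_iff.1 hU
  exact ⟨V, hV, hx, h.mono hVU⟩

theorem EvenAt.congr {φ ψ : X → ℂ} {x : X} (h : EvenAt φ x) (he : φ =ᶠ[𝓝 x] ψ) : EvenAt ψ x := by
  obtain ⟨U, hU, s, hs, hs2⟩ := h
  refine ⟨U ∩ {y | φ y = ψ y}, inter_mem hU he, s, hs.mono inter_subset_left, ?_⟩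
  intro y hy
  rw [hs2 y hy.1]; exact hy.2

theorem evenAt_congr {φ ψ : X → ℂ} {x : X} (he : φ =ᶠ[𝓝 x] ψ) : EvenAt φ x ↔ EvenAt ψ x :=
  ⟨fun h => h.congr he, fun h => h.congr he.symm⟩

theorem evenAt_of_ne {φ : X → ℂ} (hφ : Continuous φ) {x : X} (hx : φ x ≠ 0) : EvenAt φ x := by
  obtain ⟨w, hw⟩ : ∃ w : ℂ, w ^ 2 = φ x := IsAlgClosed.exists_pow_nat_eq _ (by norm_num)
  have hc : Continuous fun y => φ y / φ x := hφ.div_const _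
  refine ⟨{y | φ y / φ x ∈ Complex.slitPlane}, ?_, fun y => w * Complex.exp
    (Complex.log (φ y / φ x) / 2), ?_, ?_⟩
  · apply hc.continuousAt.preimage_mem_nhds
    apply Complex.isOpen_slitPlane.mem_nhds
    simp [div_self hx]
  · intro y hy
    apply ContinuousAt.continuousWithinAt
    have : ContinuousAt (fun y => Complex.log (φ y / φ x)) y := hc.continuousAt.clog hy
    fun_prop
  · intro y hy
    rw [mul_pow, hw, ← Complex.exp_nat_mul]
    have : φ y / φ x ≠ 0 := Complex.slitPlane_ne_zero hy
    rw [show ((2 : ℕ) : ℂ) * (Complex.log (φ y / φ x) / 2) = Complex.log (φ y / φ x) by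
      push_cast; ring, Complex.exp_log this]
    field_simp

theorem zero_of_not_evenAt {φ : X → ℂ} (hφ : Continuous φ) {x : X} (h : ¬ EvenAt φ x) : φ x = 0 := by
  by_contra hx; exact h (evenAt_of_ne hφ hx)

theorem EvenAt.mul {φ ψ : X → ℂ} {x : X} (h : EvenAt φ x) (h' : EvenAt ψ x) :
    EvenAt (fun y => φ y * ψ y) x := by
  obtain ⟨U, hU, s, hs, hs2⟩ := h
  obtain ⟨V, hV, t, ht, ht2⟩ := h'
  refine ⟨U ∩ V, inter_mem hU hV, fun y => s y * t y,
    (hs.mono inter_subset_left).mul (ht.mono inter_subset_right), fun y hy => ?_⟩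
  rw [mul_pow, hs2 y hy.1, ht2 y hy.2]

theorem continuousAt_of_sq_zero {s φ : X → ℂ} {x : X} (hφ : ContinuousAt φ x) (h0 : φ x = 0)
    (h : ∀ᶠ y in 𝓝 x, s y ^ 2 = φ y) : ContinuousAt s x := by
  have hs0 : s x = 0 := by
    have := h.self_of_nhds
    rw [h0] at this
    exact pow_eq_zero_iff (two_ne_zero) |>.1 this
  have h1 : Tendsto (fun y => Real.sqrt ‖φ y‖) (𝓝 x) (𝓝 0) := by
    have : ContinuousAt (fun y => Real.sqrt ‖φ y‖) x := by fun_prop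
    simpa [ContinuousAt, h0] using this
  rw [ContinuousAt, hs0, tendsto_zero_iff_norm_tendsto_zero]
  refine h1.congr' ?_
  filter_upwards [h] with y hy
  rw [← hy, norm_pow, Real.sqrt_sq (norm_nonneg _)]

theorem Good.ne_nhds [T2Space X] {φ : X → ℂ} (hφ : Good φ) (x : X) :
    ∃ U, IsOpen U ∧ x ∈ U ∧ ∀ y ∈ U, y ≠ x → φ y ≠ 0 := by
  refine ⟨({y | φ y = 0} \ {x})ᶜ, (hφ.2.subset sdiff_subset).isClosed.isOpen_compl, by simp, ?_⟩
  intro y hy hyx h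
  exact hy ⟨h, hyx⟩

theorem Good.mul {φ ψ : X → ℂ} (h : Good φ) (h' : Good ψ) : Good (fun y => φ y * ψ y) := by
  refine ⟨h.1.mul h'.1, (h.2.union h'.2).subset ?_⟩
  intro y hy
  exact mul_eq_zero.1 hy

theorem good_one : Good (fun _ : X => (1 : ℂ)) := ⟨continuous_const, by simp⟩

theorem Good.prod {α : Type*} (F : Finset α) {φ : α → X → ℂ} (h : ∀ i ∈ F, Good (φ i)) :
    Good (fun y => ∏ i ∈ F, φ i y) := by
  classical
  induction F using Finset.induction_on with
  | empty => simpa using good_one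
  | insert a s ha ih =>
    simp only [Finset.prod_insert ha]
    exact (h a (by simp)).mul (ih fun i hi => h i (by simp [hi]))

theorem evenAt_div [T2Space X] {φ ψ : X → ℂ} (hφ : Good φ) (hψ : Good ψ) {x : X}
    (h : EvenAt ψ x) (h' : EvenAt (fun y => φ y * ψ y) x) : EvenAt φ x := by
  classical
  by_cases hx : φ x = 0
  swap
  · exact evenAt_of_ne hφ.1 hx
  obtain ⟨U, hU, hxU, s, hs, hs2⟩ := h.exists_open
  obtain ⟨V, hV, hxV, t, ht, ht2⟩ := h'.exists_open
  obtain ⟨W, hW, hxW, hW0⟩ := hψ.ne_nhds x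
  have hO : IsOpen (U ∩ V ∩ W) := (hU.inter hV).inter hW
  have hsne : ∀ y ∈ U ∩ V ∩ W, y ≠ x → s y ≠ 0 := by
    intro y hy hyx h0
    apply hW0 y hy.2 hyx
    rw [← hs2 y hy.1.1, h0]; simp
  have hsq : ∀ y ∈ U ∩ V ∩ W, (if y = x then 0 else t y / s y) ^ 2 = φ y := by
    intro y hy
    by_cases hyx : y = x
    · simp [hyx, hx]
    · have := hsne y hy hyx
      have h2 := hW0 y hy.2 hyx
      rw [if_neg hyx, div_pow, ht2 y hy.1.2, hs2 y hy.1.1, mul_div_cancel_right₀ _ h2]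
  refine ⟨U ∩ V ∩ W, hO.mem_nhds ⟨⟨hxU, hxV⟩, hxW⟩,
    fun y => if y = x then 0 else t y / s y, ?_, hsq⟩
  intro y hy
  apply ContinuousAt.continuousWithinAt
  by_cases hyx : y = x
  · subst hyx
    refine continuousAt_of_sq_zero hφ.1.continuousAt hx ?_
    filter_upwards [hO.mem_nhds hy] with z hz using hsq z hz
  · have h1 := ht.continuousAt (hV.mem_nhds hy.1.2)
    have h2 := hs.continuousAt (hU.mem_nhds hy.1.1)
    refine (h1.div h2 (hsne y hy hyx)).congr ?_
    filter_upwards [isOpen_ne.mem_nhds hyx] with z hz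
    simp [if_neg hz]

theorem evenAt_comp {Y : Type*} [TopologicalSpace Y] [Nonempty Y] {ι : Y → X}
    (hι : IsOpenEmbedding ι) (φ : X → ℂ) (z : Y) : EvenAt (fun w => φ (ι w)) z ↔ EvenAt φ (ι z) := by
  constructor
  · intro h
    obtain ⟨U, hU, hz, s, hs, hs2⟩ := h.exists_open
    have hli := Function.leftInverse_invFun hι.injective
    refine ⟨ι '' U, (hι.isOpenMap U hU).mem_nhds ⟨z, hz, rfl⟩, s ∘ Function.invFun ι, ?_, ?_⟩
    · rintro _ ⟨w, hw, rfl⟩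
      apply ContinuousAt.continuousWithinAt
      rw [← hι.continuousAt_iff]
      refine (hs.continuousAt (hU.mem_nhds hw)).congr ?_
      filter_upwards with y
      simp [hli y]
    · rintro _ ⟨w, hw, rfl⟩
      simp [hli w, hs2 w hw]
  · rintro ⟨U, hU, s, hs, hs2⟩
    refine ⟨ι ⁻¹' U, hι.continuous.continuousAt.preimage_mem_nhds hU, s ∘ ι,
      hs.comp hι.continuous.continuousOn (fun _ h => h), fun y hy => hs2 _ hy⟩

end parity

/-- A continuous periodic function on the `w = log z` plane descends. -/
theorem sq_descend {φ : ℂ → ℂ} (hφ : Continuous φ) (h0 : φ 0 = 0) {S : ℂ → ℂ} (hS : Continuous S)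
    (hper : Function.Periodic S (2 * Real.pi * Complex.I)) (hS2 : ∀ w, S w ^ 2 = φ (Complex.exp w)) :
    EvenAt φ 0 := by
  have hinv : ∀ w w', Complex.exp w = Complex.exp w' → S w = S w' := by
    intro w w' h
    obtain ⟨n, hn⟩ := Complex.exp_eq_exp_iff_exists_int.1 h
    rw [hn]
    exact (hper.int_mul n) w'
  have hsq : ∀ z, (if z = 0 then 0 else S (Complex.log z)) ^ 2 = φ z := by
    intro z
    by_cases hz : z = 0
    · simp [hz, h0]
    · simp [hz, hS2, Complex.exp_log hz]
  refine ⟨univ, univ_mem, fun z => if z = 0 then 0 else S (Complex.log z), ?_, fun z _ => hsq z⟩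
  rw [continuousOn_univ, continuous_iff_continuousAt]
  intro z
  by_cases hz : z = 0
  · subst hz
    exact continuousAt_of_sq_zero hφ.continuousAt h0 (Eventually.of_forall hsq)
  by_cases hz' : z ∈ Complex.slitPlane
  · refine (hS.continuousAt.comp (continuousAt_id.clog hz')).congr ?_
    filter_upwards [isOpen_ne.mem_nhds hz] with y hy
    simp [if_neg hy]
  · have hz2 : -z ∈ Complex.slitPlane := by
      rw [Complex.mem_slitPlane_iff] at hz' ⊢
      push Not at hz'
      left
      simp only [Complex.neg_re, Left.neg_pos_iff]
      refine lt_of_le_of_ne hz'.1 fun h => hz (Complex.ext h hz'.2)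
    have : ContinuousAt (fun y : ℂ => S (Complex.log (-y) + Real.pi * Complex.I)) z := by
      refine hS.continuousAt.comp ?_
      exact (continuousAt_id.neg.clog hz2).add continuousAt_const
    refine this.congr ?_
    filter_upwards [isOpen_ne.mem_nhds hz] with y hy
    rw [if_neg hy]
    apply hinv
    rw [Complex.exp_add, Complex.exp_log (neg_ne_zero.2 hy), Complex.exp_log hy,
      Complex.exp_pi_mul_I]
    ring

theorem classify {φ : ℂ → ℂ} (hφ : Continuous φ) (hne : ∀ z, z ≠ 0 → φ z ≠ 0) :
    EvenAt φ 0 ∨ EvenAt (fun z => φ z * z) 0 := by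
  by_cases h0 : φ 0 = 0
  swap
  · exact Or.inl (evenAt_of_ne hφ h0)
  have hc : Continuous fun w => φ (Complex.exp w) := hφ.comp Complex.continuous_exp
  have hne' : ∀ w, φ (Complex.exp w) ≠ 0 := fun w => hne _ (Complex.exp_ne_zero w)
  obtain ⟨S, hS, hS2⟩ := sq_plane (φ := fun w => φ (Complex.exp w))
    ⟨hc, by simp [hne']⟩ (fun z => evenAt_of_ne hc (hne' z))
  have hexp : ∀ w, Complex.exp (w + 2 * Real.pi * Complex.I) = Complex.exp w := fun w =>
    Complex.exp_periodic w
  rcases rigid surf_complex isOpen_univ isPreconnected_univ finite_empty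
    (s := fun w => S (w + 2 * Real.pi * Complex.I)) (t := S) (by fun_prop) hS.continuousOn
    (fun y _ => by rw [hS2, hS2, hexp]) (fun y _ h => by
      exact (hne' y (by rw [← hS2, h]; simp)).elim) with h | h
  · left
    exact sq_descend hφ h0 hS (fun w => h w trivial) hS2
  · right
    refine sq_descend (S := fun w => S w * Complex.exp (w / 2)) (hφ.mul continuous_id) (by simp)
      (by fun_prop) ?_ ?_
    · intro w
      have h1 := h w trivial
      simp only at h1 ⊢
      rw [h1, show (w + 2 * Real.pi * Complex.I) / 2 = w / 2 + Real.pi * Complex.I by ring,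
        Complex.exp_add, Complex.exp_pi_mul_I]
      ring
    · intro w
      rw [mul_pow, hS2, ← Complex.exp_nat_mul]
      congr 2
      push_cast; ring

section parity2
variable {X : Type*} [TopologicalSpace X] [T2Space X]

theorem good_id : Good (fun z : ℂ => z) := ⟨continuous_id, by simp⟩

theorem Good.comp {Y : Type*} [TopologicalSpace Y] {ι : Y → X} (hι : IsOpenEmbedding ι) {φ : X → ℂ}
    (hφ : Good φ) : Good (fun w => φ (ι w)) :=
  ⟨hφ.1.comp hι.continuous, hφ.2.preimage hι.injective.injOn⟩

theorem evenAt_mul_odd (hX : Surf X) {φ ψ : X → ℂ} (hφ : Good φ) (hψ : Good ψ) {x : X}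
    (h : ¬ EvenAt φ x) (h' : ¬ EvenAt ψ x) : EvenAt (fun y => φ y * ψ y) x := by
  obtain ⟨U, hU, hxU, hU0⟩ := hφ.ne_nhds x
  obtain ⟨V, hV, hxV, hV0⟩ := hψ.ne_nhds x
  obtain ⟨ι, hι, h0, hr⟩ := hX x (U ∩ V) ((hU.inter hV).mem_nhds ⟨hxU, hxV⟩)
  subst h0
  have hne : ∀ z, z ≠ 0 → ι z ≠ ι 0 := fun z hz h => hz (hι.injective h)
  have c1 := (classify (φ := fun w => φ (ι w)) (hφ.comp hι).1 (fun z hz =>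
    hU0 _ (hr ⟨z, rfl⟩).1 (hne z hz))).resolve_left (by rwa [evenAt_comp hι])
  have c2 := (classify (φ := fun w => ψ (ι w)) (hψ.comp hι).1 (fun z hz =>
    hV0 _ (hr ⟨z, rfl⟩).2 (hne z hz))).resolve_left (by rwa [evenAt_comp hι])
  rw [← evenAt_comp hι]
  refine evenAt_div (hφ.mul hψ |>.comp hι) (good_id.mul good_id) (x := 0) ?_ ?_
  · exact ⟨univ, univ_mem, id, continuousOn_id, fun y _ => by simp [sq]⟩
  · refine (c1.mul c2).congr (Eventually.of_forall fun z => ?_)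
    simp only; ring

theorem evenAt_mul_iff (hX : Surf X) {φ ψ : X → ℂ} (hφ : Good φ) (hψ : Good ψ) (x : X) :
    EvenAt (fun y => φ y * ψ y) x ↔ (EvenAt φ x ↔ EvenAt ψ x) := by
  constructor
  · intro h
    constructor
    · intro h1
      refine evenAt_div hψ hφ h1 (h.congr (Eventually.of_forall fun y => mul_comm _ _))
    · intro h1
      exact evenAt_div hφ hψ h1 h
  · intro h
    by_cases h1 : EvenAt φ x
    · exact h1.mul (h.1 h1)
    · exact evenAt_mul_odd hX hφ hψ h1 (fun h2 => h1 (h.2 h2))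

theorem evenAt_one (x : X) : EvenAt (fun _ : X => (1 : ℂ)) x :=
  evenAt_of_ne continuous_const one_ne_zero

open Classical in
theorem evenAt_prod_iff {α : Type*} (hX : Surf X) (F : Finset α) {φ : α → X → ℂ}
    (h : ∀ i ∈ F, Good (φ i)) (x : X) :
    EvenAt (fun y => ∏ i ∈ F, φ i y) x ↔ Even (F.filter fun i => ¬ EvenAt (φ i) x).card := by
  induction F using Finset.induction_on with
  | empty => simpa using evenAt_one x
  | insert a s ha ih =>
    simp only [Finset.prod_insert ha]
    have hs : ∀ i ∈ s, Good (φ i) := fun i hi => h i (by simp [hi])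
    rw [evenAt_mul_iff hX (h a (by simp)) (Good.prod s hs), ih hs, Finset.filter_insert]
    by_cases h1 : EvenAt (φ a) x
    · simp [h1]
    · simp only [h1, false_iff, not_false_eq_true, if_true]
      rw [Finset.card_insert_of_notMem (by simp [ha]), Nat.even_add_one]

end parity2

theorem no_root (c : ℝ → ℂ) (hc : Continuous c) (hp : c (2 * Real.pi) = c 0)
    (h2 : ∀ θ : ℝ, c θ ^ 2 = Complex.exp (θ * Complex.I)) : False := by
  have hne : ∀ θ : ℝ, Complex.exp (θ / 2 * Complex.I) ≠ 0 := fun θ => Complex.exp_ne_zero _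
  have h3 : Complex.exp ((2 * Real.pi : ℝ) / 2 * Complex.I) = -1 := by
    rw [← Complex.exp_pi_mul_I]; congr 1; push_cast; ring
  have hc0 : c 0 ≠ 0 := by
    intro h; have := h2 0; rw [h] at this; simp at this
  rcases isPreconnected_univ.eq_or_eq_neg_of_sq_eq (f := c)
    (g := fun θ : ℝ => Complex.exp (θ / 2 * Complex.I)) hc.continuousOn
    (by fun_prop) (fun θ _ => by
      simp only [Pi.pow_apply]
      rw [h2, ← Complex.exp_nat_mul]; congr 1; push_cast; ring) (fun {θ} _ => hne θ) with h | h
  · have a := h (mem_univ (2 * Real.pi))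
    have b := h (mem_univ 0)
    simp only at a b
    rw [h3, hp, b] at a
    simp at a
    norm_num [Complex.ext_iff] at a
  · have a := h (mem_univ (2 * Real.pi))
    have b := h (mem_univ 0)
    simp only [Pi.neg_apply] at a b
    rw [h3, hp, b] at a
    simp at a
    norm_num [Complex.ext_iff] at a

theorem no_root_odd (m : ℕ) (hm : Odd m) (c : ℝ → ℂ) (hc : Continuous c)
    (hp : c (2 * Real.pi) = c 0)
    (h2 : ∀ θ : ℝ, c θ ^ 2 = Complex.exp (θ * Complex.I) ^ m) : False := by
  obtain ⟨l, rfl⟩ := hm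
  refine no_root (fun θ => c θ * Complex.exp (-(θ * Complex.I)) ^ l) (by fun_prop) ?_ ?_
  · show _ = _
    rw [hp]; congr 2
    rw [show -(((2 * Real.pi : ℝ) : ℂ) * Complex.I) = -(2 * Real.pi * Complex.I) by push_cast; ring,
      Complex.exp_neg, Complex.exp_two_pi_mul_I]
    simp
  · intro θ
    rw [mul_pow, h2, Complex.exp_neg, inv_pow, inv_pow, pow_succ, ← pow_mul, mul_comm l 2]
    have := Complex.exp_ne_zero (θ * Complex.I)
    field_simp

theorem odd_linear (a : ℂ) : ¬ EvenAt (fun z : ℂ => z - a) a := by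
  rintro ⟨U, hU, s, hs, hs2⟩
  obtain ⟨r, hr, hrU⟩ := Metric.mem_nhds_iff.1 hU
  have hmem : ∀ θ : ℝ, a + (r / 2 : ℝ) * Complex.exp (θ * Complex.I) ∈ U := by
    intro θ
    apply hrU
    rw [Metric.mem_ball, dist_eq_norm, add_sub_cancel_left, norm_mul, Complex.norm_exp_ofReal_mul_I,
      mul_one, Complex.norm_real, Real.norm_eq_abs, abs_of_pos (by positivity)]
    linarith
  refine no_root (fun θ => s (a + (r / 2 : ℝ) * Complex.exp (θ * Complex.I)) / (Real.sqrt (r/2) : ℝ))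
    ?_ ?_ ?_
  · refine Continuous.div_const ?_ _
    exact hs.comp_continuous (by fun_prop) hmem
  · show _ = _
    congr 4
    push_cast
    rw [Complex.exp_two_pi_mul_I]; simp
  · intro θ
    rw [div_pow, hs2 _ (hmem θ)]
    beta_reduce
    rw [add_sub_cancel_left, ← Complex.ofReal_pow,
      Real.sq_sqrt (by positivity)]
    have : ((r / 2 : ℝ) : ℂ) ≠ 0 := by
      rw [Complex.ofReal_ne_zero]; positivity
    field_simp

theorem good_linear (a : ℂ) : Good (fun z : ℂ => z - a) :=
  ⟨by fun_prop, by simp [sub_eq_zero]⟩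

theorem evenAt_linear (a z : ℂ) : EvenAt (fun z : ℂ => z - a) z ↔ z ≠ a := by
  constructor
  · rintro h rfl; exact odd_linear _ h
  · intro h; exact evenAt_of_ne (good_linear a).1 (sub_ne_zero.2 h)

def OddSet {X : Type*} [TopologicalSpace X] (φ : X → ℂ) : Set X := {x | ¬ EvenAt φ x}

theorem Good.oddSet_finite {X : Type*} [TopologicalSpace X] {φ : X → ℂ} (h : Good φ) :
    (OddSet φ).Finite := h.2.subset fun _ hx => zero_of_not_evenAt h.1 hx

def NonnegC (z : ℂ) : Prop := 0 ≤ z.re ∧ z.im = 0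

theorem NonnegC.eq {z : ℂ} (h : NonnegC z) : z = ((‖z‖ : ℝ) : ℂ) := by
  have : z = (z.re : ℂ) := Complex.ext rfl (by simp [h.2])
  rw [this, Complex.norm_real, Real.norm_eq_abs, abs_of_nonneg h.1]

/-- one chart version of the parity theorem -/
theorem even_plane {g : ℂ → ℂ} (hg : Good g) (R0 : ℝ) (hR0 : ∀ z, R0 ≤ ‖z‖ → NonnegC (g z)) :
    Even (OddSet g).ncard := by
  classical
  have hfin := hg.oddSet_finite
  set F := hfin.toFinset with hF
  have hP : Good (fun z => ∏ a ∈ F, (z - a)) := Good.prod F (fun a _ => good_linear a)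
  have hPe : ∀ z, EvenAt (fun z => ∏ a ∈ F, (z - a)) z ↔ EvenAt g z := by
    intro z
    rw [evenAt_prod_iff surf_complex F (fun a _ => good_linear a)]
    have : (F.filter fun a => ¬ EvenAt (fun z : ℂ => z - a) z) = if z ∈ F then {z} else ∅ := by
      ext a
      simp only [Finset.mem_filter, evenAt_linear, not_not]
      split_ifs with h
      · simp only [Finset.mem_singleton]
        constructor
        · exact fun h => h.2.symm
        · rintro rfl; exact ⟨h, rfl⟩
      · simp only [Finset.notMem_empty, iff_false]
        rintro ⟨h1, rfl⟩; exact h h1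
    rw [this]
    split_ifs with h
    · have : ¬ EvenAt g z := by simpa [hF, OddSet] using h
      simp [this]
    · have : EvenAt g z := by simpa [hF, OddSet] using h
      simp [this]
  obtain ⟨s, hs, hs2⟩ := sq_plane (hg.mul hP) (fun z => by
    rw [evenAt_mul_iff surf_complex hg hP, hPe])
  -- choose large radius
  obtain ⟨R, hR1, hR2, hR3⟩ : ∃ R : ℝ, 0 < R ∧ R0 ≤ R ∧ ∀ z, ‖z‖ = R → g z ≠ 0 ∧ ∀ a ∈ F, ‖a‖ < R := by
    obtain ⟨C, hC⟩ := hg.2.isBounded.exists_norm_le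
    refine ⟨max (max R0 C) 0 + 1, by positivity, ?_, ?_⟩
    · have := le_max_left (max R0 C) 0
      have := le_max_left R0 C
      linarith
    · intro z hz
      have h1 : C ≤ max (max R0 C) 0 := (le_max_right R0 C).trans (le_max_left _ _)
      constructor
      · intro h0
        have := hC z h0
        linarith
      · intro a ha
        have h2 : a ∈ OddSet g := by simpa [hF] using ha
        have := hC a (zero_of_not_evenAt hg.1 h2)
        linarith
  have hcard : (OddSet g).ncard = F.card := ncard_eq_toFinset_card _ hfin
  rw [hcard]
  by_contra hodd
  rw [Nat.not_even_iff_odd] at hodd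
  let z : ℝ → ℂ := fun θ => R * Complex.exp (θ * Complex.I)
  have hzc : Continuous z := by fun_prop
  have hzn : ∀ θ, ‖z θ‖ = R := by
    intro θ
    simp only [z]
    rw [norm_mul, Complex.norm_exp_ofReal_mul_I, mul_one, Complex.norm_real, Real.norm_eq_abs,
      abs_of_pos hR1]
  have hz0 : ∀ θ, z θ ≠ 0 := fun θ h => by have := hzn θ; rw [h, norm_zero] at this; linarith
  have hzp : z (2 * Real.pi) = z 0 := by
    simp only [z]; push_cast; rw [Complex.exp_two_pi_mul_I]; simp
  have hsl : ∀ θ, ∀ a ∈ F, 1 - a / z θ ∈ Complex.slitPlane := by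
    intro θ a ha
    rw [Complex.mem_slitPlane_iff]; left
    have h1 : ‖a / z θ‖ < 1 := by
      rw [norm_div, hzn, div_lt_one hR1]; exact (hR3 _ (hzn θ)).2 a ha
    have := (Complex.re_le_norm (a / z θ)).trans_lt h1
    simp only [Complex.sub_re, Complex.one_re]; linarith
  let c : ℂ → ℝ → ℂ := fun a θ => Complex.exp (Complex.log (1 - a / z θ) / 2)
  have hcc : ∀ a ∈ F, Continuous (c a) := by
    intro a ha
    refine Complex.continuous_exp.comp (Continuous.div_const ?_ _)
    exact Continuous.clog (by fun_prop (disch := exact hz0 _)) (fun θ => hsl θ a ha)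
  have hc2 : ∀ a ∈ F, ∀ θ, c a θ ^ 2 = 1 - a / z θ := by
    intro a ha θ
    simp only [c]
    rw [← Complex.exp_nat_mul, show ((2 : ℕ) : ℂ) * (Complex.log (1 - a / z θ) / 2) =
      Complex.log (1 - a / z θ) by push_cast; ring, Complex.exp_log
        (Complex.slitPlane_ne_zero (hsl θ a ha))]
  have hcne : ∀ a θ, c a θ ≠ 0 := fun a θ => Complex.exp_ne_zero _
  let den : ℝ → ℂ := fun θ => (Real.sqrt ‖g (z θ)‖ : ℝ) * (Real.sqrt R : ℝ) ^ F.card * ∏ a ∈ F, c a θ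
  have hden : Continuous den := by
    have h1 : Continuous fun θ => ((Real.sqrt ‖g (z θ)‖ : ℝ) : ℂ) := by
      have := hg.1; fun_prop
    exact (h1.mul continuous_const).mul (continuous_finsetProd _ hcc)
  have hden0 : ∀ θ, den θ ≠ 0 := by
    intro θ
    refine mul_ne_zero (mul_ne_zero ?_ (pow_ne_zero _ ?_)) (Finset.prod_ne_zero_iff.2 fun a _ => hcne a θ)
    · rw [Complex.ofReal_ne_zero, Real.sqrt_ne_zero']
      exact norm_pos_iff.2 (hR3 _ (hzn θ)).1
    · rw [Complex.ofReal_ne_zero, Real.sqrt_ne_zero']; exact hR1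
  refine no_root_odd F.card hodd (fun θ => s (z θ) / den θ) ((hs.comp hzc).div hden hden0) ?_ ?_
  · simp only [den, c]; rw [hzp]
  · intro θ
    have h0 := hden0 θ
    rw [div_pow, hs2, div_eq_iff (pow_ne_zero _ h0)]
    simp only [den]
    rw [mul_pow, mul_pow, ← Finset.prod_pow, Finset.prod_congr rfl (fun a ha => hc2 a ha θ),
      ← Complex.ofReal_pow, Real.sq_sqrt (norm_nonneg _), ← (hR0 (z θ) (by rw [hzn]; exact hR2)).eq,
      ← pow_mul, mul_comm F.card 2, pow_mul, ← Complex.ofReal_pow, Real.sq_sqrt hR1.le]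
    have : ∏ a ∈ F, (z θ - a) = (z θ) ^ F.card * ∏ a ∈ F, (1 - a / z θ) := by
      rw [← Finset.prod_const, ← Finset.prod_mul_distrib]
      refine Finset.prod_congr rfl fun a _ => ?_
      have := hz0 θ
      field_simp
    rw [this]
    simp only [z]
    rw [mul_pow]
    ring

end SurfUB

namespace SurfUB
open Set Filter Topology

theorem perturb_aux {g : ℂ → ℂ} (hg : Continuous g) {δ : ℝ} (hδ : 0 < δ) {K : Set ℂ}
    (hK : IsCompact K) : ∃ p : ℂ → ℂ, Continuous p ∧ (∀ z, ‖p z - g z‖ < δ) ∧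
      {z ∈ K | p z = 0}.Finite := by
  obtain ⟨p, hp, hpg, -⟩ := hg.exists_contDiff_approx (ε := fun _ => δ / 2) 1 continuous_const
    (fun _ => by positivity)
  have hdiff : Differentiable ℝ p := hp.differentiable (by simp)
  let Cr : Set ℂ := {z | (fderiv ℝ p z).det = 0}
  have hm : MeasureTheory.volume (p '' Cr) = 0 :=
    MeasureTheory.addHaar_image_eq_zero_of_det_fderivWithin_eq_zero (f' := fun z => fderiv ℝ p z)
      _ (fun x _ => (hdiff x).hasFDerivAt.hasFDerivWithinAt) (fun x hx => hx)
  obtain ⟨c, hc, hcr⟩ : ∃ c ∈ Metric.ball (0 : ℂ) (δ / 2), c ∉ p '' Cr := by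
    by_contra hcon
    push Not at hcon
    have h1 := MeasureTheory.measure_mono_null (show Metric.ball (0 : ℂ) (δ / 2) ⊆ p '' Cr from hcon) hm
    exact (Metric.measure_ball_pos MeasureTheory.volume (0 : ℂ) (by positivity : 0 < δ / 2)).ne' h1
  refine ⟨fun z => p z - c, hp.continuous.sub continuous_const, ?_, ?_⟩
  · intro z
    have h1 := hpg z
    rw [dist_eq_norm] at h1
    rw [mem_ball_zero_iff] at hc
    calc ‖p z - c - g z‖ = ‖(p z - g z) - c‖ := by ring_nf
      _ ≤ ‖p z - g z‖ + ‖c‖ := norm_sub_le _ _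
      _ < δ := by linarith
  · by_contra hinf
    have hKc : IsCompact {z ∈ K | p z - c = 0} := by
      have : IsClosed {z | p z - c = 0} :=
        isClosed_eq (hp.continuous.sub continuous_const) continuous_const
      exact hK.inter_right this
    obtain ⟨x, hx, hacc⟩ := Set.Infinite.exists_accPt_of_subset_isCompact hinf hKc Subset.rfl
    have hdet : (fderiv ℝ p x).det ≠ 0 := fun h => hcr ⟨x, h, sub_eq_zero.1 hx.2⟩
    have hev := (hdiff x).hasFDerivAt.eventually_ne (c := c)
      ⟨_, ((fderiv ℝ p x).toContinuousLinearEquivOfDetNeZero hdet).antilipschitz⟩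
    rw [accPt_iff_frequently] at hacc
    rw [eventually_nhdsWithin_iff] at hev
    obtain ⟨y, ⟨hy1, hy2⟩, hy3⟩ := (hacc.and_eventually hev).exists
    exact hy3 hy1 (sub_eq_zero.1 hy2.2)

theorem perturb {g : ℂ → ℂ} (hg : Continuous g) {O : Set ℂ} (_hO : IsOpen O)
    (hb : Bornology.IsBounded O) (hfr : ∀ z ∈ frontier O, g z ≠ 0) :
    ∃ g' : ℂ → ℂ, Continuous g' ∧ (∀ z, z ∉ O → g' z = g z) ∧ {z ∈ O | g' z = 0}.Finite := by
  classical
  have hK : IsCompact (closure O) := hb.isCompact_closure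
  have hfrc : IsCompact (frontier O) := hK.of_isClosed_subset isClosed_frontier frontier_subset_closure
  obtain ⟨δ, hδ, hδ'⟩ : ∃ δ > 0, ∀ z ∈ frontier O, δ ≤ ‖g z‖ := by
    rcases (frontier O).eq_empty_or_nonempty with h | h
    · exact ⟨1, one_pos, by simp [h]⟩
    · obtain ⟨z, hz, hmin⟩ := hfrc.exists_isMinOn h hg.norm.continuousOn
      exact ⟨‖g z‖, norm_pos_iff.2 (hfr z hz), fun w hw => hmin hw⟩
  obtain ⟨p, hp, hpg, hpf⟩ := perturb_aux hg (half_pos hδ) hK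
  let χ : ℂ → ℝ := fun z => max 0 (min 1 (2 - 2 * ‖g z‖ / δ))
  have hχ : Continuous χ := by fun_prop
  have hχ0 : ∀ z, δ ≤ ‖g z‖ → χ z = 0 := by
    intro z hz
    have : 1 ≤ ‖g z‖ / δ := (one_le_div hδ).2 hz
    apply max_eq_left
    refine (min_le_right _ _).trans ?_
    rw [mul_div_assoc]; linarith
  have hχ1 : ∀ z, ‖g z‖ ≤ δ / 2 → χ z = 1 := by
    intro z hz
    have : ‖g z‖ / δ ≤ 1 / 2 := by rw [div_le_iff₀ hδ]; linarith
    simp only [χ]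
    rw [min_eq_left, max_eq_right zero_le_one]
    rw [mul_div_assoc]; linarith
  have hχn : ∀ z, ‖(χ z : ℂ)‖ ≤ 1 := by
    intro z
    rw [Complex.norm_real, Real.norm_eq_abs, abs_of_nonneg (le_max_left _ _)]
    exact max_le zero_le_one (min_le_left _ _)
  refine ⟨fun z => if z ∈ O then g z + χ z * (p z - g z) else g z, ?_, fun z hz => by simp [hz], ?_⟩
  · refine Continuous.if ?_ (by fun_prop) hg
    intro z hz
    simp [hχ0 z (hδ' z hz)]
  · refine hpf.subset ?_
    rintro z ⟨hz, hz0⟩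
    simp only [hz, if_true] at hz0
    refine ⟨subset_closure hz, ?_⟩
    rcases le_or_gt ‖g z‖ (δ / 2) with h | h
    · rw [hχ1 z h] at hz0; simpa using hz0
    · exfalso
      have h1 : g z = -(χ z * (p z - g z)) := eq_neg_of_add_eq_zero_left hz0
      have h2 : ‖g z‖ ≤ ‖p z - g z‖ := by
        rw [h1, norm_neg, norm_mul]
        calc _ ≤ 1 * ‖p z - g z‖ := by gcongr; exact hχn z
          _ = _ := by rw [one_mul]; 
          _ ≤ _ := by rw [← h1]
      linarith [hpg z]

section ext
variable {X : Type*} [TopologicalSpace X]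

open Classical in
/-- Transport a function on the chart to the surface, constant outside. -/
noncomputable def ext (ι : ℂ → X) (h : ℂ → ℂ) (c : ℂ) (x : X) : ℂ :=
  if x ∈ range ι then h (Function.invFun ι x) else c

theorem ext_apply {ι : ℂ → X} (hι : Function.Injective ι) (h : ℂ → ℂ) (c z : ℂ) :
    ext ι h c (ι z) = h z := by
  simp [ext, Function.leftInverse_invFun hι z]

theorem ext_off {ι : ℂ → X} (h : ℂ → ℂ) (c : ℂ) {x : X} (hx : x ∉ range ι) :
    ext ι h c x = c := by
  simp only [ext, if_neg hx]

theorem ext_off' {ι : ℂ → X} (hι : Function.Injective ι) (h : ℂ → ℂ) (c : ℂ) {K : Set ℂ}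
    (hK : ∀ z, z ∉ K → h z = c) {x : X} (hx : x ∉ ι '' K) : ext ι h c x = c := by
  by_cases hr : x ∈ range ι
  · obtain ⟨z, rfl⟩ := hr
    rw [ext_apply hι]
    exact hK z fun hz => hx ⟨z, hz, rfl⟩
  · exact ext_off h c hr

theorem ext_continuous [T2Space X] {ι : ℂ → X} (hι : IsOpenEmbedding ι) {h : ℂ → ℂ}
    (hh : Continuous h) {c : ℂ} {K : Set ℂ} (hKc : IsCompact K) (hK : ∀ z, z ∉ K → h z = c) :
    Continuous (ext ι h c) := by
  rw [continuous_iff_continuousAt]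
  intro x
  by_cases hr : x ∈ range ι
  · obtain ⟨z, rfl⟩ := hr
    rw [← hι.continuousAt_iff]
    refine hh.continuousAt.congr (Eventually.of_forall fun w => ?_)
    simp [ext_apply hι.injective]
  · have hcl : IsClosed (ι '' K) := (hKc.image hι.continuous).isClosed
    have hx : x ∉ ι '' K := fun ⟨z, _, hz⟩ => hr ⟨z, hz⟩
    refine (continuousAt_const (y := c)).congr ?_
    filter_upwards [hcl.isOpen_compl.mem_nhds hx] with y hy
    exact (ext_off' hι.injective h c hK hy).symm

theorem evenAt_of_nonneg {φ : X → ℂ} (hφ : Continuous φ) {x : X}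
    (h : ∀ᶠ y in 𝓝 x, NonnegC (φ y)) : EvenAt φ x := by
  refine ⟨_, h, fun y => (Real.sqrt ‖φ y‖ : ℝ), ?_, ?_⟩
  · exact Continuous.continuousOn (by fun_prop)
  · intro y hy
    rw [← Complex.ofReal_pow, Real.sq_sqrt (norm_nonneg _)]
    exact hy.eq.symm

theorem evenAt_conj {φ : X → ℂ} {x : X} (h : EvenAt φ x) :
    EvenAt (fun y => (starRingEnd ℂ) (φ y)) x := by
  obtain ⟨U, hU, s, hs, hs2⟩ := h
  refine ⟨U, hU, fun y => (starRingEnd ℂ) (s y), Complex.continuous_conj.comp_continuousOn hs, ?_⟩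
  intro y hy
  rw [← map_pow, hs2 y hy]

theorem evenAt_conj_iff {φ : X → ℂ} {x : X} :
    EvenAt (fun y => (starRingEnd ℂ) (φ y)) x ↔ EvenAt φ x :=
  ⟨fun h => by simpa using evenAt_conj h, evenAt_conj⟩

end ext

theorem even_symmDiff {α : Type*} {A B : Set α} (hA : A.Finite) (hB : B.Finite) :
    Even (symmDiff A B).ncard ↔ (Even A.ncard ↔ Even B.ncard) := by
  have h1 := ncard_inter_add_ncard_sdiff_eq_ncard A B hA
  have h2 := ncard_inter_add_ncard_sdiff_eq_ncard B A hB
  have h3 : (symmDiff A B).ncard = (A \ B).ncard + (B \ A).ncard := by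
    rw [Set.symmDiff_def]
    exact ncard_union_eq (by
      rw [Set.disjoint_left]; rintro x ⟨h1, h2⟩ ⟨h3, h4⟩; exact h4 h1)
      (hA.subset sdiff_subset) (hB.subset sdiff_subset)
  rw [inter_comm B A] at h2
  rw [h3, ← h1, ← h2]
  simp only [Nat.even_add]
  tauto

theorem oddSet_mul {X : Type*} [TopologicalSpace X] [T2Space X] (hX : Surf X) {φ ψ : X → ℂ}
    (hφ : Good φ) (hψ : Good ψ) :
    OddSet (fun y => φ y * ψ y) = symmDiff (OddSet φ) (OddSet ψ) := by
  ext x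
  simp only [OddSet, mem_ofPred_eq, Set.mem_symmDiff, evenAt_mul_iff hX hφ hψ]
  tauto

theorem fund_aux {M : Type*} [TopologicalSpace M] [T2Space M] [CompactSpace M] (hM : Surf M)
    (L : List (ℂ → M)) : (∀ ι ∈ L, IsOpenEmbedding ι) → ∀ (φ : M → ℂ) (R : ℝ), Good φ →
      (∀ x, (∀ ι ∈ L, x ∉ ι '' Metric.closedBall 0 R) → NonnegC (φ x)) →
      Even (OddSet φ).ncard := by
  induction L with
  | nil =>
    intro _ φ R hφ h
    have : OddSet φ = ∅ := by
      ext x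
      simp only [OddSet, mem_ofPred_eq, mem_empty_iff_false, iff_false, not_not]
      exact evenAt_of_nonneg hφ.1 (Eventually.of_forall fun y => h y (by simp))
    simp [this]
  | cons ι L ih =>
    intro hL φ R hφ hpos
    have hι : IsOpenEmbedding ι := hL ι (by simp)
    have hL' : ∀ κ ∈ L, IsOpenEmbedding κ := fun κ hκ => hL κ (by simp [hκ])
    -- choose the radius
    obtain ⟨ρ, hρR, hρ⟩ : ∃ ρ, R < ρ ∧ ∀ κ ∈ ι :: L, ∀ z : ℂ, ‖z‖ = ρ → φ (κ z) ≠ 0 := by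
      have hfin : (⋃ κ ∈ {κ | κ ∈ ι :: L}, (fun z : ℂ => ‖z‖) '' (κ ⁻¹' {x | φ x = 0})).Finite := by
        refine Set.Finite.biUnion (List.finite_toSet _) fun κ hκ => ?_
        exact (hφ.2.preimage (hL κ hκ).injective.injOn).image _
      obtain ⟨ρ, hρ, hρ'⟩ := (Ioi_infinite R).exists_notMem_finset hfin.toFinset
      refine ⟨ρ, hρ, fun κ hκ z hz h0 => hρ' ?_⟩
      rw [Set.Finite.mem_toFinset]
      simp only [mem_iUnion]
      exact ⟨κ, hκ, z, h0, hz⟩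
    let U : Set M := ⋃ κ ∈ {κ | κ ∈ L}, κ '' Metric.ball 0 ρ
    let V : Set M := ι '' Metric.ball 0 ρ
    have hU : IsOpen U := isOpen_biUnion fun κ hκ => (hL' κ hκ).isOpenMap _ Metric.isOpen_ball
    have hV : IsOpen V := hι.isOpenMap _ Metric.isOpen_ball
    have hclU : closure U ⊆ ⋃ κ ∈ {κ | κ ∈ L}, κ '' Metric.closedBall 0 ρ := by
      apply closure_minimal
      · exact iUnion₂_mono fun κ _ => image_mono Metric.ball_subset_closedBall
      · exact (List.finite_toSet L).isClosed_biUnion fun κ hκ =>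
          ((isCompact_closedBall (0 : ℂ) ρ).image (hL' κ hκ).continuous).isClosed
    have hout : ∀ x, x ∉ U → x ∉ V → NonnegC (φ x) := by
      intro x hxU hxV
      apply hpos
      intro κ hκ
      rintro ⟨z, hz, rfl⟩
      have hz' : z ∈ Metric.ball (0 : ℂ) ρ := Metric.closedBall_subset_ball hρR hz
      rcases List.mem_cons.1 hκ with rfl | h
      · exact hxV ⟨z, hz', rfl⟩
      · exact hxU (mem_biUnion (show κ ∈ {κ | κ ∈ L} from h) ⟨z, hz', rfl⟩)
    -- the extension
    obtain ⟨Ψ, hΨc, hΨU, hΨV⟩ : ∃ Ψ : M → ℂ, Continuous Ψ ∧ (∀ x, x ∉ U → Ψ x = φ x) ∧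
        (∀ x, x ∉ V → Ψ x = ((‖φ x‖ : ℝ) : ℂ)) := by
      classical
      have hcl : IsClosed (Uᶜ ∪ Vᶜ) := hU.isClosed_compl.union hV.isClosed_compl
      let f : M → ℂ := fun x => if x ∈ U then ((‖φ x‖ : ℝ) : ℂ) else φ x
      have hfU : ∀ x, x ∉ U → f x = φ x := fun x hx => by simp [f, hx]
      have hfV : ∀ x, x ∉ V → f x = ((‖φ x‖ : ℝ) : ℂ) := fun x hx => by
        by_cases h : x ∈ U
        · simp [f, h]
        · rw [hfU x h]; exact (hout x h hx).eq
      have hfc : ContinuousOn f (Uᶜ ∪ Vᶜ) := by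
        apply ContinuousOn.union_of_isClosed _ _ hU.isClosed_compl hV.isClosed_compl
        · exact hφ.1.continuousOn.congr hfU
        · have : Continuous fun x => ((‖φ x‖ : ℝ) : ℂ) := by have := hφ.1; fun_prop
          exact this.continuousOn.congr hfV
      obtain ⟨g, hg⟩ := ContinuousMap.exists_restrict_eq hcl
        (⟨fun x => f x, continuousOn_iff_continuous_domRestrict.1 hfc⟩ : C(↑(Uᶜ ∪ Vᶜ), ℂ))
      have hg' : ∀ x ∈ Uᶜ ∪ Vᶜ, g x = f x := fun x hx => DFunLike.congr_fun hg ⟨x, hx⟩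
      exact ⟨g, g.continuous, fun x hx => (hg' x (Or.inl hx)).trans (hfU x hx),
        fun x hx => (hg' x (Or.inr hx)).trans (hfV x hx)⟩
    let O : Set ℂ := ι ⁻¹' U ∩ Metric.ball 0 ρ
    have hO : IsOpen O := (hU.preimage hι.continuous).inter Metric.isOpen_ball
    have hOb : Bornology.IsBounded O := Metric.isBounded_ball.subset inter_subset_right
    have hOK : O ⊆ Metric.closedBall 0 ρ := inter_subset_right.trans Metric.ball_subset_closedBall
    have hfr : ∀ z ∈ frontier O, Ψ (ι z) ≠ 0 := by
      intro z hz
      have hzO : z ∉ O := by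
        rw [hO.frontier_eq] at hz; exact hz.2
      have hzc : z ∈ closure O := frontier_subset_closure hz
      have hzb : ‖z‖ ≤ ρ := by
        have := closure_minimal hOK Metric.isClosed_closedBall hzc
        simpa using this
      rcases hzb.lt_or_eq with h | h
      · have hzU : ι z ∉ U := fun h' => hzO ⟨h', by simpa using h⟩
        have : ι z ∈ closure U := by
          apply map_mem_closure hι.continuous hzc
          intro w hw; exact hw.1
        have := hclU this
        simp only [mem_iUnion] at this
        obtain ⟨κ, hκ, w, hw, hwz⟩ := this
        rw [hΨU _ hzU, ← hwz]
        apply hρ κ (by simp [show κ ∈ L from hκ])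
        have hw' : ‖w‖ ≤ ρ := by simpa using hw
        refine le_antisymm hw' (not_lt.1 fun hlt => hzU ?_)
        rw [← hwz]
        exact mem_biUnion hκ ⟨w, by simpa using hlt, rfl⟩
      · have hzV : ι z ∉ V := by
          rintro ⟨w, hw, hwz⟩
          rw [hι.injective hwz] at hw
          simp [h] at hw
        rw [hΨV _ hzV]
        simpa using hρ ι (by simp) z h
    obtain ⟨g', hg'c, hg'eq, hg'f⟩ := perturb (hΨc.comp hι.continuous) hO hOb hfr
    have hd0 : ∀ z, z ∉ O → g' z - Ψ (ι z) = 0 := fun z hz => by rw [hg'eq z hz]; simp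
    let ψ : M → ℂ := fun x => Ψ x + ext ι (fun z => g' z - Ψ (ι z)) 0 x
    have hψc : Continuous ψ := by
      refine hΨc.add (ext_continuous hι (hg'c.sub (hΨc.comp hι.continuous))
        (isCompact_closedBall (0 : ℂ) ρ) fun z hz => hd0 z fun h => hz (hOK h))
    have hψι : ∀ z, ψ (ι z) = g' z := fun z => by
      simp only [ψ]; rw [ext_apply hι.injective]; ring
    have hψoff : ∀ x, x ∉ ι '' O → ψ x = Ψ x := fun x hx => by
      simp only [ψ]; rw [ext_off' hι.injective _ _ hd0 hx, add_zero]
    have hψU : ∀ x, x ∉ U → ψ x = φ x := fun x hx => by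
      rw [hψoff x (by rintro ⟨z, hz, rfl⟩; exact hx hz.1), hΨU x hx]
    have hψV : ∀ x, x ∉ V → ψ x = ((‖φ x‖ : ℝ) : ℂ) := fun x hx => by
      rw [hψoff x (by rintro ⟨z, hz, rfl⟩; exact hx ⟨z, hz.2, rfl⟩), hΨV x hx]
    have hψg : Good ψ := by
      refine ⟨hψc, ((hg'f.image ι).union hφ.2).subset ?_⟩
      intro x hx
      by_cases hxU : x ∈ U
      · by_cases hxV : x ∈ V
        · obtain ⟨z, hz, rfl⟩ := hxV
          left
          refine ⟨z, ⟨⟨hxU, hz⟩, ?_⟩, rfl⟩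
          rw [← hψι]; exact hx
        · right
          have : ψ x = 0 := hx
          rw [hψV x hxV] at this
          simpa using this
      · right
        have : ψ x = 0 := hx
        rwa [hψU x hxU] at this
    have hnn : ∀ x, NonnegC ((‖φ x‖ : ℝ) : ℂ) := fun x => ⟨by simp, by simp⟩
    have hodd : OddSet ψ = ι '' OddSet (fun z => ψ (ι z)) := by
      ext x
      constructor
      · intro hx
        have hxcl : x ∈ ι '' Metric.closedBall 0 ρ := by
          by_contra hcon
          apply hx
          apply evenAt_of_nonneg hψc
          have hcl : IsClosed (ι '' Metric.closedBall 0 ρ) :=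
            ((isCompact_closedBall (0 : ℂ) ρ).image hι.continuous).isClosed
          filter_upwards [hcl.isOpen_compl.mem_nhds hcon] with y hy
          rw [hψV y fun h => hy (image_mono Metric.ball_subset_closedBall h)]
          exact hnn y
        obtain ⟨z, -, rfl⟩ := hxcl
        exact ⟨z, fun h => hx ((evenAt_comp hι ψ z).1 h), rfl⟩
      · rintro ⟨z, hz, rfl⟩ h
        exact hz ((evenAt_comp hι ψ z).2 h)
    have hψeven : Even (OddSet ψ).ncard := by
      rw [hodd, ncard_image_of_injective _ hι.injective]
      refine even_plane (hψg.comp hι) ρ fun z hz => ?_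
      rw [hψV]
      · exact hnn _
      · rintro ⟨w, hw, hwz⟩
        rw [hι.injective hwz, mem_ball_zero_iff] at hw
        linarith
    have hcj : Good (fun x => (starRingEnd ℂ) (ψ x)) :=
      ⟨Complex.continuous_conj.comp hψc, by simpa using hψg.2⟩
    have hχeven := ih hL' (fun x => φ x * (starRingEnd ℂ) (ψ x)) ρ (hφ.mul hcj) (by
      intro x hx
      have hxU : x ∉ U := by
        simp only [U, mem_iUnion]
        rintro ⟨κ, hκ, h⟩
        exact hx κ hκ (image_mono Metric.ball_subset_closedBall h)
      simp only [hψU x hxU, Complex.mul_conj]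
      exact ⟨by simpa using Complex.normSq_nonneg _, by simp⟩)
    rw [oddSet_mul hM hφ hcj, even_symmDiff hφ.oddSet_finite hcj.oddSet_finite] at hχeven
    rw [hχeven]
    have : OddSet (fun x => (starRingEnd ℂ) (ψ x)) = OddSet ψ := by
      ext x; simp only [OddSet, mem_ofPred_eq, evenAt_conj_iff]
    rw [this]; exact hψeven

/-- the number of odd points of a good function on a compact surface is even -/
theorem fund {M : Type*} [TopologicalSpace M] [T2Space M] [CompactSpace M] (hM : Surf M)
    {φ : M → ℂ} (hφ : Good φ) : Even (OddSet φ).ncard := by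
  choose ι hι h0 _ using fun x : M => hM x univ univ_mem
  obtain ⟨t, ht⟩ := isCompact_univ.elim_finite_subcover (fun x => ι x '' Metric.ball 0 1)
    (fun x => (hι x).isOpenMap _ Metric.isOpen_ball)
    (fun x _ => mem_iUnion.2 ⟨x, 0, by simp, h0 x⟩)
  refine fund_aux hM (t.toList.map ι) ?_ φ 1 hφ ?_
  · intro κ hκ
    obtain ⟨x, -, rfl⟩ := List.mem_map.1 hκ
    exact hι x
  · intro x hx
    exfalso
    have := ht (mem_univ x)
    simp only [mem_iUnion] at this
    obtain ⟨y, hy, hxy⟩ := this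
    exact hx (ι y) (List.mem_map.2 ⟨y, by simpa using hy, rfl⟩)
      (image_mono Metric.ball_subset_closedBall hxy)

end SurfUB

namespace SurfUB
open Set Filter Topology

/-- angle function -/
noncomputable def rho (x : ℝ) : ℝ := 2 * Real.pi * max 0 (min 1 ((x + 1) / 2))

theorem rho_cont : Continuous rho := by unfold rho; fun_prop

theorem rho_left {x : ℝ} (h : x ≤ -1) : rho x = 0 := by
  unfold rho
  rw [max_eq_left ((min_le_right _ _).trans (by linarith)), mul_zero]

theorem rho_right {x : ℝ} (h : 1 ≤ x) : rho x = 2 * Real.pi := by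
  unfold rho
  rw [min_eq_left (by linarith), max_eq_right zero_le_one, mul_one]

theorem rho_mid {x : ℝ} (h : -1 ≤ x) (h' : x ≤ 1) : rho x = Real.pi * (x + 1) := by
  unfold rho
  rw [min_eq_right (by linarith), max_eq_right (by linarith)]; ring

/-- coefficient -/
noncomputable def lam (y : ℝ) : ℝ := max 0 (1 - |y|)

/-- the model function -/
noncomputable def Fm (z : ℂ) : ℂ := 1 + lam z.im * (Complex.exp (rho z.re * Complex.I) - 1)

theorem lam_cont : Continuous lam := by unfold lam; fun_prop

theorem Fm_cont : Continuous Fm := by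
  have := rho_cont; have := lam_cont
  unfold Fm; fun_prop

theorem exp_rho_left {x : ℝ} (h : x ≤ -1) : Complex.exp (rho x * Complex.I) = 1 := by
  simp [rho_left h]

theorem exp_rho_right {x : ℝ} (h : 1 ≤ x) : Complex.exp (rho x * Complex.I) = 1 := by
  rw [rho_right h]; push_cast; exact Complex.exp_two_pi_mul_I

theorem lam_zero {y : ℝ} (h : 1 ≤ |y|) : lam y = 0 := max_eq_left (by linarith)

theorem Fm_off_im {z : ℂ} (h : 1 ≤ |z.im|) : Fm z = 1 := by
  unfold Fm; simp [lam_zero h]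

theorem exp_rho_off {x : ℝ} (h : 1 ≤ |x|) : Complex.exp (rho x * Complex.I) = 1 := by
  rcases le_abs.1 h with h | h
  · exact exp_rho_right h
  · exact exp_rho_left (by linarith)

theorem Fm_off_re {z : ℂ} (h : 1 ≤ |z.re|) : Fm z = 1 := by
  unfold Fm; rw [exp_rho_off h]; simp

theorem Fm_real (x : ℝ) : Fm x = Complex.exp (rho x * Complex.I) := by
  simp [Fm, lam]

/-- key algebra: zero of interpolation -/
theorem interp_zero {l x : ℝ} (h : 1 + (l : ℂ) * (Complex.exp (rho x * Complex.I) - 1) = 0) :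
    l = 1 / 2 ∧ x = 0 := by
  have hre := congrArg Complex.re h
  have him := congrArg Complex.im h
  simp [Complex.exp_ofReal_mul_I_re, Complex.exp_ofReal_mul_I_im] at hre him
  have hl : l ≠ 0 := by rintro rfl; simp at hre
  have hs : Real.sin (rho x) = 0 := him.resolve_left hl
  have hc : Real.cos (rho x) ^ 2 = 1 := by
    have := Real.sin_sq_add_cos_sq (rho x); rw [hs] at this; linarith
  have hc' : Real.cos (rho x) = -1 := by
    rcases mul_self_eq_one_iff.1 ((sq _).symm.trans hc) with h | h
    · rw [h] at hre; simp at hre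
    · exact h
  constructor
  · rw [hc'] at hre; linarith
  · by_cases h1 : x ≤ -1
    · rw [rho_left h1] at hc'; norm_num at hc'
    by_cases h2 : 1 ≤ x
    · rw [rho_right h2] at hc'; norm_num at hc'
    push Not at h1 h2
    rw [rho_mid h1.le h2.le, mul_add, mul_one, Real.cos_add_pi] at hc'
    have h3 : Real.cos (Real.pi * x) = 1 := by linarith
    rw [Real.cos_eq_one_iff_of_lt_of_lt] at h3
    · exact (mul_eq_zero.1 h3).resolve_left Real.pi_ne_zero
    · nlinarith [Real.pi_pos]
    · nlinarith [Real.pi_pos]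

theorem lam_half {y : ℝ} (h : lam y = 1 / 2) : |y| = 1 / 2 := by
  unfold lam at h
  rcases max_choice (0 : ℝ) (1 - |y|) with h' | h' <;> rw [h'] at h <;> linarith

/-- the two odd points of the model -/
noncomputable def pp : ℂ := ⟨0, 1 / 2⟩
noncomputable def pm : ℂ := ⟨0, -(1 / 2)⟩

theorem Fm_zero {z : ℂ} (h : Fm z = 0) : z = pp ∨ z = pm := by
  obtain ⟨h1, h2⟩ := interp_zero h
  have h3 := lam_half h1
  rcases eq_or_eq_neg_of_abs_eq h3 with h4 | h4
  · exact Or.inl (Complex.ext h2 h4)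
  · exact Or.inr (Complex.ext h2 h4)

theorem Fm_good : Good Fm := by
  refine ⟨Fm_cont, (Set.toFinite {pp, pm}).subset ?_⟩
  intro z hz
  exact Fm_zero hz

theorem Fm_odd_pp : ¬ EvenAt Fm pp := by
  intro hev
  let G : ℂ → ℂ := fun z => 1 + (lam (max z.im 0) : ℝ) * (Complex.exp (rho z.re * Complex.I) - 1)
  have hGc : Continuous G := by
    have := rho_cont; have := lam_cont
    simp only [G]; fun_prop
  have hG0 : ∀ z, G z = 0 → z = pp := by
    intro z hz
    obtain ⟨h1, h2⟩ := interp_zero hz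
    have h3 := lam_half h1
    rw [abs_of_nonneg (le_max_right _ _)] at h3
    refine Complex.ext h2 ?_
    rcases max_choice z.im 0 with h' | h'
    · rw [h'] at h3; exact h3
    · rw [h'] at h3; norm_num at h3
  have hGg : Good G := ⟨hGc, (Set.finite_singleton pp).subset fun z hz => hG0 z hz⟩
  have hGe : ∀ z, EvenAt G z := by
    intro z
    by_cases hz : z = pp
    · subst hz
      refine hev.congr ?_
      have : {z : ℂ | 0 < z.im} ∈ 𝓝 pp :=
        (isOpen_lt continuous_const Complex.continuous_im).mem_nhds (by simp [pp])
      filter_upwards [this] with z hz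
      have hz' : 0 < z.im := hz
      simp only [G, Fm, max_eq_left hz'.le]
    · exact evenAt_of_ne hGc fun h => hz (hG0 z h)
  obtain ⟨s, hs, hs2⟩ := sq_plane hGg hGe
  -- outer region
  let A : Set ℂ := {z | z.re ≤ -1}
  let B : Set ℂ := {z | 1 ≤ z.im}
  let C : Set ℂ := {z | 1 ≤ z.re}
  have hA : IsPreconnected A := (convex_halfSpace_re_le (-1)).isPreconnected
  have hB : IsPreconnected B := (convex_halfSpace_im_ge 1).isPreconnected
  have hC : IsPreconnected C := (convex_halfSpace_re_ge 1).isPreconnected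
  have hW : IsPreconnected (A ∪ B ∪ C) := by
    have hAB : IsPreconnected (A ∪ B) :=
      IsPreconnected.union (⟨-1, 1⟩ : ℂ) (by simp [A]) (by simp [B]) hA hB
    exact IsPreconnected.union (⟨1, 1⟩ : ℂ) (Or.inr (by simp [B])) (by simp [C]) hAB hC
  have hG1 : ∀ z ∈ A ∪ B ∪ C, G z = 1 := by
    rintro z ((hz | hz) | hz)
    · simp only [G]; rw [exp_rho_left hz]; simp
    · simp only [G]
      rw [lam_zero]
      · simp
      · rw [abs_of_nonneg (le_max_right _ _)]; exact le_trans hz (le_max_left _ _)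
    · simp only [G]; rw [exp_rho_right hz]; simp
  have h1 : s ((-1 : ℝ) : ℂ) = s ((1 : ℝ) : ℂ) := by
    rcases hW.eq_one_or_eq_neg_one_of_sq_eq hs.continuousOn (fun z hz => by
      simp only [Pi.pow_apply]; rw [hs2, hG1 z hz]; rfl) with h | h
    · rw [h (Or.inl (Or.inl (by simp [A]))), h (Or.inr (by simp [C]))]; rfl
    · rw [h (Or.inl (Or.inl (by simp [A]))), h (Or.inr (by simp [C]))]; rfl
  have hr := rho_cont
  have hreal : ∀ x : ℝ, s x ^ 2 = Complex.exp (rho x * Complex.I) := by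
    intro x; rw [hs2]; simp [G, lam]
  have e1 : Complex.exp (((rho 1 : ℝ) : ℂ) / 2 * Complex.I) = -1 := by
    rw [rho_right le_rfl, ← Complex.exp_pi_mul_I]; congr 1; push_cast; ring
  have e2 : Complex.exp (((rho (-1) : ℝ) : ℂ) / 2 * Complex.I) = 1 := by
    rw [rho_left le_rfl]; simp
  rcases isPreconnected_univ.eq_or_eq_neg_of_sq_eq (f := fun x : ℝ => s x)
    (g := fun x : ℝ => Complex.exp (rho x / 2 * Complex.I)) (by fun_prop) (by fun_prop)
    (fun x _ => by
      simp only [Pi.pow_apply]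
      rw [hreal, ← Complex.exp_nat_mul]; congr 1; push_cast; ring)
    (fun {x} _ => Complex.exp_ne_zero _) with h | h
  · have a := h (mem_univ 1)
    have b := h (mem_univ (-1))
    simp only [e1, e2] at a b
    rw [a, b] at h1
    norm_num [Complex.ext_iff] at h1
  · have a := h (mem_univ 1)
    have b := h (mem_univ (-1))
    simp only [Pi.neg_apply, e1, e2] at a b
    rw [a, b] at h1
    norm_num [Complex.ext_iff] at h1

theorem Fm_conj (z : ℂ) : Fm ((starRingEnd ℂ) z) = Fm z := by
  simp [Fm, lam]

theorem Fm_odd_pm : ¬ EvenAt Fm pm := by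
  intro h
  apply Fm_odd_pp
  have hc : IsOpenEmbedding (fun z : ℂ => (starRingEnd ℂ) z) :=
    Complex.conjCLE.toHomeomorph.isOpenEmbedding
  have h2 : (starRingEnd ℂ) pp = pm := by
    apply Complex.ext <;> simp [pp, pm]
  have := (evenAt_comp hc Fm pp).2 (by rw [h2]; exact h)
  simpa only [Fm_conj] using this

theorem Fm_oddSet : OddSet Fm = {pp, pm} := by
  ext z
  constructor
  · intro h; exact Fm_zero (zero_of_not_evenAt Fm_cont h)
  · rintro (rfl | rfl)
    · exact Fm_odd_pp
    · exact Fm_odd_pm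

/-- closed unit square -/
def SqC : Set ℂ := {z | |z.re| ≤ 1 ∧ |z.im| ≤ 1}
/-- open unit square -/
def SqO : Set ℂ := {z | |z.re| < 1 ∧ |z.im| < 1}

theorem SqC_closed : IsClosed SqC := by
  have h1 := Complex.continuous_re
  have h2 := Complex.continuous_im
  exact (isClosed_le h1.abs continuous_const).inter (isClosed_le h2.abs continuous_const)

theorem SqC_compact : IsCompact SqC := by
  refine Metric.isCompact_of_isClosed_isBounded SqC_closed ?_
  rw [isBounded_iff_forall_norm_le]
  refine ⟨2, fun z hz => (Complex.norm_le_abs_re_add_abs_im z).trans ?_⟩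
  linarith [hz.1, hz.2]

theorem SqO_sub : SqO ⊆ SqC := fun _ h => ⟨h.1.le, h.2.le⟩

theorem Fm_off {z : ℂ} (h : z ∉ SqO) : Fm z = 1 := by
  by_cases h1 : 1 ≤ |z.re|
  · exact Fm_off_re h1
  · exact Fm_off_im (not_lt.1 fun h2 => h ⟨not_le.1 h1, h2⟩)

section onX
variable {X : Type*} [TopologicalSpace X] [T2Space X]

/-- model function transported -/
noncomputable def fe (ι : ℂ → X) : X → ℂ := ext ι Fm 1

theorem fe_off {ι : ℂ → X} (hι : IsOpenEmbedding ι) {x : X} (hx : x ∉ ι '' SqO) : fe ι x = 1 :=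
  ext_off' hι.injective _ _ (fun _ => Fm_off) hx

theorem fe_apply {ι : ℂ → X} (hι : IsOpenEmbedding ι) (z : ℂ) : fe ι (ι z) = Fm z :=
  ext_apply hι.injective _ _ _

theorem fe_good {ι : ℂ → X} (hι : IsOpenEmbedding ι) : Good (fe ι) := by
  refine ⟨ext_continuous hι Fm_cont SqC_compact fun z hz => Fm_off fun h => hz (SqO_sub h),
    (Fm_good.2.image ι).subset ?_⟩
  intro x hx
  have hx : fe ι x = 0 := hx
  by_cases h : x ∈ ι '' SqO
  · obtain ⟨z, -, rfl⟩ := h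
    rw [fe_apply hι] at hx
    exact ⟨z, hx, rfl⟩
  · rw [fe_off hι h] at hx; simp at hx

theorem fe_odd {ι : ℂ → X} (hι : IsOpenEmbedding ι) : OddSet (fe ι) = {ι pp, ι pm} := by
  have hg := fe_good hι
  ext x
  by_cases h : x ∈ range ι
  · obtain ⟨z, rfl⟩ := h
    have h1 : ι z ∈ OddSet (fe ι) ↔ z ∈ OddSet Fm := by
      simp only [OddSet, mem_ofPred_eq]
      rw [← evenAt_comp hι]
      simp only [fe_apply hι]
    rw [h1, Fm_oddSet]
    simp [hι.injective.eq_iff]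
  · constructor
    · intro h1
      have := zero_of_not_evenAt hg.1 h1
      rw [fe_off hι fun ⟨z, _, hz⟩ => h ⟨z, hz⟩] at this
      simp at this
    · rintro (rfl | rfl) <;> simp at h

/-- push lemma -/
theorem push (hX : Surf X) {F : Set X} (hF : IsOpen F) (hFc : IsPreconnected F) {x y : X}
    (hx : x ∈ F) (hy : y ∈ F) : ∃ h : X → ℂ, Good h ∧ (∀ z, z ∉ F → h z = 1) ∧
      OddSet h = symmDiff {x} {y} := by
  let P : X → X → Prop := fun x y => ∃ h : X → ℂ, Good h ∧ (∀ z, z ∉ F → h z = 1) ∧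
      OddSet h = symmDiff {x} {y}
  have hrefl : ∀ x, P x x := fun x => ⟨_, good_one, fun _ _ => rfl, by
    rw [symmDiff_self]; ext z; simp [OddSet, evenAt_one]⟩
  have htrans : ∀ x y z, P x y → P y z → P x z := by
    rintro x y z ⟨h, h1, h2, h3⟩ ⟨h', h1', h2', h3'⟩
    refine ⟨_, h1.mul h1', fun w hw => by simp [h2 w hw, h2' w hw], ?_⟩
    rw [oddSet_mul hX h1 h1', h3, h3', symmDiff_assoc, symmDiff_symmDiff_cancel_left]
  have hsymm : ∀ x y, P x y → P y x := by
    rintro x y ⟨h, h1, h2, h3⟩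
    exact ⟨h, h1, h2, by rw [h3, symmDiff_comm]⟩
  have hloc : ∀ x ∈ F, ∃ U, IsOpen U ∧ x ∈ U ∧ ∀ y ∈ U, P x y := by
    intro x hx
    obtain ⟨ι, hι, h0, hr⟩ := hX x F (hF.mem_nhds hx)
    refine ⟨range ι, hι.isOpen_range, ⟨0, h0⟩, ?_⟩
    rintro _ ⟨b, rfl⟩
    rw [← h0]
    by_cases hb : b = 0
    · subst hb; exact hrefl _
    -- affine map taking pp to 0, pm to b
    have hI : (Complex.I : ℂ) * b ≠ 0 := mul_ne_zero Complex.I_ne_zero hb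
    let α : ℂ ≃ₜ ℂ := (Homeomorph.mulLeft₀ (Complex.I * b) hI).trans (Homeomorph.addRight (b / 2))
    have hα : ∀ z, α z = Complex.I * b * z + b / 2 := fun z => rfl
    have hpp : pp = Complex.I / 2 := by
      apply Complex.ext <;> simp [pp]
    have hpm : pm = -(Complex.I / 2) := by
      apply Complex.ext <;> simp [pm]
    have a1 : α pp = 0 := by
      rw [hα, hpp]; ring_nf; rw [Complex.I_sq]; ring
    have a2 : α pm = b := by
      rw [hα, hpm]; ring_nf; rw [Complex.I_sq]; ring
    have hκ : IsOpenEmbedding (ι ∘ α) := hι.comp α.isOpenEmbedding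
    refine ⟨fe (ι ∘ α), fe_good hκ, fun z hz => fe_off hκ ?_, ?_⟩
    · rintro ⟨w, _, rfl⟩; exact hz (hr ⟨_, rfl⟩)
    · rw [fe_odd hκ]
      simp only [Function.comp, a1, a2]
      have hne : ι 0 ≠ ι b := fun h => hb (hι.injective h).symm
      ext w
      simp only [mem_insert_iff, mem_singleton_iff, Set.mem_symmDiff]
      constructor
      · rintro (rfl | rfl)
        · exact Or.inl ⟨rfl, hne⟩
        · exact Or.inr ⟨rfl, hne.symm⟩
      · rintro (h | h)
        · exact Or.inl h.1
        · exact Or.inr h.1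
  choose! U hU hxU hUP using hloc
  by_contra hcon
  have hcon : ¬ P x y := hcon
  have := hFc (⋃ z ∈ {z ∈ F | P x z}, U z) (⋃ z ∈ {z ∈ F | ¬ P x z}, U z)
    (isOpen_biUnion fun z hz => hU z hz.1) (isOpen_biUnion fun z hz => hU z hz.1)
    (fun z hz => by
      by_cases h : P x z
      · exact Or.inl (mem_biUnion (show z ∈ {z ∈ F | P x z} from ⟨hz, h⟩) (hxU z hz))
      · exact Or.inr (mem_biUnion (show z ∈ {z ∈ F | ¬ P x z} from ⟨hz, h⟩) (hxU z hz)))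
    ⟨x, hx, mem_biUnion (show x ∈ {z ∈ F | P x z} from ⟨hx, hrefl x⟩) (hxU x hx)⟩
    ⟨y, hy, mem_biUnion (show y ∈ {z ∈ F | ¬ P x z} from ⟨hy, hcon⟩) (hxU y hy)⟩
  obtain ⟨w, hw, hw1, hw2⟩ := this
  simp only [mem_iUnion] at hw1 hw2
  obtain ⟨a, ⟨haF, ha⟩, haw⟩ := hw1
  obtain ⟨b, ⟨hbF, hb⟩, hbw⟩ := hw2
  exact hb (htrans _ _ _ (htrans _ _ _ ha (hUP a haF w haw)) (hsymm _ _ (hUP b hbF w hbw)))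

end onX

/-- H1 lemma: finitely many classes of square-root coverings -/
theorem finite_classes (M : Type*) [TopologicalSpace M] [T2Space M] [CompactSpace M] (hM : Surf M) :
    ∃ (N : ℕ) (sig : (M → ℂ) → Fin N), ∀ φ ψ : M → ℂ, Good φ → Good ψ →
      (∀ x, EvenAt φ x) → (∀ x, EvenAt ψ x) → sig φ = sig ψ →
      ∃ s : M → ℂ, Continuous s ∧ ∀ x, s x ^ 2 = φ x * ψ x := by
  classical
  choose ι hι h0 _ using fun x : M => hM x univ univ_mem
  obtain ⟨t, ht⟩ := isCompact_univ.elim_finite_subcover (fun x => ι x '' Metric.ball 0 1)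
    (fun x => (hι x).isOpenMap _ Metric.isOpen_ball)
    (fun x _ => mem_iUnion.2 ⟨x, 0, by simp, h0 x⟩)
  let K : M → Set M := fun x => ι x '' Metric.closedBall 0 1
  have hK : ∀ x, IsCompact (K x) := fun x => (isCompact_closedBall _ _).image (hι x).continuous
  have hKr : ∀ x, K x ⊆ range (ι x) := fun x => image_subset_range _ _
  -- local preconnected neighbourhoods
  have hloc : ∀ a b p : M, ∃ U : Set M, IsOpen U ∧ IsPreconnected U ∧
      (p ∈ range (ι a) → p ∈ range (ι b) → p ∈ U) ∧ U ⊆ range (ι a) ∩ range (ι b) := by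
    intro a b p
    by_cases h : p ∈ range (ι a) ∩ range (ι b)
    · obtain ⟨κ, hκ, hκ0, hκr⟩ := hM p _ (((hι a).isOpen_range.inter (hι b).isOpen_range).mem_nhds h)
      exact ⟨range κ, hκ.isOpen_range, isPreconnected_range hκ.continuous,
        fun _ _ => ⟨0, hκ0⟩, hκr⟩
    · exact ⟨∅, isOpen_empty, isPreconnected_empty, fun h1 h2 => (h ⟨h1, h2⟩).elim, empty_subset _⟩
  choose U hUo hUc hUm hUs using hloc
  have hcov : ∀ a b, ∃ T : Finset M, K a ∩ K b ⊆ ⋃ p ∈ T, U a b p := by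
    intro a b
    obtain ⟨T, hT⟩ := ((hK a).inter (hK b)).elim_finite_subcover (U a b) (hUo a b)
      (fun p hp => mem_iUnion.2 ⟨p, hUm a b p (hKr a hp.1) (hKr b hp.2)⟩)
    exact ⟨T, hT⟩
  choose T hT using hcov
  let I := Σ q : t × t, T q.1 q.2
  -- roots
  let root : M → (M → ℂ) → M → ℂ := fun a φ =>
    if h : ∃ s : M → ℂ, ContinuousOn s (range (ι a)) ∧ ∀ y ∈ range (ι a), s y ^ 2 = φ y
    then h.choose else 0
  have hroot : ∀ a φ, Good φ → (∀ x, EvenAt φ x) → ContinuousOn (root a φ) (range (ι a)) ∧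
      ∀ y ∈ range (ι a), root a φ y ^ 2 = φ y := by
    intro a φ hφ he
    have h : ∃ s : M → ℂ, ContinuousOn s (range (ι a)) ∧ ∀ y ∈ range (ι a), s y ^ 2 = φ y := by
      obtain ⟨s, hs, hs2⟩ := sq_plane (hφ.comp (hι a)) (fun z => (evenAt_comp (hι a) φ z).2 (he _))
      have hli := Function.leftInverse_invFun (hι a).injective
      refine ⟨s ∘ Function.invFun (ι a), ?_, ?_⟩
      · rintro _ ⟨w, rfl⟩
        apply ContinuousAt.continuousWithinAt
        rw [← (hι a).continuousAt_iff]
        refine hs.continuousAt.congr (Eventually.of_forall fun y => ?_)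
        simp [hli y]
      · rintro _ ⟨w, rfl⟩
        simp [hli w, hs2 w]
    simp only [root, dif_pos h]
    exact h.choose_spec
  let sg : (M → ℂ) → (I → Bool) := fun φ i =>
    decide (∀ y ∈ U i.1.1 i.1.2 i.2, root i.1.1 φ y = root i.1.2 φ y)
  refine ⟨Fintype.card (I → Bool), fun φ => Fintype.equivFin _ (sg φ), ?_⟩
  intro φ ψ hφ hψ heφ heψ hsig
  have hsig : sg φ = sg ψ := (Fintype.equivFin (I → Bool)).injective hsig
  have hrφ := fun a => hroot a φ hφ heφ
  have hrψ := fun a => hroot a ψ hψ heψ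
  have hdich : ∀ χ : M → ℂ, Good χ → (∀ x, EvenAt χ x) → ∀ a b p,
      (∀ y ∈ U a b p, root a χ y = root b χ y) ∨ (∀ y ∈ U a b p, root a χ y = - root b χ y) := by
    intro χ hχ heχ a b p
    have h1 := hroot a χ hχ heχ
    have h2 := hroot b χ hχ heχ
    refine rigid hM (hUo a b p) (hUc a b p) hχ.2 (h1.1.mono fun y hy => (hUs a b p hy).1)
      (h2.1.mono fun y hy => (hUs a b p hy).2) (fun y hy => ?_) (fun y hy h => ?_)
    · rw [h1.2 y (hUs a b p hy).1, h2.2 y (hUs a b p hy).2]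
    · show χ y = 0
      rw [← h2.2 y (hUs a b p hy).2, h]; simp
  have hagree : ∀ a ∈ t, ∀ b ∈ t, ∀ y ∈ K a ∩ K b,
      root a φ y * root a ψ y = root b φ y * root b ψ y := by
    intro a ha b hb y hy
    have := hT a b hy
    simp only [mem_iUnion] at this
    obtain ⟨p, hp, hyU⟩ := this
    have hs := congrFun hsig ⟨(⟨a, ha⟩, ⟨b, hb⟩), ⟨p, hp⟩⟩
    simp only [sg, decide_eq_decide] at hs
    by_cases h : ∀ y ∈ U a b p, root a φ y = root b φ y
    · rw [h y hyU, hs.1 h y hyU]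
    · rw [(hdich φ hφ heφ a b p).resolve_left h y hyU,
        (hdich ψ hψ heψ a b p).resolve_left (fun h' => h (hs.2 h')) y hyU]
      ring
  have hidx : ∀ x, ∃ a ∈ t, x ∈ ι a '' Metric.ball 0 1 := by
    intro x
    have := ht (mem_univ x)
    simpa only [mem_iUnion, exists_prop] using this
  choose i hit hix using hidx
  have hBK : ∀ a, ι a '' Metric.ball 0 1 ⊆ K a := fun a => image_mono Metric.ball_subset_closedBall
  refine ⟨fun x => root (i x) φ x * root (i x) ψ x, ?_, ?_⟩
  · rw [continuous_iff_continuousAt]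
    intro x
    have hx : x ∈ range (ι (i x)) := hKr _ (hBK _ (hix x))
    have hn := (hι (i x)).isOpen_range.mem_nhds hx
    refine (((hrφ (i x)).1.continuousAt hn).mul ((hrψ (i x)).1.continuousAt hn)).congr ?_
    filter_upwards [((hι (i x)).isOpenMap _ Metric.isOpen_ball).mem_nhds (hix x)] with y hy
    exact hagree _ (hit x) _ (hit y) y ⟨hBK _ hy, hBK _ (hix y)⟩
  · intro x
    have hx : x ∈ range (ι (i x)) := hKr _ (hBK _ (hix x))
    rw [mul_pow, (hrφ _).2 x hx, (hrψ _).2 x hx]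

end SurfUB

namespace SurfUB
open Set Filter Topology

/-- gluing real functions over a finite closed cover -/
theorem glue_closed {X I Y : Type*} [TopologicalSpace X] [TopologicalSpace Y] [Finite I] [Nonempty Y] {K : I → Set X}
    (hK : ∀ i, IsClosed (K i)) {f : I → X → Y} (hf : ∀ i, ContinuousOn (f i) (K i))
    (hag : ∀ i j x, x ∈ K i → x ∈ K j → f i x = f j x) :
    ∃ g : X → Y, ContinuousOn g (⋃ i, K i) ∧ ∀ i, ∀ x ∈ K i, g x = f i x := by
  classical
  let g : X → Y := fun x => if h : ∃ i, x ∈ K i then f h.choose x else Classical.arbitrary Y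
  have hg : ∀ i, ∀ x ∈ K i, g x = f i x := by
    intro i x hx
    have h : ∃ i, x ∈ K i := ⟨i, hx⟩
    simp only [g, dif_pos h]
    exact hag _ _ _ h.choose_spec hx
  refine ⟨g, ?_, hg⟩
  exact (locallyFinite_of_finite K).continuousOn_iUnion hK fun i => (hf i).congr (hg i)

theorem inv_contOn {X Y : Type*} [TopologicalSpace X] [TopologicalSpace Y] {ι : ℂ → X}
    (hι : IsOpenEmbedding ι) {f : ℂ → Y} (hf : Continuous f) :
    ContinuousOn (fun x => f (Function.invFun ι x)) (range ι) := by
  refine hf.comp_continuousOn ?_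
  rintro _ ⟨z, rfl⟩
  apply ContinuousAt.continuousWithinAt
  have h1 : Function.invFun ι ∘ ι = id := funext fun z => Function.leftInverse_invFun hι.injective z
  rw [← hι.continuousAt_iff, h1]
  exact continuousAt_id

theorem invFun_app {X : Type*} [TopologicalSpace X] {ι : ℂ → X}
    (hι : IsOpenEmbedding ι) (z : ℂ) : Function.invFun ι (ι z) = z :=
  Function.leftInverse_invFun hι.injective z

/-- configuration of blobs and bands -/
structure Config (M V E : Type*) [TopologicalSpace M] where
  u : E → V
  w : E → V
  B : V → Set M
  ι : E → ℂ → M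
  ne : ∀ e, u e ≠ w e
  Bc : ∀ v, IsCompact (B v)
  Bp : ∀ v, IsPreconnected (B v)
  Bd : ∀ v v' x, x ∈ B v → x ∈ B v' → v = v'
  emb : ∀ e, IsOpenEmbedding (ι e)
  sd : ∀ e e' z z', z ∈ SqC → z' ∈ SqC → ι e z = ι e' z' → e = e'
  sB : ∀ e v z, z ∈ SqC → ι e z ∈ B v → (z = -1 ∧ v = u e) ∨ (z = 1 ∧ v = w e)
  hl : ∀ e, ι e (-1) ∈ B (u e)
  hr : ∀ e, ι e 1 ∈ B (w e)

namespace Config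
variable {M V E : Type*} [TopologicalSpace M]

/-- core segment -/
def seg (C : Config M V E) (e : E) : Set M := (fun x : ℝ => C.ι e x) '' Icc (-1) 1

/-- the drawn graph -/
def net (C : Config M V E) : Set M := (⋃ v, C.B v) ∪ ⋃ e, C.seg e

theorem seg_compact (C : Config M V E) (e : E) : IsCompact (C.seg e) :=
  isCompact_Icc.image ((C.emb e).continuous.comp Complex.continuous_ofReal)

theorem real_mem {x : ℝ} (h : x ∈ Icc (-1 : ℝ) 1) : (x : ℂ) ∈ SqC := by
  simp [SqC, abs_le, h.1, h.2]

theorem one_not : (1 : ℂ) ∉ SqO := by simp [SqO]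
theorem mone_not : (-1 : ℂ) ∉ SqO := by simp [SqO]

theorem net_closed [T2Space M] [Finite V] [Finite E] (C : Config M V E) : IsClosed C.net :=
  (isClosed_iUnion_of_finite fun v => (C.Bc v).isClosed).union
    (isClosed_iUnion_of_finite fun e => (C.seg_compact e).isClosed)

theorem B_sub (C : Config M V E) (v : V) : C.B v ⊆ C.net := fun _ h => Or.inl (mem_iUnion.2 ⟨v, h⟩)
theorem seg_sub (C : Config M V E) (e : E) : C.seg e ⊆ C.net := fun _ h => Or.inr (mem_iUnion.2 ⟨e, h⟩)

/-- flipping the orientation of some edges -/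
noncomputable def flip (C : Config M V E) (P : E → Prop) : Config M V E := by
  classical
  exact
  { u := fun e => if P e then C.w e else C.u e
    w := fun e => if P e then C.u e else C.w e
    B := C.B
    ι := fun e => if P e then fun z => C.ι e (-z) else C.ι e
    ne := fun e => by split_ifs; exacts [(C.ne e).symm, C.ne e]
    Bc := C.Bc
    Bp := C.Bp
    Bd := C.Bd
    emb := fun e => by
      split_ifs
      · exact (C.emb e).comp (Homeomorph.neg ℂ).isOpenEmbedding
      · exact C.emb e
    sd := fun e e' z z' hz hz' h => by
      have hn : ∀ z ∈ SqC, -z ∈ SqC := fun z hz => by simpa [SqC] using hz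
      split_ifs at h
      · exact C.sd _ _ _ _ (hn _ hz) (hn _ hz') h
      · exact C.sd _ _ _ _ (hn _ hz) hz' h
      · exact C.sd _ _ _ _ hz (hn _ hz') h
      · exact C.sd _ _ _ _ hz hz' h
    sB := fun e v z hz h => by
      have hn : ∀ z ∈ SqC, -z ∈ SqC := fun z hz => by simpa [SqC] using hz
      split_ifs at h ⊢
      · rcases C.sB _ _ _ (hn _ hz) h with h | h
        · right; exact ⟨neg_inj.1 h.1, h.2⟩
        · left; exact ⟨by rw [← h.1, neg_neg], h.2⟩
      · exact C.sB _ _ _ hz h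
    hl := fun e => by
      split_ifs
      · simpa using C.hr e
      · exact C.hl e
    hr := fun e => by
      split_ifs
      · simpa using C.hl e
      · exact C.hr e }

/-- number of band sides in F -/
noncomputable def cnt (C : Config M V E) (F : Set M) (e : E) : ℕ := by
  classical
  exact (if C.ι e pp ∈ F then 1 else 0) + (if C.ι e pm ∈ F then 1 else 0)

theorem pp_neg : -pp = pm := by simp [pp, pm, Complex.ext_iff]
theorem pm_neg : -pm = pp := by simp [pp, pm, Complex.ext_iff]

theorem flip_cnt (C : Config M V E) (P : E → Prop) (F : Set M) (e : E) :
    (C.flip P).cnt F e = C.cnt F e := by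
  classical
  unfold cnt flip
  by_cases h : P e
  · simp only [h, if_true, pp_neg, pm_neg]; rw [add_comm]
  · simp only [h, if_false]

theorem flip_seg (C : Config M V E) (P : E → Prop) (e : E) :
    (C.flip P).seg e = C.seg e := by
  classical
  unfold seg flip
  by_cases h : P e
  · simp only [h, if_true]
    ext x; constructor
    · rintro ⟨t, ht, rfl⟩; exact ⟨-t, ⟨by linarith [ht.2], by linarith [ht.1]⟩, by simp⟩
    · rintro ⟨t, ht, rfl⟩; exact ⟨-t, ⟨by linarith [ht.2], by linarith [ht.1]⟩, by simp⟩
  · simp only [h, if_false]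

theorem flip_net (C : Config M V E) (P : E → Prop) : (C.flip P).net = C.net := by
  unfold net
  simp only [flip_seg]
  rfl

theorem pp_mem : pp ∈ SqC := by norm_num [pp, SqC, abs_le]
theorem pm_mem : pm ∈ SqC := by norm_num [pm, SqC, abs_le]

theorem pp_ne : pp ≠ pm := by norm_num [pp, pm, Complex.ext_iff]

theorem fe_blob [T2Space M] (C : Config M V E) {v : V} {x : M} (hx : x ∈ C.B v) (e : E) : fe (C.ι e) x = 1 := by
  apply fe_off (C.emb e)
  rintro ⟨z, hz, rfl⟩
  rcases C.sB e v z (SqO_sub hz) hx with h | h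
  · rw [h.1] at hz; exact mone_not hz
  · rw [h.1] at hz; exact one_not hz

theorem fe_other [T2Space M] (C : Config M V E) {e e' : E} (h : e ≠ e') {z : ℂ} (hz : z ∈ SqC) :
    fe (C.ι e') (C.ι e z) = 1 := by
  apply fe_off (C.emb e')
  rintro ⟨z', hz', h'⟩
  exact h (C.sd _ _ _ _ (SqO_sub hz') hz h').symm

theorem pp_not (C : Config M V E) (e : E) : C.ι e pp ∉ C.net := by
  rintro (h | h)
  · obtain ⟨v, hv⟩ := mem_iUnion.1 h
    rcases C.sB e v _ pp_mem hv with h | h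
    · have := congrArg Complex.im h.1; norm_num [pp] at this
    · have := congrArg Complex.im h.1; norm_num [pp] at this
  · obtain ⟨e', t, ht, h⟩ := mem_iUnion.1 h
    obtain rfl := C.sd _ _ _ _ (real_mem ht) pp_mem h
    have := congrArg Complex.im ((C.emb _).injective h); norm_num [pp] at this

theorem pm_not (C : Config M V E) (e : E) : C.ι e pm ∉ C.net := by
  rw [← pp_neg]
  have := (C.flip fun _ => True).pp_not e
  rw [flip_net] at this
  simpa [flip] using this

variable [T2Space M]

theorem par_prod (hM : Surf M) (C : Config M V E) (F : Set M) (m : Finset E) :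
    Even (OddSet (fun x => ∏ e ∈ m, fe (C.ι e) x) ∩ F).ncard ↔ Even (∑ e ∈ m, C.cnt F e) := by
  classical
  induction m using Finset.induction_on with
  | empty =>
    have : OddSet (fun _ : M => (1 : ℂ)) = ∅ := by ext x; simp [OddSet, evenAt_one]
    simp [this]
  | insert e m he ih =>
    have hg : Good (fun x => ∏ e ∈ m, fe (C.ι e) x) := Good.prod _ fun e _ => fe_good (C.emb e)
    simp only [Finset.prod_insert he, Finset.sum_insert he]
    rw [oddSet_mul hM (fe_good (C.emb e)) hg, fe_odd (C.emb e)]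
    rw [Set.inter_comm, Set.inter_symmDiff_distrib_left,
      even_symmDiff (((Set.finite_singleton _).insert _).subset inter_subset_right)
        (hg.oddSet_finite.subset inter_subset_right), Set.inter_comm F (OddSet _), ih, Nat.even_add]
    suffices (F ∩ {C.ι e pp, C.ι e pm}).ncard = C.cnt F e by rw [this]
    have hne : C.ι e pp ≠ C.ι e pm := fun h => pp_ne ((C.emb e).injective h)
    unfold cnt
    by_cases h1 : C.ι e pp ∈ F <;> by_cases h2 : C.ι e pm ∈ F
    · rw [inter_eq_right.2 (by rintro _ (rfl | rfl) <;> assumption), ncard_pair hne]; simp [h1, h2]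
    · rw [show F ∩ {C.ι e pp, C.ι e pm} = {C.ι e pp} by
        rw [Set.inter_comm, insert_inter_of_mem h1, singleton_inter_of_notMem h2]; simp]
      simp [h1, h2]
    · rw [show F ∩ {C.ι e pp, C.ι e pm} = {C.ι e pm} by
        rw [Set.inter_comm, insert_inter_of_notMem h1, singleton_inter_of_mem h2]]
      simp [h1, h2]
    · rw [show F ∩ {C.ι e pp, C.ι e pm} = ∅ by
        rw [Set.inter_comm, insert_inter_of_notMem h1, singleton_inter_of_notMem h2]]
      simp [h1, h2]

end Config
end SurfUB

namespace SurfUB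
open Set Filter Topology
namespace Config
variable {M V E : Type*} [TopologicalSpace M] [T2Space M] [CompactSpace M] 

/-- angle function on the net -/
theorem angle [Finite V] [Finite E] (C : Config M V E) (v : V) (hw : ∀ e, C.w e ≠ v) :
    ∃ θ : M → ℝ, ContinuousOn θ C.net ∧ (∀ x ∈ C.B v, θ x = 0) ∧
      (∀ v' ≠ v, ∀ x ∈ C.B v', θ x = 2 * Real.pi) ∧
      (∀ e, C.u e = v → ∀ t ∈ Icc (-1 : ℝ) 1, θ (C.ι e t) = rho t) ∧
      (∀ e, C.u e ≠ v → ∀ t ∈ Icc (-1 : ℝ) 1, θ (C.ι e t) = 2 * Real.pi) := by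
  classical
  let K : V ⊕ E → Set M := Sum.elim C.B C.seg
  let fV : V → M → ℝ := fun v' _ => if v' = v then 0 else 2 * Real.pi
  let fE : E → M → ℝ := fun e x => if C.u e = v then rho (Function.invFun (C.ι e) x).re else 2 * Real.pi
  let f : V ⊕ E → M → ℝ := Sum.elim fV fE
  have hVE : ∀ v' e x, x ∈ C.B v' → x ∈ C.seg e → fV v' x = fE e x := by
    rintro v' e x hx ⟨t, ht, rfl⟩
    simp only [fV, fE]
    rcases C.sB e v' t (real_mem ht) hx with ⟨h, rfl⟩ | ⟨h, rfl⟩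
    · have : t = -1 := by exact_mod_cast h
      subst this
      rw [invFun_app (C.emb e), Complex.ofReal_re, rho_left le_rfl]
    · have : t = 1 := by exact_mod_cast h
      subst this
      rw [invFun_app (C.emb e), Complex.ofReal_re, rho_right le_rfl, if_neg (hw e)]
      simp
  have key := glue_closed (K := K) (f := f) ?_ ?_ ?_
  · obtain ⟨g, hg, hgf⟩ := key
    refine ⟨g, ?_, ?_, ?_, ?_, ?_⟩
    · refine hg.mono ?_
      rintro x (h | h)
      · obtain ⟨v, h⟩ := mem_iUnion.1 h; exact mem_iUnion.2 ⟨Sum.inl v, h⟩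
      · obtain ⟨v, h⟩ := mem_iUnion.1 h; exact mem_iUnion.2 ⟨Sum.inr v, h⟩
    · intro x hx; rw [hgf (Sum.inl v) x hx]; simp [f, fV]
    · intro v' hv x hx; rw [hgf (Sum.inl v') x hx]; simp [f, fV, hv]
    · intro e he t ht; rw [hgf (Sum.inr e) _ ⟨t, ht, rfl⟩]; simp [f, fE, he, invFun_app (C.emb e)]
    · intro e he t ht; rw [hgf (Sum.inr e) _ ⟨t, ht, rfl⟩]; simp [f, fE, he]
  · rintro (v | e)
    · exact (C.Bc v).isClosed
    · exact (C.seg_compact e).isClosed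
  · rintro (v' | e)
    · exact continuousOn_const
    · show ContinuousOn (fE e) (C.seg e)
      by_cases h : C.u e = v
      · simp only [fE, h, if_true]
        refine (inv_contOn (C.emb e) (f := fun z => rho z.re) (rho_cont.comp Complex.continuous_re)).mono ?_
        rintro _ ⟨t, _, rfl⟩; exact ⟨_, rfl⟩
      · simp only [fE, h, if_false]; exact continuousOn_const
  · rintro (v | e) (v' | e') x h h'
    · obtain rfl := C.Bd _ _ _ h h'; rfl
    · exact hVE _ _ _ h h'
    · exact (hVE _ _ _ h' h).symm
    · obtain ⟨t, ht, rfl⟩ := h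
      obtain ⟨t', ht', h'⟩ := h'
      obtain rfl := C.sd _ _ _ _ (real_mem ht') (real_mem ht) h'
      rfl

theorem prod_blob (C : Config M V E) {v : V} {x : M} (hx : x ∈ C.B v) (m : Finset E) :
    ∏ e ∈ m, fe (C.ι e) x = 1 := Finset.prod_eq_one fun e _ => C.fe_blob hx e

open Classical in
theorem prod_seg (C : Config M V E) {e : E} {t : ℝ} (ht : t ∈ Icc (-1 : ℝ) 1) (m : Finset E) :
    ∏ e' ∈ m, fe (C.ι e') (C.ι e t) = if e ∈ m then Complex.exp (rho t * Complex.I) else 1 := by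
  split_ifs with h
  · rw [Finset.prod_eq_single_of_mem e h, fe_apply (C.emb e), Fm_real]
    intro e' _ hne
    exact C.fe_other hne.symm (real_mem ht)
  · refine Finset.prod_eq_one fun e' he' => C.fe_other ?_ (real_mem ht)
    rintro rfl; exact h he'

theorem claimA0 [Fintype V] [Fintype E] (hM : Surf M) (C : Config M V E) (v : V)
    (hw : ∀ e, C.w e ≠ v) {F : Set M} (hF : IsOpen F) (hfr : frontier F ⊆ C.net)
    (m : Finset E) (hm : ∀ e, e ∈ m ↔ C.u e = v) :
    Even (∑ e ∈ m, C.cnt F e) := by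
  classical
  obtain ⟨θ, hθ, h1, h2, h3, h4⟩ := C.angle v hw
  obtain ⟨Θ, hΘ⟩ := ContinuousMap.exists_restrict_eq C.net_closed
    (⟨C.net.domRestrict θ, continuousOn_iff_continuous_domRestrict.1 hθ⟩ : C(C.net, ℝ))
  have hΘ' : ∀ x ∈ C.net, Θ x = θ x := fun x hx => by
    have := congrArg (fun f => f ⟨x, hx⟩) hΘ
    simpa using this
  let g : M → ℂ := fun x => ∏ e ∈ m, fe (C.ι e) x
  have hg : Good g := Good.prod _ fun e _ => fe_good (C.emb e)
  have hgθ : ∀ x ∈ C.net, g x = Complex.exp (Θ x * Complex.I) := by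
    intro x hx
    rw [hΘ' x hx]
    have h2pi : Complex.exp ((2 * Real.pi : ℝ) * Complex.I) = 1 := by
      push_cast; exact Complex.exp_two_pi_mul_I
    rcases hx with h | h
    · obtain ⟨v', h⟩ := mem_iUnion.1 h
      simp only [g, C.prod_blob h]
      by_cases hv : v' = v
      · subst hv; rw [h1 x h]; simp
      · rw [h2 v' hv x h, h2pi]
    · obtain ⟨e, t, ht, rfl⟩ := mem_iUnion.1 h
      simp only [g]
      rw [C.prod_seg ht]
      by_cases he : C.u e = v
      · rw [if_pos ((hm e).2 he), h3 e he t ht]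
      · rw [if_neg (fun h => he ((hm e).1 h)), h4 e he t ht, h2pi]
  let un : M → ℂ := fun x => Complex.exp (-(Θ x * Complex.I))
  have hun : Good un := by
    refine ⟨by fun_prop, ?_⟩
    simp [un, Complex.exp_ne_zero]
  let ψ : M → ℂ := F.piecewise (fun x => g x * un x) (fun _ => 1)
  have hψF : ∀ x ∈ F, ψ x = g x * un x := fun x hx => by simp [ψ, hx]
  have hψF' : ∀ x ∉ F, ψ x = 1 := fun x hx => by simp [ψ, hx]
  have hψ : Good ψ := by
    constructor
    · refine Continuous.piecewise ?_ (hg.1.mul hun.1) continuous_const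
      intro x hx
      have hx := hfr hx
      simp only [un]
      rw [hgθ x hx, ← Complex.exp_add]; simp
    · refine hg.2.subset ?_
      intro x hx
      have hx : ψ x = 0 := hx
      by_cases h : x ∈ F
      · rw [hψF x h] at hx
        rcases mul_eq_zero.1 hx with h | h
        · exact h
        · exact absurd h (Complex.exp_ne_zero _)
      · rw [hψF' x h] at hx; simp at hx
  have hodd : OddSet ψ = OddSet g ∩ F := by
    ext x
    by_cases h : x ∈ F
    · simp only [OddSet, mem_ofPred_eq, mem_inter_iff, h, and_true]
      rw [evenAt_congr (φ := ψ) (ψ := fun x => g x * un x)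
        (by filter_upwards [hF.mem_nhds h] with y hy using hψF y hy),
        evenAt_mul_iff hM hg hun]
      have : EvenAt un x := evenAt_of_ne hun.1 (Complex.exp_ne_zero _)
      simp [this]
    · simp only [mem_inter_iff, h, and_false, iff_false]
      intro hx
      have := zero_of_not_evenAt hψ.1 hx
      rw [hψF' x h] at this; simp at this
  rw [← par_prod hM, ← hodd]
  exact fund hM hψ

theorem claimA [Fintype V] [Fintype E] (hM : Surf M) (C : Config M V E) (v : V)
    {F : Set M} (hF : IsOpen F) (hfr : frontier F ⊆ C.net)
    (m : Finset E) (hm : ∀ e, e ∈ m ↔ C.u e = v ∨ C.w e = v) :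
    Even (∑ e ∈ m, C.cnt F e) := by
  classical
  have h := claimA0 hM (C.flip fun e => C.w e = v) v ?_ hF (by rwa [flip_net]) m ?_
  · simpa only [flip_cnt] using h
  · intro e
    simp only [flip]
    split_ifs with h
    · exact fun h' => C.ne e (h'.trans h.symm)
    · exact h
  · intro e
    rw [hm]
    simp only [flip]
    split_ifs with h <;> simp [h]

end Config
end SurfUB

namespace SurfUB
open Set Filter Topology

theorem Surf.locConn {X : Type*} [TopologicalSpace X] (h : Surf X) : LocallyConnectedSpace X := by
  rw [locallyConnectedSpace_iff_subsets_isOpen_isConnected]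
  intro x U hU
  obtain ⟨ι, hι, h0, hr⟩ := h x U hU
  exact ⟨range ι, hr, hι.isOpen_range, ⟨0, h0⟩, isConnected_range hι.continuous⟩

theorem comp_frontier {X : Type*} [TopologicalSpace X] [LocallyConnectedSpace X] {K : Set X}
    (hK : IsClosed K) (x : X) : frontier (connectedComponentIn Kᶜ x) ⊆ K := by
  intro y hy
  by_contra hyK
  have ho : IsOpen (connectedComponentIn Kᶜ y) := hK.isOpen_compl.connectedComponentIn
  have hym : y ∈ connectedComponentIn Kᶜ y := mem_connectedComponentIn hyK
  have hcl := frontier_subset_closure hy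
  obtain ⟨z, hz1, hz2⟩ := mem_closure_iff.1 hcl _ ho hym
  have e1 := connectedComponentIn_eq hz1
  have e2 := connectedComponentIn_eq hz2
  have : y ∈ connectedComponentIn Kᶜ x := by rw [e2, ← e1]; exact hym
  rw [(hK.isOpen_compl.connectedComponentIn).frontier_eq] at hy
  exact hy.2 this

theorem flatten {M : Type*} [TopologicalSpace M] [T2Space M] (hM : Surf M) {K : Set M}
    (hK : IsClosed K) (n : ℕ) : ∀ {g : M → ℂ}, Good g → (OddSet g).ncard = n →
    (∀ x ∈ K, EvenAt g x) →
    (∀ x, Even (OddSet g ∩ connectedComponentIn Kᶜ x).ncard) →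
    ∃ φ, Good φ ∧ (∀ x, EvenAt φ x) ∧ ∀ x ∈ K, φ x = g x := by
  have := hM.locConn
  induction n using Nat.strong_induction_on with
  | _ n ih =>
  intro g hg hn hgK hev
  by_cases hall : ∀ x, EvenAt g x
  · exact ⟨g, hg, hall, fun _ _ => rfl⟩
  push Not at hall
  obtain ⟨x, hx⟩ := hall
  have hxo : x ∈ OddSet g := hx
  have hxK : x ∈ Kᶜ := fun h => hx (hgK x h)
  have hfin := hg.oddSet_finite
  set F := connectedComponentIn Kᶜ x with hFdef
  have hFo : IsOpen F := hK.isOpen_compl.connectedComponentIn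
  have hxF : x ∈ F := mem_connectedComponentIn hxK
  obtain ⟨y, hyo, hyF, hyx⟩ : ∃ y, y ∈ OddSet g ∧ y ∈ F ∧ y ≠ x := by
    by_contra hcon
    push Not at hcon
    have h1 : OddSet g ∩ F = {x} := by
      ext y; constructor
      · rintro ⟨h, h'⟩; exact hcon y h h'
      · rintro rfl; exact ⟨hxo, hxF⟩
    have := hev x
    rw [← hFdef, h1] at this; simp at this
  obtain ⟨h, hh, h1, hodd⟩ := push hM hFo isPreconnected_connectedComponentIn hxF hyF
  have hFK : ∀ z ∈ K, z ∉ F := fun z hz hzF => connectedComponentIn_subset _ _ hzF hz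
  have hpair : symmDiff {x} {y} = ({x, y} : Set M) := by
    ext z; simp only [mem_symmDiff, mem_singleton_iff, mem_insert_iff]
    constructor
    · tauto
    · rintro (rfl | rfl)
      · left; exact ⟨rfl, hyx.symm⟩
      · right; exact ⟨rfl, hyx⟩
  rw [hpair] at hodd
  have hom := oddSet_mul hM hg hh
  have hpf : ({x, y} : Set M).Finite := (finite_singleton _).insert _
  have hsub : ({x, y} : Set M) ⊆ OddSet g := by rintro _ (rfl | rfl) <;> assumption
  have hdiff : symmDiff (OddSet g) {x, y} = OddSet g \ {x, y} := by
    rw [Set.symmDiff_def, sdiff_eq_empty.2 hsub, union_empty]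
  have hlt : (OddSet fun z => g z * h z).ncard < n := by
    rw [hom, hodd, hdiff, ← hn]
    exact ncard_lt_ncard ⟨sdiff_subset, fun hs => (hs hxo).2 (by simp)⟩ hfin
  have key := ih _ hlt (hg.mul hh) rfl ?_ ?_
  · obtain ⟨φ, hφ, he, hφg⟩ := key
    exact ⟨φ, hφ, he, fun z hz => by rw [hφg z hz, h1 z (hFK z hz), mul_one]⟩
  · intro z hz
    rw [evenAt_mul_iff hM hg hh]
    have : EvenAt h z := evenAt_of_ne hh.1 (by rw [h1 z (hFK z hz)]; simp)
    simp [this, hgK z hz]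
  · intro z
    rw [hom, hodd, inter_comm, inter_symmDiff_distrib_left,
      even_symmDiff (hfin.subset inter_subset_right) (hpf.subset inter_subset_right),
      inter_comm _ (OddSet g)]
    suffices Even (connectedComponentIn Kᶜ z ∩ {x, y}).ncard by simp only [this, iff_true]; exact hev z
    have hiff : x ∈ connectedComponentIn Kᶜ z ↔ y ∈ connectedComponentIn Kᶜ z := by
      have e3 := connectedComponentIn_eq hyF
      constructor
      · intro h; rw [connectedComponentIn_eq h]; exact hyF
      · intro h; rw [connectedComponentIn_eq h, ← e3]; exact hxF
    by_cases hxz : x ∈ connectedComponentIn Kᶜ z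
    · rw [inter_eq_right.2 (by rintro _ (rfl | rfl); exacts [hxz, hiff.1 hxz]), ncard_pair hyx.symm]
      decide
    · rw [show connectedComponentIn Kᶜ z ∩ {x, y} = ∅ by
        rw [inter_comm, insert_inter_of_notMem hxz, singleton_inter_of_notMem (fun h => hxz (hiff.2 h))]]
      simp

/-- root sign along a preconnected set -/
theorem sign_const {X : Type*} [TopologicalSpace X] {S : Set X} (hS : IsPreconnected S) {f : X → ℂ}
    (hf : ContinuousOn f S) (h : ∀ x ∈ S, f x ^ 2 = 1) {x y : X} (hx : x ∈ S) (hy : y ∈ S) :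
    f x = f y := by
  rcases hS.eq_one_or_eq_neg_one_of_sq_eq hf (fun x hx => h x hx) with h1 | h1
  · rw [h1 hx, h1 hy]; rfl
  · rw [h1 hx, h1 hy]; rfl

theorem root_seg {f : ℝ → ℂ} (hf : Continuous f) (a b : Prop) [Decidable a] [Decidable b]
    (h : ∀ t ∈ Icc (-1 : ℝ) 1, f t ^ 2 = (if a then Complex.exp (rho t * Complex.I) else 1) *
      (if b then Complex.exp (rho t * Complex.I) else 1)) :
    f 1 = (if (a ↔ b) then 1 else -1) * f (-1) := by
  -- multiply by an explicit inverse root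
  have key : ∀ q : ℝ, (∀ t ∈ Icc (-1 : ℝ) 1, (if a then Complex.exp (rho t * Complex.I) else 1) *
      (if b then Complex.exp (rho t * Complex.I) else 1) = Complex.exp (rho t * q * Complex.I) ^ 2) →
      f 1 = Complex.exp ((2 * Real.pi : ℝ) * q * Complex.I) * f (-1) := by
    intro q hq
    have h1 := sign_const (S := Icc (-1 : ℝ) 1) isPreconnected_Icc
      (f := fun t => f t * Complex.exp (-(rho t * q * Complex.I)))
      (by have := rho_cont; fun_prop) ?_ (x := 1) (y := -1) (by simp) (by simp)
    · simp only [rho_left le_rfl, rho_right le_rfl] at h1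
      rw [Complex.exp_neg, Complex.ofReal_zero, zero_mul, zero_mul, neg_zero, Complex.exp_zero, mul_one,
        ← div_eq_mul_inv, div_eq_iff (Complex.exp_ne_zero _)] at h1
      rw [h1, mul_comm]
    · intro t ht
      rw [mul_pow, h t ht, hq t ht, ← mul_pow, ← Complex.exp_add]; simp
  by_cases ha : a <;> by_cases hb : b
  · rw [key 1 (fun t _ => by simp [ha, hb, sq])]
    simp [ha, hb, Complex.exp_two_pi_mul_I]
  · rw [key (1/2) (fun t _ => by rw [if_pos ha, if_neg hb, mul_one, ← Complex.exp_nat_mul]; congr 1; push_cast; ring)]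
    rw [show ((2 * Real.pi : ℝ) : ℂ) * ((1/2 : ℝ) : ℂ) * Complex.I = Real.pi * Complex.I by push_cast; ring]
    simp [ha, hb, Complex.exp_pi_mul_I]
  · rw [key (1/2) (fun t _ => by rw [if_neg ha, if_pos hb, one_mul, ← Complex.exp_nat_mul]; congr 1; push_cast; ring)]
    rw [show ((2 * Real.pi : ℝ) : ℂ) * ((1/2 : ℝ) : ℂ) * Complex.I = Real.pi * Complex.I by push_cast; ring]
    simp [ha, hb, Complex.exp_pi_mul_I]
  · rw [key 0 (fun t _ => by simp [ha, hb])]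
    simp [ha, hb]

namespace Config
variable {M V E : Type*} [TopologicalSpace M] [T2Space M] [CompactSpace M] 

theorem odd_prod_sub (hM : Surf M) (C : Config M V E) (m : Finset E) {x : M} (hx : x ∈ C.net) :
    EvenAt (fun x => ∏ e ∈ m, fe (C.ι e) x) x := by
  have hg : Good (fun x => ∏ e ∈ m, fe (C.ι e) x) := Good.prod _ fun e _ => fe_good (C.emb e)
  apply evenAt_of_ne hg.1
  classical
  rcases hx with h | h
  · obtain ⟨v, h⟩ := mem_iUnion.1 h
    rw [C.prod_blob h]; simp
  · obtain ⟨e, t, ht, rfl⟩ := mem_iUnion.1 h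
    simp only []
    rw [C.prod_seg ht]
    split_ifs
    · exact Complex.exp_ne_zero _
    · simp

theorem claimB1 [Finite V] [Finite E] (hM : Surf M) (C : Config M V E) (m : Finset E)
    (hm : ∀ x, Even (∑ e ∈ m, C.cnt (connectedComponentIn C.netᶜ x) e)) :
    ∃ φ, Good φ ∧ (∀ x, EvenAt φ x) ∧ ∀ x ∈ C.net, φ x = ∏ e ∈ m, fe (C.ι e) x :=
  flatten hM C.net_closed _ (Good.prod _ fun e _ => fe_good (C.emb e)) rfl
    (fun _ hx => C.odd_prod_sub hM m hx) fun x => (C.par_prod hM _ m).2 (hm x)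

theorem claimB2 (C : Config M V E) (m m' : Finset E) {s : M → ℂ} (hs : Continuous s)
    (h : ∀ x ∈ C.net, s x ^ 2 = (∏ e ∈ m, fe (C.ι e) x) * ∏ e ∈ m', fe (C.ι e) x) :
    ∃ b : V → ZMod 2, ∀ e, (b (C.u e) = b (C.w e)) ↔ (e ∈ m ↔ e ∈ m') := by
  classical
  have hB : ∀ v, ∀ x ∈ C.B v, s x ^ 2 = 1 := fun v x hx => by
    rw [h x (C.B_sub v hx), C.prod_blob hx, C.prod_blob hx, one_mul]
  let b : V → ZMod 2 := fun v => if ∃ x ∈ C.B v, s x = 1 then 1 else 0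
  have hb : ∀ v, ∀ x ∈ C.B v, s x = if b v = 1 then 1 else -1 := by
    intro v x hx
    by_cases hv : ∃ x ∈ C.B v, s x = 1
    · simp only [b, if_pos hv]
      obtain ⟨y, hy, hy1⟩ := hv
      rw [sign_const (C.Bp v) hs.continuousOn (hB v) hx hy, hy1]; simp
    · simp only [b, if_neg hv]
      push Not at hv
      rcases mul_self_eq_one_iff.1 ((sq _).symm.trans (hB v x hx)) with h | h
      · exact absurd h (hv x hx)
      · simp [h]
  refine ⟨b, fun e => ?_⟩
  have h1 := root_seg (f := fun t : ℝ => s (C.ι e t)) (by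
      exact hs.comp ((C.emb e).continuous.comp Complex.continuous_ofReal)) (e ∈ m) (e ∈ m') (by
      intro t ht
      rw [h _ (C.seg_sub e ⟨t, ht, rfl⟩), C.prod_seg ht, C.prod_seg ht])
  simp only [Complex.ofReal_one, Complex.ofReal_neg] at h1
  rw [hb _ _ (C.hl e), hb _ _ (C.hr e)] at h1
  have h2 : ∀ a c : ZMod 2, (a = c ↔ (a = 1 ↔ c = 1)) := by decide
  rw [h2]
  by_cases p : b (C.u e) = 1 <;> by_cases q : b (C.w e) = 1 <;> by_cases r : (e ∈ m ↔ e ∈ m') <;>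
    simp only [p, q, r, if_true, if_false] at h1 ⊢ <;> first | (exfalso; norm_num at h1; done) | simp
end Config
end SurfUB

namespace SurfUB
open Set Filter Topology

open Classical in
/-- purely combinatorial output -/
def PlanarLike {V E : Type*} [Fintype V] [Fintype E] (u w : E → V) (N : ℕ) : Prop :=
  ∃ b : Finset (E → ZMod 2), LinearIndependent (ZMod 2) (Subtype.val : b → E → ZMod 2) ∧
    (∀ e, (b.filter fun x => x e ≠ 0).card ≤ 2) ∧
    (∀ x ∈ b, ∀ v, ∑ e with u e = v ∨ w e = v, x e = 0) ∧
    Fintype.card E ≤ b.card + Fintype.card V + N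

theorem zmod2_sum {E : Type*} [Fintype E] [DecidableEq E] (x : E → ZMod 2) (c : E → ℕ) :
    (∑ e, x e * (c e : ZMod 2) = 0) ↔ Even (∑ e with x e = 1, c e) := by
  rw [← ZMod.natCast_eq_zero_iff_even]
  push_cast
  rw [Finset.sum_filter]
  have : ∀ a : ZMod 2, ∀ d, a * d = if a = 1 then d else 0 := by decide
  rw [Finset.sum_congr rfl fun e _ => this (x e) _]

namespace Config
variable {M V E : Type*} [TopologicalSpace M] [T2Space M] [CompactSpace M] 

theorem planar [Fintype V] [Fintype E] (hM : Surf M) (C : Config M V E) {N : ℕ}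
    (sig : (M → ℂ) → Fin N) (hsig : ∀ φ ψ : M → ℂ, Good φ → Good ψ →
      (∀ x, EvenAt φ x) → (∀ x, EvenAt ψ x) → sig φ = sig ψ →
      ∃ s : M → ℂ, Continuous s ∧ ∀ x, s x ^ 2 = φ x * ψ x) : PlanarLike C.u C.w N := by
  classical
  have := hM.locConn
  let cc : M → Set M := fun x => connectedComponentIn C.netᶜ x
  let row : M → E → ZMod 2 := fun x e => (C.cnt (cc x) e : ZMod 2)
  obtain ⟨b0, hb0, hspan, hlin⟩ := exists_linearIndependent (ZMod 2) (range row)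
  have hfin : b0.Finite := Set.toFinite _
  let b := hfin.toFinset
  have hbm : ∀ x, x ∈ b ↔ x ∈ b0 := fun x => hfin.mem_toFinset
  refine ⟨b, ?_, ?_, ?_, ?_⟩
  · exact hlin.comp (fun x : b => (⟨x.1, (hbm _).1 x.2⟩ : b0)) fun x y h => Subtype.ext (by simpa using h)
  · intro e
    refine (Finset.card_le_card (t := {row (C.ι e pp), row (C.ι e pm)}) ?_).trans Finset.card_le_two
    intro x hx
    rw [Finset.mem_filter, hbm] at hx
    obtain ⟨y, rfl⟩ := hb0 hx.1
    have hx2 : C.cnt (cc y) e ≠ 0 := fun h => hx.2 (by simp only [row, h]; simp)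
    unfold cnt at hx2
    simp only [Finset.mem_insert, Finset.mem_singleton]
    by_cases h1 : C.ι e pp ∈ cc y
    · left
      have : cc y = cc (C.ι e pp) := connectedComponentIn_eq h1
      funext e'; simp only [row, this]
    · by_cases h2 : C.ι e pm ∈ cc y
      · right
        have : cc y = cc (C.ι e pm) := connectedComponentIn_eq h2
        funext e'; simp only [row, this]
      · exact absurd (by simp [h1, h2]) hx2
  · intro x hx v
    obtain ⟨y, rfl⟩ := hb0 ((hbm _).1 hx)
    have := C.claimA hM v (F := cc y) C.net_closed.isOpen_compl.connectedComponentIn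
      (comp_frontier C.net_closed y) (Finset.univ.filter fun e => C.u e = v ∨ C.w e = v)
      (fun e => by simp)
    rw [← ZMod.natCast_eq_zero_iff_even] at this
    push_cast at this
    exact this
  · -- counting
    let L : (E → ZMod 2) →ₗ[ZMod 2] (b → ZMod 2) :=
      { toFun := fun m x => ∑ e, m e * x.1 e
        map_add' := fun m m' => by
          funext x; simp [add_mul, Finset.sum_add_distrib]
        map_smul' := fun c m => by
          funext x; simp [Finset.mul_sum, mul_assoc] }
    have hW : ∀ m ∈ LinearMap.ker L, ∀ y, ∑ e, m e * row y e = 0 := by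
      intro m hm y
      have h1 : ∀ x ∈ b0, ∑ e, m e * x e = 0 := fun x hx => by
        have := congrFun (LinearMap.mem_ker.1 hm) ⟨x, (hbm x).2 hx⟩
        simpa [L] using this
      let D : (E → ZMod 2) →ₗ[ZMod 2] ZMod 2 :=
        { toFun := fun x => ∑ e, m e * x e
          map_add' := fun m m' => by simp [mul_add, Finset.sum_add_distrib]
          map_smul' := fun c m => by simp [Finset.mul_sum, mul_left_comm] }
      have h2 : Submodule.span (ZMod 2) b0 ≤ LinearMap.ker D :=
        Submodule.span_le.2 fun x hx => LinearMap.mem_ker.2 (h1 x hx)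
      rw [hspan] at h2
      exact LinearMap.mem_ker.1 (h2 (Submodule.subset_span ⟨y, rfl⟩))
    let su : (E → ZMod 2) → Finset E := fun m => Finset.univ.filter fun e => m e = 1
    have hφ : ∀ m : LinearMap.ker L, ∃ φ, Good φ ∧ (∀ x, EvenAt φ x) ∧
        ∀ x ∈ C.net, φ x = ∏ e ∈ su m.1, fe (C.ι e) x := fun m =>
      C.claimB1 hM (su m.1) fun x => (zmod2_sum _ _).1 (hW m.1 m.2 x)
    choose φ hφ1 hφ2 hφ3 using hφ
    have hb : ∀ m m' : LinearMap.ker L, sig (φ m) = sig (φ m') →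
        ∃ β : V → ZMod 2, ∀ e, m.1 e + m'.1 e = β (C.u e) + β (C.w e) := by
      intro m m' h
      obtain ⟨s, hs, hs2⟩ := hsig _ _ (hφ1 m) (hφ1 m') (hφ2 m) (hφ2 m') h
      obtain ⟨β, hβ⟩ := C.claimB2 (su m.1) (su m'.1) hs fun x hx => by
        rw [hs2, hφ3 m x hx, hφ3 m' x hx]
      refine ⟨β, fun e => ?_⟩
      have := hβ e
      simp only [su, Finset.mem_filter, Finset.mem_univ, true_and] at this
      have h2 : ∀ a b c d : ZMod 2, (a = b ↔ (c = 1 ↔ d = 1)) → c + d = a + b := by decide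
      exact h2 _ _ _ _ this
    let base : Fin N → (LinearMap.ker L) := fun i =>
      if h : ∃ m, sig (φ m) = i then h.choose else 0
    have hbase : ∀ m, sig (φ m) = sig (φ (base (sig (φ m)))) := fun m => by
      have h : ∃ m', sig (φ m') = sig (φ m) := ⟨m, rfl⟩
      simp only [base, dif_pos h]
      exact h.choose_spec.symm
    choose β hβ using fun m => hb m (base (sig (φ m))) (hbase m)
    have hinj : Function.Injective (fun m : LinearMap.ker L => (sig (φ m), β m)) := by
      intro m m' h
      rw [Prod.mk.injEq] at h
      apply Subtype.ext
      funext e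
      have h1 := hβ m e
      have h2 := hβ m' e
      rw [← h.1, ← h.2, ← h1] at h2
      exact (add_right_cancel h2).symm
    have hcard := Fintype.card_le_of_injective _ hinj
    rw [Fintype.card_prod, Fintype.card_fin, Fintype.card_fun, ZMod.card,
      Module.card_eq_pow_finrank (K := ZMod 2), ZMod.card] at hcard
    have hrn := L.finrank_range_add_finrank_ker
    have hr : Module.finrank (ZMod 2) (LinearMap.range L) ≤ b.card := by
      refine (Submodule.finrank_le _).trans ?_
      simp
    rw [Module.finrank_fintype_fun_eq_card] at hrn
    have h3 : 2 ^ Module.finrank (ZMod 2) (LinearMap.ker L) ≤ 2 ^ (N + Fintype.card V) := by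
      refine hcard.trans ?_
      rw [pow_add]
      exact Nat.mul_le_mul_right _ Nat.lt_two_pow_self.le
    have h4 := (Nat.pow_le_pow_iff_right (by norm_num)).1 h3
    omega
end Config

theorem planar_of_config (M : Type*) [TopologicalSpace M] [T2Space M] [CompactSpace M] (hM : Surf M) :
    ∃ N : ℕ, ∀ {V E : Type} [Fintype V] [Fintype E] (C : Config M V E), PlanarLike C.u C.w N := by
  obtain ⟨N, sig, hsig⟩ := finite_classes M hM
  exact ⟨N, fun C => C.planar hM sig hsig⟩
end SurfUB

namespace SurfUB
open Set Filter Topology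

theorem gap {X : Type*} [TopologicalSpace X] {f : ℝ → X} (hf : Continuous f) {P Q : Set X}
    (hP : IsClosed P) (hQ : IsClosed Q) {a b : ℝ} (hab : a ≤ b) (ha : f a ∈ P) (hb : f b ∈ Q) :
    ∃ s t, a ≤ s ∧ s ≤ t ∧ t ≤ b ∧ f s ∈ P ∧ f t ∈ Q ∧ ∀ x, s < x → x < t → f x ∉ P ∧ f x ∉ Q := by
  obtain ⟨t, ⟨⟨ht1, ht2⟩, htQ⟩, hmin⟩ :=
    ((isCompact_Icc (a := a) (b := b)).inter_right (hQ.preimage hf)).exists_isLeast ⟨b, ⟨hab, le_rfl⟩, hb⟩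
  obtain ⟨s, ⟨⟨hs1, hs2⟩, hsP⟩, hmax⟩ :=
    ((isCompact_Icc (a := a) (b := t)).inter_right (hP.preimage hf)).exists_isGreatest ⟨a, ⟨le_rfl, ht1⟩, ha⟩
  refine ⟨s, t, hs1, hs2, ht2, hsP, htQ, fun x hx1 hx2 => ⟨fun h => ?_, fun h => ?_⟩⟩
  · exact absurd (hmax ⟨⟨by linarith, hx2.le⟩, h⟩) (not_le.2 hx1)
  · exact absurd (hmin ⟨⟨by linarith, by linarith⟩, h⟩) (not_le.2 hx2)

/-- affine map sending -1 to a and 1 to b -/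
noncomputable def aff (a b z : ℂ) : ℂ := (b - a) / 2 * z + (a + b) / 2

theorem aff_l (a b : ℂ) : aff a b (-1) = a := by unfold aff; ring
theorem aff_r (a b : ℂ) : aff a b 1 = b := by unfold aff; ring

theorem aff_emb {a b : ℂ} (h : a ≠ b) : IsOpenEmbedding (aff a b) := by
  have h2 : (b - a) / 2 ≠ 0 := div_ne_zero (sub_ne_zero.2 h.symm) two_ne_zero
  have : aff a b = (Homeomorph.addRight ((a + b) / 2)) ∘ (Homeomorph.mulLeft₀ _ h2) := by
    funext z; simp [aff]
  rw [this]
  exact (Homeomorph.isOpenEmbedding _).comp (Homeomorph.isOpenEmbedding _)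

/-- tree state -/
structure TS {M I : Type*} [TopologicalSpace M] (O : Set M) (C : I → Set M) (root : I) (J : Finset I) where
  B : I → Set M
  par : I → I
  rk : I → ℕ
  ι : I → ℂ → M
  hCB : ∀ i, C i ⊆ B i
  hBO : ∀ i, B i ⊆ C i ∪ O
  hBc : ∀ i, IsCompact (B i)
  hBp : ∀ i, IsPreconnected (B i)
  hBd : ∀ i i' x, x ∈ B i → x ∈ B i' → i = i'
  hBJ : ∀ i ∉ J, B i = C i
  hroot : root ∈ J
  hpar : ∀ j ∈ J, j ≠ root → par j ∈ J
  hrk : ∀ j ∈ J, j ≠ root → rk (par j) < rk j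
  hemb : ∀ j ∈ J, j ≠ root → IsOpenEmbedding (ι j)
  hO : ∀ j ∈ J, j ≠ root → ∀ t ∈ Icc (-1 : ℝ) 1, ι j t ∈ O
  hl : ∀ j ∈ J, j ≠ root → ι j (-1) ∈ B (par j)
  hr : ∀ j ∈ J, j ≠ root → ι j 1 ∈ B j
  hin : ∀ j ∈ J, j ≠ root → ∀ t ∈ Ioo (-1 : ℝ) 1, ∀ i, ι j t ∉ B i
  hdis : ∀ j ∈ J, j ≠ root → ∀ j' ∈ J, j' ≠ root → ∀ t ∈ Ioo (-1 : ℝ) 1, ∀ t' ∈ Ioo (-1 : ℝ) 1,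
    ι j t = ι j' t' → j = j'

namespace TS
variable {M I : Type*} [TopologicalSpace M] {O : Set M} {C : I → Set M} {root : I} {J : Finset I}

/-- drawn part -/
def P (S : TS O C root J) : Set M :=
  {x | (∃ i ∈ J, x ∈ S.B i) ∨ ∃ j ∈ J, j ≠ root ∧ ∃ t ∈ Ioo (-1 : ℝ) 1, S.ι j t = x}

theorem P_closed [T2Space M] (S : TS O C root J) : IsClosed S.P := by
  classical
  have : S.P = (⋃ i ∈ J, S.B i) ∪ ⋃ j ∈ J.erase root, (fun t : ℝ => S.ι j t) '' Icc (-1) 1 := by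
    ext x
    simp only [P, mem_ofPred_eq, mem_union, mem_iUnion, exists_prop, Finset.mem_erase]
    constructor
    · rintro (h | ⟨j, hj, hj', t, ht, rfl⟩)
      · exact Or.inl h
      · exact Or.inr ⟨j, ⟨hj', hj⟩, t, Ioo_subset_Icc_self ht, rfl⟩
    · rintro (h | ⟨j, ⟨hj', hj⟩, t, ht, rfl⟩)
      · exact Or.inl h
      · rcases eq_or_lt_of_le ht.1 with h | h
        · left; refine ⟨_, S.hpar j hj hj', ?_⟩
          rw [← h]; simpa using S.hl j hj hj'
        rcases eq_or_lt_of_le ht.2 with h' | h'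
        · left; refine ⟨_, hj, ?_⟩
          rw [h']; simpa using S.hr j hj hj'
        exact Or.inr ⟨j, hj, hj', t, ⟨h, h'⟩, rfl⟩
  rw [this]
  refine IsClosed.union ?_ ?_
  · exact J.finite_toSet.isClosed_biUnion fun i _ => (S.hBc i).isClosed
  · refine (J.erase root).finite_toSet.isClosed_biUnion fun j hj => IsCompact.isClosed ?_
    have hj := Finset.mem_erase.1 hj
    exact isCompact_Icc.image ((S.hemb j hj.2 hj.1).continuous.comp Complex.continuous_ofReal)

theorem aff_real (a b t : ℝ) : aff a b t = (((b - a) / 2 * t + (a + b) / 2 : ℝ) : ℂ) := by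
  simp [aff]

theorem step1 [DecidableEq I] (S : TS O C root J) {p : M} (hp : p ∈ S.P) :
    ∃ S' : TS O C root J, S'.P ⊆ S.P ∧ ∃ i ∈ J, p ∈ S'.B i := by
  rcases hp with h | ⟨j, hj, hj', a, ha, rfl⟩
  · exact ⟨S, Subset.rfl, h⟩
  have hcont : Continuous fun t : ℝ => S.ι j t := (S.hemb j hj hj').continuous.comp Complex.continuous_ofReal
  let T : Set M := (fun t : ℝ => S.ι j t) '' Icc a 1
  have hT1 : S.ι j 1 ∈ T := ⟨1, ⟨ha.2.le, le_rfl⟩, by simp⟩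
  let B' : I → Set M := Function.update S.B j (S.B j ∪ T)
  let ι' : I → ℂ → M := Function.update S.ι j (fun z => S.ι j (aff (-1 : ℝ) a z))
  -- membership facts
  have hTm : ∀ x ∈ T, x ∈ S.B j ∨ ∃ t ∈ Ioo (-1 : ℝ) 1, a ≤ t ∧ S.ι j t = x := by
    rintro x ⟨t, ht, rfl⟩
    rcases eq_or_lt_of_le ht.2 with h | h
    · left; rw [h]; simpa using S.hr j hj hj'
    · right; exact ⟨t, ⟨ha.1.trans_le ht.1, h⟩, ht.1, rfl⟩
  have hB'j : B' j = S.B j ∪ T := by simp [B']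
  have hB' : ∀ i, i ≠ j → B' i = S.B i := fun i hi => by simp [B', hi]
  have hBm : ∀ i x, x ∈ B' i → x ∈ S.B i ∨ (i = j ∧ ∃ t ∈ Ioo (-1 : ℝ) 1, a ≤ t ∧ S.ι j t = x) := by
    intro i x hx
    by_cases h : i = j
    · subst h
      rw [hB'j] at hx
      rcases hx with hx | hx
      · exact Or.inl hx
      · rcases hTm x hx with h | h
        · exact Or.inl h
        · exact Or.inr ⟨rfl, h⟩
    · rw [hB' i h] at hx; exact Or.inl hx
  have hBsub : ∀ i, S.B i ⊆ B' i := by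
    intro i
    by_cases h : i = j
    · subst h; rw [hB'j]; exact subset_union_left
    · rw [hB' i h]
  have hι'j : ι' j = fun z => S.ι j (aff (-1 : ℝ) a z) := by simp [ι']
  have hι' : ∀ i, i ≠ j → ι' i = S.ι i := fun i hi => by simp [ι', hi]
  have hιm : ∀ t ∈ Icc (-1 : ℝ) 1, ∃ t' ∈ Icc (-1 : ℝ) a, ι' j t = S.ι j t' ∧ (t < 1 → t' < a) ∧ (-1 < t → -1 < t') := by
    intro t ht
    refine ⟨(a - -1) / 2 * t + (-1 + a) / 2, ⟨?_, ?_⟩, ?_, ?_, ?_⟩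
    · nlinarith [ht.1, ht.2, ha.1, ha.2]
    · nlinarith [ht.1, ht.2, ha.1, ha.2]
    · rw [hι'j]; simp only []; rw [aff_real]
    · intro h; nlinarith [ha.1]
    · intro h; nlinarith [ha.1]
  have hιo : ∀ i, ∀ t ∈ Ioo (-1 : ℝ) 1, ∃ t' ∈ Ioo (-1 : ℝ) 1, ι' i t = S.ι i t' ∧ (i = j → t' < a) := by
    intro i t ht
    by_cases h : i = j
    · subst h
      obtain ⟨t', ht', h1, h2, h3⟩ := hιm t (Ioo_subset_Icc_self ht)
      exact ⟨t', ⟨h3 ht.1, (h2 ht.2).trans ha.2⟩, h1, fun _ => h2 ht.2⟩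
    · exact ⟨t, ht, by rw [hι' i h], fun h' => absurd h' h⟩
  have hne : ((-1 : ℝ) : ℂ) ≠ (a : ℂ) := by
    intro h; have : (-1 : ℝ) = a := by exact_mod_cast h
    linarith [ha.1]
  let S' : TS O C root J :=
    { B := B', par := S.par, rk := S.rk, ι := ι'
      hCB := fun i => (S.hCB i).trans (hBsub i)
      hBO := by
        intro i x hx
        rcases hBm i x hx with h | ⟨rfl, t, ht, _, rfl⟩
        · exact S.hBO i h
        · exact Or.inr (S.hO i hj hj' t (Ioo_subset_Icc_self ht))
      hBc := by
        intro i
        by_cases h : i = j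
        · subst h; rw [hB'j]; exact (S.hBc i).union (isCompact_Icc.image hcont)
        · rw [hB' i h]; exact S.hBc i
      hBp := by
        intro i
        by_cases h : i = j
        · subst h; rw [hB'j]
          exact (S.hBp i).union _ (S.hr i hj hj') hT1 (isPreconnected_Icc.image _ hcont.continuousOn)
        · rw [hB' i h]; exact S.hBp i
      hBd := by
        intro i i' x hx hx'
        rcases hBm i x hx with h | ⟨rfl, t, ht, _, rfl⟩
        · rcases hBm i' x hx' with h' | ⟨rfl, t, ht, _, rfl⟩
          · exact S.hBd _ _ _ h h'
          · exact absurd h (S.hin _ hj hj' t ht _)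
        · rcases hBm i' _ hx' with h' | ⟨rfl, t, ht, _, h⟩
          · exact absurd h' (S.hin _ hj hj' t ht _)
          · rfl
      hBJ := fun i hi => by
        rw [hB' i (fun h => hi (h ▸ hj))]; exact S.hBJ i hi
      hroot := S.hroot
      hpar := S.hpar
      hrk := S.hrk
      hemb := by
        intro i hi hi'
        by_cases h : i = j
        · subst h; rw [hι'j]; exact (S.hemb i hi hi').comp (aff_emb hne)
        · rw [hι' i h]; exact S.hemb i hi hi'
      hO := by
        intro i hi hi' t ht
        by_cases h : i = j
        · subst h
          obtain ⟨t', ht', h1, -⟩ := hιm t ht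
          rw [h1]; exact S.hO i hi hi' t' ⟨ht'.1, ht'.2.trans ha.2.le⟩
        · rw [hι' i h]; exact S.hO i hi hi' t ht
      hl := by
        intro i hi hi'
        apply hBsub
        by_cases h : i = j
        · subst h; rw [hι'j]; simp only []; rw [aff_l]
          simpa using S.hl i hi hi'
        · rw [hι' i h]; exact S.hl i hi hi'
      hr := by
        intro i hi hi'
        by_cases h : i = j
        · subst h; rw [hι'j, hB'j]; simp only []; rw [aff_r]
          exact Or.inr ⟨a, ⟨le_rfl, ha.2.le⟩, rfl⟩
        · rw [hι' i h]; exact hBsub _ (S.hr i hi hi')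
      hin := by
        intro i hi hi' t ht i1 hx
        obtain ⟨t', ht', h1, h2⟩ := hιo i t ht
        rw [h1] at hx
        rcases hBm i1 _ hx with h | ⟨rfl, t2, ht2, h3, h4⟩
        · exact S.hin i hi hi' t' ht' _ h
        · obtain rfl := S.hdis _ hj hj' _ hi hi' _ ht2 _ ht' h4
          have := (S.hemb _ hj hj').injective h4
          have h5 : t2 = t' := by exact_mod_cast this
          have := h2 rfl
          linarith
      hdis := by
        intro i hi hi' i1 hi1 hi1' t ht t1 ht1 h
        obtain ⟨t', ht', h1, h2⟩ := hιo i t ht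
        obtain ⟨t1', ht1', h1', h2'⟩ := hιo i1 t1 ht1
        rw [h1, h1'] at h
        exact S.hdis _ hi hi' _ hi1 hi1' _ ht' _ ht1' h }
  refine ⟨S', ?_, j, hj, ?_⟩
  · rintro x (⟨i, hi, hx⟩ | ⟨i, hi, hi', t, ht, rfl⟩)
    · rcases hBm i x hx with h | ⟨rfl, t, ht, _, rfl⟩
      · exact Or.inl ⟨i, hi, h⟩
      · exact Or.inr ⟨_, hj, hj', t, ht, rfl⟩
    · obtain ⟨t', ht', h1, h2⟩ := hιo i t ht
      exact Or.inr ⟨i, hi, hi', t', ht', h1.symm⟩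
  · show _ ∈ B' j
    rw [hB'j]; exact Or.inr ⟨a, ⟨le_rfl, ha.2.le⟩, rfl⟩
end TS
end SurfUB

namespace SurfUB
open Set Filter Topology
namespace TS
variable {M I : Type*} [TopologicalSpace M] {O : Set M} {C : I → Set M} {root : I} {J : Finset I}

/-- add a tentacle and a short edge -/
theorem step2 [DecidableEq I] [T2Space M] (hM : Surf M) (hO : IsOpen O) [Finite I]
    (S : TS O C root J) (hCc : ∀ i, IsCompact (C i))
    {γ : ℝ → M} (hγ : Continuous γ) {s t : ℝ} (hst : s < t) (hγO : ∀ x ∈ Icc s t, γ x ∈ O)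
    {i0 j : I} (hi0 : i0 ∈ J) (hs : γ s ∈ S.B i0) (hjJ : j ∉ J) (ht : γ t ∈ C j)
    (hgap : ∀ x, s < x → x < t → γ x ∉ S.P ∧ ∀ i ∉ J, γ x ∉ C i) :
    Nonempty (TS O C root (insert j J)) := by
  have hCP : ∀ i ∉ J, ∀ x ∈ C i, x ∉ S.P := by
    rintro i hi x hx (⟨i', hi', h⟩ | ⟨j, hj, hj', a, ha, rfl⟩)
    · rw [← S.hBJ i hi] at hx
      exact hi (S.hBd _ _ _ hx h ▸ hi')
    · rw [← S.hBJ i hi] at hx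
      exact S.hin j hj hj' a ha _ hx
  have hBP : ∀ i ∈ J, ∀ x ∈ S.B i, x ∈ S.P := fun i hi x hx => Or.inl ⟨i, hi, hx⟩
  -- chart
  have hU : (O ∩ S.Pᶜ) ∩ (⋂ i ∈ {i | i ∉ J ∧ i ≠ j}, (C i)ᶜ) ∈ 𝓝 (γ t) := by
    refine inter_mem (inter_mem (hO.mem_nhds (hγO t ⟨hst.le, le_rfl⟩))
      (S.P_closed.isOpen_compl.mem_nhds (hCP j hjJ _ ht))) ?_
    refine (biInter_mem (Set.toFinite _)).2 fun i hi => (hCc i).isClosed.isOpen_compl.mem_nhds ?_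
    intro h
    rw [← S.hBJ i hi.1] at h
    rw [← S.hBJ j hjJ] at ht
    exact hi.2 (S.hBd _ _ _ h ht)
  obtain ⟨κ, hκ, hκ0, hκr⟩ := hM _ _ hU
  have hκO : ∀ z, κ z ∈ O := fun z => (hκr ⟨z, rfl⟩).1.1
  have hκP : ∀ z, κ z ∉ S.P := fun z => (hκr ⟨z, rfl⟩).1.2
  have hκC : ∀ z, ∀ i ∉ J, i ≠ j → κ z ∉ C i := fun z i hi hij =>
    mem_iInter₂.1 (hκr ⟨z, rfl⟩).2 i ⟨hi, hij⟩
  -- t2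
  obtain ⟨t2, ht2s, ht2t, w, hw⟩ : ∃ t2, s < t2 ∧ t2 < t ∧ ∃ w, κ w = γ t2 := by
    have h1 : γ ⁻¹' range κ ∈ 𝓝 t := hγ.continuousAt.preimage_mem_nhds
      (hκ.isOpen_range.mem_nhds ⟨0, hκ0⟩)
    have h2 : ∀ᶠ x in 𝓝[<] t, x ∈ γ ⁻¹' range κ := nhdsWithin_le_nhds h1
    have h3 : ∀ᶠ x in 𝓝[<] t, x ∈ Ioo s t := Ioo_mem_nhdsLT hst
    obtain ⟨x, ⟨w, hw⟩, hx⟩ := (h2.and h3).exists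
    exact ⟨x, hx.1, hx.2, w, hw⟩
  have hγC : ∀ x ∈ Icc s t2, ∀ i ∉ J, γ x ∉ C i := by
    intro x hx i hi h
    rcases eq_or_lt_of_le hx.1 with h' | h'
    · subst h'; exact hCP i hi _ h (hBP _ hi0 _ hs)
    · exact (hgap x h' (hx.2.trans_lt ht2t)).2 i hi h
  have hγP : ∀ x ∈ Icc s t2, γ x ∈ S.P → γ x = γ s := by
    intro x hx h
    rcases eq_or_lt_of_le hx.1 with h' | h'
    · rw [h']
    · exact absurd h (hgap x h' (hx.2.trans_lt ht2t)).1
  have hw0 : w ≠ 0 := by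
    rintro rfl
    rw [hκ0] at hw
    exact hγC t2 ⟨ht2s.le, le_rfl⟩ j hjJ (hw ▸ ht)
  let T : Set M := γ '' Icc s t2
  have hTc : IsCompact T := isCompact_Icc.image hγ
  have hTp : IsPreconnected T := isPreconnected_Icc.image _ hγ.continuousOn
  have hTs : γ s ∈ T := ⟨s, ⟨le_rfl, ht2s.le⟩, rfl⟩
  obtain ⟨x1, x2, hx1, hx12, hx2, hT1, hC2, hg⟩ := gap (f := fun x : ℝ => κ ((1 - x : ℝ) * w))
    (hκ.continuous.comp (by fun_prop)) hTc.isClosed (hCc j).isClosed (a := 0) (b := 1) zero_le_one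
    (by simp only [sub_zero, Complex.ofReal_one, one_mul]; rw [hw]; exact ⟨t2, ⟨ht2s.le, le_rfl⟩, rfl⟩)
    (by simp only [sub_self, Complex.ofReal_zero, zero_mul]; rw [hκ0]; exact ht)
  have hx12' : x1 < x2 := by
    rcases eq_or_lt_of_le hx12 with h | h
    · subst h
      obtain ⟨x, hx, hx'⟩ := hT1
      exact absurd (hx' ▸ hC2) (hγC x hx j hjJ)
    · exact h
  let al : ℂ := (1 - x1 : ℝ) * w
  let be : ℂ := (1 - x2 : ℝ) * w
  have hab : al ≠ be := by
    intro h
    have := mul_right_cancel₀ hw0 h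
    have : (1 - x1 : ℝ) = 1 - x2 := by exact_mod_cast this
    linarith
  let ν : ℂ → M := fun z => κ (aff al be z)
  have hν : IsOpenEmbedding ν := hκ.comp (aff_emb hab)
  have hνin : ∀ a ∈ Ioo (-1 : ℝ) 1, ν a ∉ T ∧ ν a ∉ C j := by
    intro a ha
    have : ν a = κ ((1 - ((x2 - x1) / 2 * a + (x1 + x2) / 2) : ℝ) * w) := by
      simp only [ν, aff, al, be]; congr 1; push_cast; ring
    rw [this]
    apply hg
    · nlinarith [ha.1, ha.2]
    · nlinarith [ha.1, ha.2]
  let B' : I → Set M := Function.update S.B i0 (S.B i0 ∪ T)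
  have hB'i : B' i0 = S.B i0 ∪ T := by simp [B']
  have hB' : ∀ i, i ≠ i0 → B' i = S.B i := fun i hi => by simp [B', hi]
  have hBm : ∀ i x, x ∈ B' i → x ∈ S.B i ∨ (i = i0 ∧ x ∈ T) := by
    intro i x hx
    by_cases h : i = i0
    · subst h; rw [hB'i] at hx
      rcases hx with hx | hx
      · exact Or.inl hx
      · exact Or.inr ⟨rfl, hx⟩
    · rw [hB' i h] at hx; exact Or.inl hx
  have hBsub : ∀ i, S.B i ⊆ B' i := by
    intro i
    by_cases h : i = i0
    · subst h; rw [hB'i]; exact subset_union_left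
    · rw [hB' i h]
  have hTB : ∀ x ∈ T, ∀ i, x ∈ S.B i → i = i0 := by
    rintro _ ⟨x, hx, rfl⟩ i hi
    by_cases hiJ : i ∈ J
    · rw [hγP x hx (hBP i hiJ _ hi)] at hi
      exact S.hBd _ _ _ hi hs
    · rw [S.hBJ i hiJ] at hi
      exact absurd hi (hγC x hx i hiJ)
  have hj0 : j ≠ i0 := fun h => hjJ (h ▸ hi0)
  have hjr : j ≠ root := fun h => hjJ (h ▸ S.hroot)
  have hJj : ∀ i ∈ J, i ≠ j := fun i hi h => hjJ (h ▸ hi)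
  let ι' : I → ℂ → M := Function.update S.ι j ν
  let par' : I → I := Function.update S.par j i0
  let rk' : I → ℕ := Function.update S.rk j (S.rk i0 + 1)
  have eι : ι' j = ν := by simp [ι']
  have epar : par' j = i0 := by simp [par']
  have erk : rk' j = S.rk i0 + 1 := by simp [rk']
  have eι' : ∀ i ∈ J, ι' i = S.ι i := fun i hi => by simp [ι', hJj i hi]
  have epar' : ∀ i ∈ J, par' i = S.par i := fun i hi => by simp [par', hJj i hi]
  have erk' : ∀ i ∈ J, rk' i = S.rk i := fun i hi => by simp [rk', hJj i hi]
  exact ⟨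
    { B := B', par := par', rk := rk', ι := ι'
      hCB := fun i => (S.hCB i).trans (hBsub i)
      hBO := by
        intro i x hx
        rcases hBm i x hx with h | ⟨rfl, y, hy, rfl⟩
        · exact S.hBO i h
        · exact Or.inr (hγO y ⟨hy.1, hy.2.trans ht2t.le⟩)
      hBc := by
        intro i
        by_cases h : i = i0
        · subst h; rw [hB'i]; exact (S.hBc i).union hTc
        · rw [hB' i h]; exact S.hBc i
      hBp := by
        intro i
        by_cases h : i = i0
        · subst h; rw [hB'i]
          exact (S.hBp i).union _ hs hTs hTp
        · rw [hB' i h]; exact S.hBp i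
      hBd := by
        intro i i' x hx hx'
        rcases hBm i x hx with h | ⟨rfl, h⟩
        · rcases hBm i' x hx' with h' | ⟨rfl, h'⟩
          · exact S.hBd _ _ _ h h'
          · exact hTB x h' _ h
        · rcases hBm i' x hx' with h' | ⟨rfl, h'⟩
          · exact (hTB x h _ h').symm
          · rfl
      hBJ := fun i hi => by
        rw [Finset.mem_insert, not_or] at hi
        rw [hB' i (fun h => hi.2 (h ▸ hi0))]; exact S.hBJ i hi.2
      hroot := Finset.mem_insert_of_mem S.hroot
      hpar := by
        intro i hi hi'
        rcases Finset.mem_insert.1 hi with rfl | hi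
        · rw [epar]; exact Finset.mem_insert_of_mem hi0
        · rw [epar' i hi]; exact Finset.mem_insert_of_mem (S.hpar i hi hi')
      hrk := by
        intro i hi hi'
        rcases Finset.mem_insert.1 hi with rfl | hi
        · rw [epar, erk, erk' _ hi0]; exact Nat.lt_succ_self _
        · rw [epar' i hi, erk' i hi, erk' _ (S.hpar i hi hi')]; exact S.hrk i hi hi'
      hemb := by
        intro i hi hi'
        rcases Finset.mem_insert.1 hi with rfl | hi
        · rw [eι]; exact hν
        · rw [eι' i hi]; exact S.hemb i hi hi'
      hO := by
        intro i hi hi' t ht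
        rcases Finset.mem_insert.1 hi with rfl | hi
        · rw [eι]; exact hκO _
        · rw [eι' i hi]; exact S.hO i hi hi' t ht
      hl := by
        intro i hi hi'
        rcases Finset.mem_insert.1 hi with rfl | hi
        · rw [eι, epar, hB'i]; simp only [ν, aff_l]; exact Or.inr hT1
        · rw [eι' i hi, epar' i hi]; exact hBsub _ (S.hl i hi hi')
      hr := by
        intro i hi hi'
        rcases Finset.mem_insert.1 hi with rfl | hi
        · rw [eι]; simp only [ν, aff_r]; exact hBsub _ (S.hCB _ hC2)
        · rw [eι' i hi]; exact hBsub _ (S.hr i hi hi')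
      hin := by
        intro i hi hi' a ha i1 hx
        rcases Finset.mem_insert.1 hi with rfl | hi
        · rw [eι] at hx
          rcases hBm i1 _ hx with h | ⟨rfl, h⟩
          · by_cases h1 : i1 ∈ J
            · exact hκP _ (hBP i1 h1 _ h)
            · rw [S.hBJ i1 h1] at h
              by_cases h2 : i1 = i
              · subst h2; exact (hνin a ha).2 h
              · exact hκC _ i1 h1 h2 h
          · exact (hνin a ha).1 h
        · rw [eι' i hi] at hx
          rcases hBm i1 _ hx with h | ⟨rfl, x, hx, h⟩
          · exact S.hin i hi hi' a ha i1 h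
          · have h2 : S.ι i a ∈ S.P := Or.inr ⟨i, hi, hi', a, ha, rfl⟩
            rw [← h] at h2
            rw [hγP x hx h2] at h
            exact S.hin i hi hi' a ha _ (h ▸ hs)
      hdis := by
        intro i hi hi' i1 hi1 hi1' a ha t1 ht1 h
        rcases Finset.mem_insert.1 hi with rfl | hi2
        · rcases Finset.mem_insert.1 hi1 with rfl | hi1
          · rfl
          · rw [eι, eι' i1 hi1] at h
            exact absurd (Or.inr ⟨i1, hi1, hi1', t1, ht1, h.symm⟩) (hκP _)
        · rcases Finset.mem_insert.1 hi1 with rfl | hi1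
          · rw [eι, eι' i hi2] at h
            exact absurd (Or.inr ⟨i, hi2, hi', a, ha, h⟩) (hκP _)
          · rw [eι' i hi2, eι' i1 hi1] at h
            exact S.hdis _ hi2 hi' _ hi1 hi1' _ ha _ ht1 h }⟩

theorem step [DecidableEq I] [T2Space M] (hM : Surf M) (hO : IsOpen O) [Fintype I]
    (S : TS O C root J) (hCc : ∀ i, IsCompact (C i))
    {Y : Set M} (hY : IsPathConnected Y) (hYO : Y ⊆ O) (hYC : ∀ i, (Y ∩ C i).Nonempty)
    (hJ : J ≠ Finset.univ) : ∃ j ∉ J, Nonempty (TS O C root (insert j J)) := by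
  obtain ⟨j, hj⟩ : ∃ j, j ∉ J := by
    by_contra h; push Not at h; exact hJ (Finset.eq_univ_iff_forall.2 h)
  obtain ⟨x, hxY, hx⟩ := hYC root
  obtain ⟨y, hyY, hy⟩ := hYC j
  obtain ⟨p, hp⟩ := hY.joinedIn x hxY y hyY
  have hpY : ∀ x, p.extend x ∈ Y := fun x => by
    have : p.extend x ∈ range p.extend := ⟨x, rfl⟩
    rw [Path.extend_range] at this
    obtain ⟨t, ht⟩ := this
    rw [← ht]; exact hp t
  have hQ : IsClosed (⋃ i ∈ {i | i ∉ J}, C i) :=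
    (Set.toFinite _).isClosed_biUnion fun i _ => (hCc i).isClosed
  obtain ⟨s, t, hs, hst, ht, hsP, htQ, hgap⟩ := gap p.continuous_extend S.P_closed hQ zero_le_one
    (by rw [p.extend_zero]; exact Or.inl ⟨root, S.hroot, S.hCB _ hx⟩)
    (by rw [p.extend_one]; exact mem_iUnion₂.2 ⟨j, hj, hy⟩)
  obtain ⟨j', hj', hjt⟩ := mem_iUnion₂.1 htQ
  obtain ⟨S', hS', i0, hi0, hi0s⟩ := S.step1 hsP
  have hst' : s < t := by
    rcases eq_or_lt_of_le hst with h | h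
    · subst h
      have h1 := S'.hCB _ hjt
      exact absurd hi0 (S'.hBd _ _ _ h1 hi0s ▸ hj')
    · exact h
  refine ⟨j', hj', S'.step2 hM hO hCc p.continuous_extend hst' (fun x _ => hYO (hpY x)) hi0 hi0s hj' hjt ?_⟩
  intro x h1 h2
  refine ⟨fun h => (hgap x h1 h2).1 (hS' h), fun i hi h => (hgap x h1 h2).2 (mem_iUnion₂.2 ⟨i, hi, h⟩)⟩

theorem full [T2Space M] (hM : Surf M) (hO : IsOpen O) [Fintype I] (root : I)
    (hCc : ∀ i, IsCompact (C i)) (hCp : ∀ i, IsPreconnected (C i))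
    (hCd : ∀ i i' x, x ∈ C i → x ∈ C i' → i = i')
    {Y : Set M} (hY : IsPathConnected Y) (hYO : Y ⊆ O) (hYC : ∀ i, (Y ∩ C i).Nonempty) :
    Nonempty (TS O C root Finset.univ) := by
  classical
  have h0 : Nonempty (TS O C root {root}) := ⟨
    { B := C, par := id, rk := fun _ => 0, ι := fun _ _ => (hYC root).some
      hCB := fun i => Subset.rfl
      hBO := fun i => subset_union_left
      hBc := hCc
      hBp := hCp
      hBd := hCd
      hBJ := fun _ _ => rfl
      hroot := by simp
      hpar := fun j hj h => absurd (Finset.mem_singleton.1 hj) h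
      hrk := fun j hj h => absurd (Finset.mem_singleton.1 hj) h
      hemb := fun j hj h => absurd (Finset.mem_singleton.1 hj) h
      hO := fun j hj h => absurd (Finset.mem_singleton.1 hj) h
      hl := fun j hj h => absurd (Finset.mem_singleton.1 hj) h
      hr := fun j hj h => absurd (Finset.mem_singleton.1 hj) h
      hin := fun j hj h => absurd (Finset.mem_singleton.1 hj) h
      hdis := fun j hj h => absurd (Finset.mem_singleton.1 hj) h }⟩
  have key : ∀ n (J : Finset I), (Finset.univ \ J).card = n → Nonempty (TS O C root J) →
      Nonempty (TS O C root Finset.univ) := by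
    intro n
    induction n with
    | zero =>
      intro J hJ h
      rw [Finset.card_eq_zero, Finset.sdiff_eq_empty_iff_subset, Finset.univ_subset_iff] at hJ
      exact hJ ▸ h
    | succ n ih =>
      rintro J hJ ⟨S⟩
      obtain ⟨j, hj, h⟩ := S.step hM hO hCc hY hYO hYC (by rintro rfl; simp at hJ)
      refine ih _ ?_ h
      rw [Finset.sdiff_insert, Finset.card_erase_of_mem (by simp [hj]), hJ]; rfl
  exact key _ _ rfl h0
end TS
end SurfUB

namespace SurfUB
open Set Filter Topology

theorem sep_family {X T : Type*} [TopologicalSpace X] [T2Space X] [Finite T] {K : T → Set X}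
    (hK : ∀ i, IsCompact (K i)) (hd : ∀ i j x, x ∈ K i → x ∈ K j → i = j) :
    ∃ G : T → Set X, (∀ i, IsOpen (G i)) ∧ (∀ i, K i ⊆ G i) ∧ ∀ i j x, x ∈ G i → x ∈ G j → i = j := by
  classical
  have h : ∀ i j, ∃ U V : Set X, IsOpen U ∧ IsOpen V ∧ K i ⊆ U ∧ K j ⊆ V ∧ (i ≠ j → Disjoint U V) := by
    intro i j
    by_cases hij : i = j
    · exact ⟨univ, univ, isOpen_univ, isOpen_univ, subset_univ _, subset_univ _, fun h => absurd hij h⟩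
    · obtain ⟨U, V, hU, hV, h1, h2, h3⟩ := SeparatedNhds.of_isCompact_isCompact (hK i) (hK j)
        (Set.disjoint_left.2 fun x hx hx' => hij (hd i j x hx hx'))
      exact ⟨U, V, hU, hV, h1, h2, fun _ => h3⟩
  choose U V hU hV hKU hKV hdis using h
  refine ⟨fun i => ⋂ j, U i j ∩ V j i, fun i => isOpen_iInter_of_finite fun j => (hU i j).inter (hV j i),
    fun i => subset_iInter fun j => subset_inter (hKU i j) (hKV j i), fun i j x hx hx' => ?_⟩
  by_contra hij
  exact Set.disjoint_left.1 (hdis i j hij) (mem_iInter.1 hx j).1 (mem_iInter.1 hx' i).2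

theorem thin {U : Set ℂ} (hU : IsOpen U) (h : ∀ t ∈ Icc (-(1 / 2) : ℝ) (1 / 2), (t : ℂ) ∈ U) :
    ∃ h > 0, ∀ x y : ℝ, |x| ≤ 1 / 2 → |y| ≤ h → (x : ℂ) + (y : ℂ) * Complex.I ∈ U := by
  let f : ℝ × ℝ → ℂ := fun p => (p.1 : ℂ) + (p.2 : ℂ) * Complex.I
  have hf : Continuous f := by fun_prop
  obtain ⟨u, v, _, hv, hu1, hv1, huv⟩ := generalized_tube_lemma (isCompact_Icc (a := (-(1 / 2) : ℝ)) (b := 1 / 2))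
    (isCompact_singleton (x := (0 : ℝ))) (hU.preimage hf) (by
      rintro ⟨x, y⟩ ⟨hx, hy⟩
      obtain rfl : y = 0 := hy
      simpa [f] using h x hx)
  obtain ⟨r, hr, hrv⟩ := Metric.isOpen_iff.1 hv 0 (hv1 rfl)
  refine ⟨r / 2, by positivity, fun x y hx hy => ?_⟩
  exact huv (show (x, y) ∈ u ×ˢ v from ⟨hu1 (abs_le.1 hx), hrv (by simp; linarith)⟩)

/-- squeezing homeomorphism -/
noncomputable def squeeze (h : ℝ) (hh : h ≠ 0) : ℂ ≃ₜ ℂ where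
  toFun z := ((z.re / 2 : ℝ) : ℂ) + ((h * z.im : ℝ) : ℂ) * Complex.I
  invFun z := ((z.re * 2 : ℝ) : ℂ) + ((z.im / h : ℝ) : ℂ) * Complex.I
  left_inv z := by apply Complex.ext <;> simp; field_simp
  right_inv z := by apply Complex.ext <;> simp; field_simp
  continuous_toFun := by fun_prop
  continuous_invFun := by fun_prop

/-- configuration with thin edges only -/
structure PreConfig (M V E : Type*) [TopologicalSpace M] where
  u : E → V
  w : E → V
  B : V → Set M
  ι : E → ℂ → M
  ne : ∀ e, u e ≠ w e
  Bc : ∀ v, IsCompact (B v)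
  Bp : ∀ v, IsPreconnected (B v)
  Bd : ∀ v v' x, x ∈ B v → x ∈ B v' → v = v'
  emb : ∀ e, IsOpenEmbedding (ι e)
  hl : ∀ e, ι e (-1) ∈ B (u e)
  hr : ∀ e, ι e 1 ∈ B (w e)
  hin : ∀ e, ∀ t ∈ Ioo (-1 : ℝ) 1, ∀ v, ι e t ∉ B v
  hdis : ∀ e e', ∀ t ∈ Ioo (-1 : ℝ) 1, ∀ t' ∈ Ioo (-1 : ℝ) 1, ι e t = ι e' t' → e = e'

theorem PreConfig.thicken {M V E : Type*} [TopologicalSpace M] [T2Space M] [Finite V] [Finite E]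
    (P : PreConfig M V E) : ∃ C : Config M V E, C.u = P.u ∧ C.w = P.w := by
  have hcont : ∀ e, Continuous fun t : ℝ => P.ι e t := fun e =>
    (P.emb e).continuous.comp Complex.continuous_ofReal
  let sg : E → ℝ → ℝ → Set M := fun e a b => (fun t : ℝ => P.ι e t) '' Icc a b
  have sgc : ∀ e a b, IsCompact (sg e a b) := fun e a b => isCompact_Icc.image (hcont e)
  have sgp : ∀ e a b, IsPreconnected (sg e a b) := fun e a b =>
    isPreconnected_Icc.image _ (hcont e).continuousOn
  let B' : V → Set M := fun v => P.B v ∪ ((⋃ e ∈ {e | P.u e = v}, sg e (-1) (-(1 / 2))) ∪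
    ⋃ e ∈ {e | P.w e = v}, sg e (1 / 2) 1)
  have hBm : ∀ v x, x ∈ B' v → x ∈ P.B v ∨ ∃ e, ∃ t ∈ Ioo (-1 : ℝ) 1, P.ι e t = x ∧
      ((t ≤ -(1 / 2) ∧ P.u e = v) ∨ (1 / 2 ≤ t ∧ P.w e = v)) := by
    rintro v x (h | h | h)
    · exact Or.inl h
    · obtain ⟨e, he, t, ht, rfl⟩ := mem_iUnion₂.1 h
      obtain rfl : P.u e = v := he
      rcases eq_or_lt_of_le ht.1 with h | h
      · left; rw [← h]; simpa using P.hl e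
      · exact Or.inr ⟨e, t, ⟨h, by linarith [ht.2]⟩, rfl, Or.inl ⟨ht.2, rfl⟩⟩
    · obtain ⟨e, he, t, ht, rfl⟩ := mem_iUnion₂.1 h
      obtain rfl : P.w e = v := he
      rcases eq_or_lt_of_le ht.2 with h | h
      · left; rw [h]; simpa using P.hr e
      · exact Or.inr ⟨e, t, ⟨by linarith [ht.1], h⟩, rfl, Or.inr ⟨ht.1, rfl⟩⟩
  obtain ⟨G, hGo, hGs, hGd⟩ := sep_family (K := fun e => sg e (-(1 / 2)) (1 / 2)) (fun e => sgc e _ _) (by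
    rintro e e' x ⟨t, ht, rfl⟩ ⟨t', ht', h⟩
    exact P.hdis _ _ _ ⟨by linarith [ht.1], by linarith [ht.2]⟩ _ ⟨by linarith [ht'.1], by linarith [ht'.2]⟩ h.symm)
  let R : E → Set M := fun e => (⋃ v, P.B v) ∪ ⋃ e' ∈ {e' | e' ≠ e}, sg e' (-1) 1
  have hR : ∀ e, IsClosed (R e) := fun e =>
    (isClosed_iUnion_of_finite fun v => (P.Bc v).isClosed).union
      ((Set.toFinite _).isClosed_biUnion fun e' _ => (sgc e' _ _).isClosed)
  have hth : ∀ e, ∃ h > 0, ∀ x y : ℝ, |x| ≤ 1 / 2 → |y| ≤ h →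
      (x : ℂ) + (y : ℂ) * Complex.I ∈ P.ι e ⁻¹' ((R e)ᶜ ∩ G e) := by
    intro e
    apply thin (((hR e).isOpen_compl.inter (hGo e)).preimage (P.emb e).continuous)
    intro t ht
    have hto : t ∈ Ioo (-1 : ℝ) 1 := ⟨by linarith [ht.1], by linarith [ht.2]⟩
    refine ⟨?_, hGs e ⟨t, ht, rfl⟩⟩
    rintro (h | h)
    · obtain ⟨v, hv⟩ := mem_iUnion.1 h
      exact P.hin e t hto v hv
    · obtain ⟨e', he', t', ht', h⟩ := mem_iUnion₂.1 h
      rcases eq_or_lt_of_le ht'.1 with h1 | h1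
      · refine P.hin e t hto (P.u e') ?_
        rw [← h, ← h1]; simpa using P.hl e'
      rcases eq_or_lt_of_le ht'.2 with h2 | h2
      · refine P.hin e t hto (P.w e') ?_
        rw [← h, h2]; simpa using P.hr e'
      exact he' (P.hdis _ _ _ ⟨h1, h2⟩ _ hto h)
  choose h hh hth using hth
  have hsq : ∀ e, ∀ z ∈ SqC, P.ι e (squeeze (h e) (hh e).ne' z) ∈ (R e)ᶜ ∩ G e := by
    intro e z hz
    refine hth e _ _ ?_ ?_
    · rw [abs_div, abs_two]; linarith [hz.1]
    · rw [abs_mul, abs_of_pos (hh e)]; nlinarith [hz.2, hh e]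
  refine ⟨
    { u := P.u, w := P.w, B := B', ι := fun e z => P.ι e (squeeze (h e) (hh e).ne' z)
      ne := P.ne
      Bc := ?_, Bp := ?_, Bd := ?_
      emb := fun e => (P.emb e).comp (Homeomorph.isOpenEmbedding _)
      sd := ?_, sB := ?_, hl := ?_, hr := ?_ }, rfl, rfl⟩
  · intro v
    exact (P.Bc v).union (((Set.toFinite _).isCompact_biUnion fun e _ => sgc e _ _).union
      ((Set.toFinite _).isCompact_biUnion fun e _ => sgc e _ _))
  · intro v
    by_cases hv : (P.B v).Nonempty
    · obtain ⟨x0, hx0⟩ := hv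
      apply isPreconnected_of_forall x0
      rintro y (hy | hy | hy)
      · exact ⟨P.B v, subset_union_left, hx0, hy, P.Bp v⟩
      · obtain ⟨e, he, hy'⟩ := mem_iUnion₂.1 hy
        obtain rfl : P.u e = v := he
        refine ⟨P.B (P.u e) ∪ sg e (-1) (-(1 / 2)), ?_, Or.inl hx0, Or.inr hy',
          (P.Bp _).union _ (P.hl e) ⟨-1, by norm_num, by simp⟩ (sgp e _ _)⟩
        refine union_subset_union_right _ (Subset.trans ?_ subset_union_left)
        exact subset_biUnion_of_mem (u := fun e => sg e (-1) (-(1 / 2))) (rfl : P.u e = P.u e)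
      · obtain ⟨e, he, hy'⟩ := mem_iUnion₂.1 hy
        obtain rfl : P.w e = v := he
        refine ⟨P.B (P.w e) ∪ sg e (1 / 2) 1, ?_, Or.inl hx0, Or.inr hy',
          (P.Bp _).union _ (P.hr e) ⟨1, by norm_num, by simp⟩ (sgp e _ _)⟩
        refine union_subset_union_right _ (Subset.trans ?_ subset_union_right)
        exact subset_biUnion_of_mem (u := fun e => sg e (1 / 2) 1) (rfl : P.w e = P.w e)
    · have : B' v = ∅ := by
        rw [eq_empty_iff_forall_notMem]
        rintro y (hy | hy | hy)
        · exact hv ⟨y, hy⟩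
        · obtain ⟨e, he, hy⟩ := mem_iUnion₂.1 hy
          obtain rfl : P.u e = v := he
          exact hv ⟨_, P.hl e⟩
        · obtain ⟨e, he, hy⟩ := mem_iUnion₂.1 hy
          obtain rfl : P.w e = v := he
          exact hv ⟨_, P.hr e⟩
      rw [this]; exact isPreconnected_empty
  · intro v v' x hx hx'
    rcases hBm v x hx with h1 | ⟨e, t, ht, rfl, h1⟩
    · rcases hBm v' x hx' with h2 | ⟨e, t, ht, rfl, h2⟩
      · exact P.Bd _ _ _ h1 h2
      · exact absurd h1 (P.hin e t ht _)
    · rcases hBm v' _ hx' with h2 | ⟨e', t', ht', he, h2⟩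
      · exact absurd h2 (P.hin e t ht _)
      · obtain rfl := P.hdis _ _ _ ht' _ ht he
        have : t' = t := by exact_mod_cast (P.emb _).injective he
        subst this
        rcases h1 with h1 | h1 <;> rcases h2 with h2 | h2
        · exact h1.2.symm.trans h2.2
        · linarith [h1.1, h2.1]
        · linarith [h1.1, h2.1]
        · exact h1.2.symm.trans h2.2
  · intro e e' z z' hz hz' he
    have h1 := (hsq e z hz).2
    have h2 := (hsq e' z' hz').2
    rw [he] at h1
    exact hGd _ _ _ h1 h2
  · intro e v z hz hx
    have hr := (hsq e z hz).1
    rcases hBm v _ hx with h1 | ⟨e', t, ht, he, h1⟩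
    · exact absurd (show _ ∈ R e from Or.inl (mem_iUnion.2 ⟨v, h1⟩)) hr
    · by_cases hee : e' = e
      · subst hee
        have h2 := (P.emb _).injective he
        have hre := congrArg Complex.re h2
        have him := congrArg Complex.im h2
        simp [squeeze] at hre him
        have hz1 : z.im = 0 := him.resolve_left (hh _).ne'
        have hz2 := abs_le.1 hz.1
        rcases h1 with h1 | h1
        · left
          refine ⟨Complex.ext ?_ ?_, h1.2.symm⟩
          · simp; linarith [h1.1]
          · simp [hz1]
        · right
          refine ⟨Complex.ext ?_ ?_, h1.2.symm⟩
          · simp; linarith [h1.1]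
          · simp [hz1]
      · exact absurd (show _ ∈ R e from Or.inr (mem_iUnion₂.2 ⟨e', hee, t, Ioo_subset_Icc_self ht, he⟩)) hr
  · intro e
    refine Or.inr (Or.inl (mem_iUnion₂.2 ⟨e, rfl, -(1 / 2), by norm_num, ?_⟩))
    simp only []; congr 1
    apply Complex.ext <;> simp [squeeze] <;> norm_num
  · intro e
    refine Or.inr (Or.inr (mem_iUnion₂.2 ⟨e, rfl, (1 / 2), by norm_num, ?_⟩))
    simp only []; congr 1
    apply Complex.ext <;> simp [squeeze] <;> norm_num
end SurfUB

namespace SurfUB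
open Set Filter Topology

variable {M : Type*} [TopologicalSpace M]

theorem path_union {A : Set M} (hA : IsPathConnected A) {I : Type*} [Finite I] [Nonempty I] (p : I → M)
    (hp : ∀ i, p i ∈ A) : ∃ L, IsCompact L ∧ IsPathConnected L ∧ L ⊆ A ∧ ∀ i, p i ∈ L := by
  obtain ⟨i0⟩ := ‹Nonempty I›
  have : PathConnectedSpace unitInterval :=
    isPathConnected_iff_pathConnectedSpace.1 ((convex_Icc (0:ℝ) 1).isPathConnected ⟨0, by simp⟩)
  choose γ hγ using fun i => hA.joinedIn (p i0) (hp i0) (p i) (hp i)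
  refine ⟨⋃ i, range (γ i), isCompact_iUnion fun i => isCompact_range (γ i).continuous,
    ⟨p i0, mem_iUnion.2 ⟨i0, 0, by simp⟩, ?_⟩, ?_, fun i => mem_iUnion.2 ⟨i, 1, by simp⟩⟩
  · intro y hy
    obtain ⟨i, hy⟩ := mem_iUnion.1 hy
    exact ((isPathConnected_range (γ i).continuous).joinedIn (p i0) ⟨0, by simp⟩ y hy).mono
      (subset_iUnion (fun i => range (γ i)) i)
  · refine iUnion_subset fun i => ?_
    rintro _ ⟨t, rfl⟩; exact hγ i t

theorem compact_nbhd (hM : Surf M) {D K : Set M} (hDo : IsOpen D)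
    (hD : IsPathConnected D) (hK : IsCompact K) (hKD : K ⊆ D) :
    ∃ C, IsCompact C ∧ IsPreconnected C ∧ K ⊆ interior C ∧ C ⊆ D := by
  choose! ι hι h0 hr using fun x (hx : x ∈ D) => hM x D (hDo.mem_nhds hx)
  obtain ⟨t, ht⟩ := hK.elim_nhds_subcover' (fun x _ => ι x '' Metric.ball 0 1) (fun x hx => by
    refine ((hι x (hKD hx)).isOpenMap _ Metric.isOpen_ball).mem_nhds ⟨0, by simp, h0 x (hKD hx)⟩)
  by_cases hne : Nonempty t
  · obtain ⟨L, hLc, hLp, hLD, hpL⟩ := path_union hD (fun x : t => (x.1.1 : M)) (fun x => hKD x.1.2)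
    let Q : t → Set M := fun x => ι x.1.1 '' Metric.closedBall 0 1
    have hQc : ∀ x, IsCompact (Q x) := fun x =>
      (isCompact_closedBall _ _).image (hι _ (hKD x.1.2)).continuous
    have hQp : ∀ x, IsPreconnected (Q x) := fun x =>
      (convex_closedBall _ _).isPreconnected.image _ (hι _ (hKD x.1.2)).continuous.continuousOn
    refine ⟨L ∪ ⋃ x, Q x, hLc.union (isCompact_iUnion hQc), ?_, ?_, ?_⟩
    · obtain ⟨x0, hx0⟩ := hLp.nonempty
      apply isPreconnected_of_forall x0
      rintro y (hy | hy)
      · exact ⟨L, subset_union_left, hx0, hy, hLp.isConnected.isPreconnected⟩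
      · obtain ⟨x, hx⟩ := mem_iUnion.1 hy
        exact ⟨L ∪ Q x, union_subset_union_right _ (subset_iUnion _ x), Or.inl hx0, Or.inr hx,
          hLp.isConnected.isPreconnected.union (x.1.1 : M) (hpL x) ⟨0, by simp, h0 _ (hKD x.1.2)⟩ (hQp x)⟩
    · intro y hy
      obtain ⟨x, hx, hy⟩ := mem_iUnion₂.1 (ht hy)
      refine mem_interior.2 ⟨_, ?_, (hι _ (hKD x.2)).isOpenMap _ Metric.isOpen_ball, hy⟩
      refine Subset.trans ?_ (subset_union_right.trans' (subset_iUnion Q ⟨x, hx⟩))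
      exact image_mono Metric.ball_subset_closedBall
    · refine union_subset hLD (iUnion_subset fun x => ?_)
      rintro _ ⟨z, _, rfl⟩
      exact hr _ (hKD x.1.2) ⟨z, rfl⟩
  · refine ⟨∅, isCompact_empty, isPreconnected_empty, ?_, empty_subset _⟩
    intro y hy
    obtain ⟨x, hx, _⟩ := mem_iUnion₂.1 (ht hy)
    exact absurd ⟨⟨x, hx⟩⟩ hne

/-- topological incidence data -/
structure Inc (M T S : Type*) [TopologicalSpace M] where
  inc : T → S → Prop
  A : T → Set M
  D : S → Set M
  hAo : ∀ τ, IsOpen (A τ)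
  hAp : ∀ τ, IsPathConnected (A τ)
  hDo : ∀ σ, IsOpen (D σ)
  hDp : ∀ σ, IsPathConnected (D σ)
  hDd : ∀ σ σ' x, x ∈ D σ → x ∈ D σ' → σ = σ'
  hin : ∀ τ σ, inc τ σ → D σ ⊆ A τ
  hnin : ∀ τ σ x, x ∈ D σ → x ∈ A τ → inc τ σ
  hmeet : ∀ τ τ' x, τ ≠ τ' → x ∈ A τ → x ∈ A τ' → ∃ σ, x ∈ D σ
  hne : ∀ τ, ∃ σ, inc τ σ

theorem Inc.setup [T2Space M] (hM : Surf M) {T S : Type*} [Finite T] [Finite S] (Z : Inc M T S) :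
    ∃ (O L : T → Set M) (C : S → Set M), (∀ τ, IsOpen (O τ)) ∧ (∀ τ, IsPathConnected (L τ)) ∧
      (∀ τ, L τ ⊆ O τ) ∧ (∀ σ, IsCompact (C σ)) ∧ (∀ σ, IsPreconnected (C σ)) ∧ (∀ σ, (C σ).Nonempty) ∧
      (∀ σ σ' x, x ∈ C σ → x ∈ C σ' → σ = σ') ∧ (∀ τ σ, Z.inc τ σ → (L τ ∩ C σ).Nonempty) ∧
      (∀ τ σ x, x ∈ C σ → x ∈ O τ → Z.inc τ σ) ∧
      (∀ τ τ' x, τ ≠ τ' → x ∈ O τ → x ∈ O τ' → ∃ σ, x ∈ C σ) := by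
  choose p hp using fun σ => (Z.hDp σ).nonempty
  have hL : ∀ τ, ∃ L, IsCompact L ∧ IsPathConnected L ∧ L ⊆ Z.A τ ∧ ∀ σ, Z.inc τ σ → p σ ∈ L := by
    intro τ
    obtain ⟨σ0, h0⟩ := Z.hne τ
    have : Nonempty {σ // Z.inc τ σ} := ⟨⟨σ0, h0⟩⟩
    obtain ⟨L, h1, h2, h3, h4⟩ := path_union (Z.hAp τ) (fun σ : {σ // Z.inc τ σ} => p σ.1)
      (fun σ => Z.hin τ σ.1 σ.2 (hp σ.1))
    exact ⟨L, h1, h2, h3, fun σ hσ => h4 ⟨σ, hσ⟩⟩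
  choose L hLc hLp hLA hpL using hL
  let K : S → Set M := fun σ => {p σ} ∪ ⋃ q ∈ {q : T × T | q.1 ≠ q.2}, (L q.1 ∩ L q.2) \ ⋃ σ' ∈ {σ' | σ' ≠ σ}, Z.D σ'
  have hKc : ∀ σ, IsCompact (K σ) := by
    intro σ
    refine isCompact_singleton.union ((Set.toFinite _).isCompact_biUnion fun q _ => ?_)
    exact ((hLc q.1).inter (hLc q.2)).diff (isOpen_biUnion fun σ' _ => Z.hDo σ')
  have hKD : ∀ σ, K σ ⊆ Z.D σ := by
    rintro σ x (h | h)
    · rw [mem_singleton_iff.1 h]; exact hp σ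
    · obtain ⟨q, hq, ⟨h1, h2⟩, h3⟩ := mem_iUnion₂.1 h
      obtain ⟨σ', hσ'⟩ := Z.hmeet _ _ x hq (hLA _ h1) (hLA _ h2)
      by_cases h4 : σ' = σ
      · exact h4 ▸ hσ'
      · exact absurd (mem_iUnion₂.2 ⟨σ', h4, hσ'⟩) h3
  choose C hCc hCp hKC hCD using fun σ => compact_nbhd hM (Z.hDo σ) (Z.hDp σ) (hKc σ) (hKD σ)
  have hCd : ∀ σ σ' x, x ∈ C σ → x ∈ C σ' → σ = σ' := fun σ σ' x h h' => Z.hDd _ _ x (hCD _ h) (hCD _ h')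
  have hpC : ∀ σ, p σ ∈ C σ := fun σ => interior_subset (hKC σ (Or.inl rfl))
  have hLL : ∀ τ τ' x, τ ≠ τ' → x ∈ L τ → x ∈ L τ' → ∃ σ, x ∈ interior (C σ) := by
    intro τ τ' x hne h h'
    obtain ⟨σ, hσ⟩ := Z.hmeet _ _ x hne (hLA _ h) (hLA _ h')
    refine ⟨σ, hKC σ (Or.inr (mem_iUnion₂.2 ⟨(τ, τ'), hne, ⟨h, h'⟩, ?_⟩))⟩
    intro h2
    obtain ⟨σ', h3, h4⟩ := mem_iUnion₂.1 h2
    exact h3 (Z.hDd _ _ _ h4 hσ)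
  have hio : IsOpen (⋃ σ, interior (C σ)) := isOpen_iUnion fun σ => isOpen_interior
  obtain ⟨G, hGo, hGs, hGd⟩ := sep_family (K := fun τ => L τ \ ⋃ σ, interior (C σ))
    (fun τ => (hLc τ).diff hio) (by
      rintro τ τ' x ⟨h1, h2⟩ ⟨h3, -⟩
      by_contra hne
      obtain ⟨σ, hσ⟩ := hLL τ τ' x hne h1 h3
      exact h2 (mem_iUnion.2 ⟨σ, hσ⟩))
  refine ⟨fun τ => Z.A τ ∩ (G τ ∪ ⋃ σ, interior (C σ)), L, C, fun τ => (Z.hAo τ).inter ((hGo τ).union hio),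
    hLp, ?_, hCc, hCp, fun σ => ⟨_, hpC σ⟩, hCd, fun τ σ h => ⟨p σ, hpL τ σ h, hpC σ⟩, ?_, ?_⟩
  · intro τ x hx
    refine ⟨hLA τ hx, ?_⟩
    by_cases h : x ∈ ⋃ σ, interior (C σ)
    · exact Or.inr h
    · exact Or.inl (hGs τ ⟨hx, h⟩)
  · intro τ σ x hx hO
    exact Z.hnin τ σ x (hCD σ hx) hO.1
  · rintro τ τ' x hne ⟨-, h⟩ ⟨-, h'⟩
    rcases h with h | h
    · rcases h' with h' | h'
      · exact absurd (hGd _ _ _ h h') hne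
      · obtain ⟨σ, hσ⟩ := mem_iUnion.1 h'; exact ⟨σ, interior_subset hσ⟩
    · obtain ⟨σ, hσ⟩ := mem_iUnion.1 h; exact ⟨σ, interior_subset hσ⟩

theorem Inc.build [T2Space M] (hM : Surf M) {T S : Type} [Fintype T] [Fintype S] (Z : Inc M T S) :
    ∃ (root : T → S) (par : T → S → S) (rk : T → S → ℕ), (∀ τ, Z.inc τ (root τ)) ∧
      (∀ τ σ, Z.inc τ σ → σ ≠ root τ → Z.inc τ (par τ σ) ∧ rk τ (par τ σ) < rk τ σ) ∧
      ∃ C : Config M S {q : T × S // Z.inc q.1 q.2 ∧ q.2 ≠ root q.1},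
        (∀ e, C.u e = par e.1.1 e.1.2) ∧ ∀ e, C.w e = e.1.2 := by
  classical
  obtain ⟨O, L, C, hO, hLp, hLO, hCc, hCp, hCn, hCd, hLC, F1, F2⟩ := Z.setup hM
  choose root hroot using Z.hne
  have tree : ∀ τ, Nonempty (TS (O τ) (fun σ : {σ // Z.inc τ σ} => C σ.1) ⟨root τ, hroot τ⟩ Finset.univ) :=
    fun τ => TS.full hM (hO τ) ⟨root τ, hroot τ⟩ (fun i => hCc i.1) (fun i => hCp i.1)
      (fun i i' x h h' => Subtype.ext (hCd _ _ x h h')) (hLp τ) (hLO τ) (fun i => hLC τ i.1 i.2)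
  let t := fun τ => (tree τ).some
  -- transfer to S
  let par : T → S → S := fun τ σ => if h : Z.inc τ σ then ((t τ).par ⟨σ, h⟩).1 else σ
  let rk : T → S → ℕ := fun τ σ => if h : Z.inc τ σ then (t τ).rk ⟨σ, h⟩ else 0
  let Bb : S → Set M := fun σ => C σ ∪ ⋃ τ : {τ // Z.inc τ σ}, (t τ.1).B ⟨σ, τ.2⟩
  have hne' : ∀ τ σ (h : Z.inc τ σ), σ ≠ root τ → (⟨σ, h⟩ : {σ // Z.inc τ σ}) ≠ ⟨root τ, hroot τ⟩ :=
    fun τ σ h hr he => hr (congrArg Subtype.val he)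
  have hparrk : ∀ τ σ, Z.inc τ σ → σ ≠ root τ → Z.inc τ (par τ σ) ∧ rk τ (par τ σ) < rk τ σ := by
    intro τ σ h hr
    have h1 : par τ σ = ((t τ).par ⟨σ, h⟩).1 := by simp [par, h]
    have h2 : Z.inc τ (par τ σ) := by rw [h1]; exact ((t τ).par ⟨σ, h⟩).2
    refine ⟨h2, ?_⟩
    have := (t τ).hrk ⟨σ, h⟩ (Finset.mem_univ _) (hne' τ σ h hr)
    have h3 := ((t τ).par ⟨σ, h⟩).2
    rw [h1]
    simp only [rk, dif_pos h, dif_pos h3]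
    exact this
  -- blob facts
  have hCB : ∀ τ σ (h : Z.inc τ σ), C σ ⊆ (t τ).B ⟨σ, h⟩ := fun τ σ h => (t τ).hCB ⟨σ, h⟩
  have claim : ∀ τ σ (h : Z.inc τ σ) σ' x, x ∈ (t τ).B ⟨σ, h⟩ → x ∈ C σ' → σ = σ' := by
    intro τ σ h σ' x hx hx'
    rcases (t τ).hBO _ hx with h1 | h1
    · exact hCd _ _ _ h1 hx'
    · have h2 := F1 τ σ' x hx' h1
      have := (t τ).hBd _ _ x hx (hCB τ σ' h2 hx')
      exact congrArg Subtype.val this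
  have hBd : ∀ τ σ (h : Z.inc τ σ) τ' σ' (h' : Z.inc τ' σ') x, x ∈ (t τ).B ⟨σ, h⟩ →
      x ∈ (t τ').B ⟨σ', h'⟩ → σ = σ' := by
    intro τ σ h τ' σ' h' x hx hx'
    by_cases hC : ∃ σ'', x ∈ C σ''
    · obtain ⟨σ'', h2⟩ := hC
      rw [claim _ _ _ _ _ hx h2, claim _ _ _ _ _ hx' h2]
    · by_cases hτ : τ = τ'
      · subst hτ
        exact congrArg Subtype.val ((t τ).hBd _ _ x hx hx')
      · exfalso
        have h1 := ((t τ).hBO _ hx).resolve_left (fun h => hC ⟨_, h⟩)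
        have h2 := ((t τ').hBO _ hx').resolve_left (fun h => hC ⟨_, h⟩)
        exact hC (F2 τ τ' x hτ h1 h2)
  have hsegC : ∀ τ σ (h : Z.inc τ σ), σ ≠ root τ → ∀ a ∈ Ioo (-1 : ℝ) 1, ∀ σ',
      (t τ).ι ⟨σ, h⟩ a ∉ C σ' := by
    intro τ σ h hr a ha σ' hx
    have h1 := (t τ).hO ⟨σ, h⟩ (Finset.mem_univ _) (hne' τ σ h hr) a (Ioo_subset_Icc_self ha)
    have h2 := F1 τ σ' _ hx h1
    exact (t τ).hin ⟨σ, h⟩ (Finset.mem_univ _) (hne' τ σ h hr) a ha ⟨σ', h2⟩ (hCB _ _ h2 hx)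
  let P : PreConfig M S {q : T × S // Z.inc q.1 q.2 ∧ q.2 ≠ root q.1} :=
    { u := fun e => par e.1.1 e.1.2
      w := fun e => e.1.2
      B := Bb
      ι := fun e => (t e.1.1).ι ⟨e.1.2, e.2.1⟩
      ne := by
        intro e he
        have := (hparrk e.1.1 e.1.2 e.2.1 e.2.2).2
        rw [he] at this
        exact lt_irrefl _ this
      Bc := fun σ => (hCc σ).union (isCompact_iUnion fun τ => (t τ.1).hBc _)
      Bp := by
        intro σ
        obtain ⟨x0, hx0⟩ := hCn σ
        apply isPreconnected_of_forall x0
        rintro y (hy | hy)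
        · exact ⟨C σ, subset_union_left, hx0, hy, hCp σ⟩
        · obtain ⟨τ, hτ⟩ := mem_iUnion.1 hy
          exact ⟨(t τ.1).B ⟨σ, τ.2⟩, subset_union_of_subset_right (subset_iUnion (fun τ : {τ // Z.inc τ σ} => (t τ.1).B ⟨σ, τ.2⟩) τ) _,
            hCB _ _ _ hx0, hτ, (t τ.1).hBp _⟩
      Bd := by
        rintro σ σ' x (h | h) (h' | h')
        · exact hCd _ _ _ h h'
        · obtain ⟨τ, hτ⟩ := mem_iUnion.1 h'
          exact (claim _ _ _ _ _ hτ h).symm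
        · obtain ⟨τ, hτ⟩ := mem_iUnion.1 h
          exact claim _ _ _ _ _ hτ h'
        · obtain ⟨τ, hτ⟩ := mem_iUnion.1 h
          obtain ⟨τ', hτ'⟩ := mem_iUnion.1 h'
          exact hBd _ _ _ _ _ _ _ hτ hτ'
      emb := fun e => (t e.1.1).hemb _ (Finset.mem_univ _) (hne' _ _ _ e.2.2)
      hl := by
        intro e
        have h1 : par e.1.1 e.1.2 = ((t e.1.1).par ⟨e.1.2, e.2.1⟩).1 := by simp [par, e.2.1]
        rw [h1]
        exact Or.inr (mem_iUnion.2 ⟨⟨e.1.1, ((t e.1.1).par ⟨e.1.2, e.2.1⟩).2⟩,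
          (t e.1.1).hl _ (Finset.mem_univ _) (hne' _ _ e.2.1 e.2.2)⟩)
      hr := fun e => Or.inr (mem_iUnion.2 ⟨⟨e.1.1, e.2.1⟩,
          (t e.1.1).hr _ (Finset.mem_univ _) (hne' _ _ e.2.1 e.2.2)⟩)
      hin := by
        rintro e a ha σ (h | h)
        · exact hsegC _ _ e.2.1 e.2.2 a ha σ h
        · obtain ⟨τ, hτ⟩ := mem_iUnion.1 h
          by_cases hτe : τ.1 = e.1.1
          · obtain ⟨τ, hi⟩ := τ
            obtain ⟨⟨τ2, σ2⟩, he⟩ := e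
            obtain rfl : τ = τ2 := hτe
            exact (t τ).hin _ (Finset.mem_univ _) (hne' _ _ he.1 he.2) a ha _ hτ
          · have h1 := (t e.1.1).hO ⟨e.1.2, e.2.1⟩ (Finset.mem_univ _) (hne' _ _ e.2.1 e.2.2) a (Ioo_subset_Icc_self ha)
            rcases (t τ.1).hBO _ hτ with h2 | h2
            · exact hsegC _ _ e.2.1 e.2.2 a ha σ h2
            · obtain ⟨σ', h3⟩ := F2 _ _ _ hτe h2 h1
              exact hsegC _ _ e.2.1 e.2.2 a ha σ' h3
      hdis := by
        intro e e' a ha a' ha' he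
        by_cases hτ : e.1.1 = e'.1.1
        · obtain ⟨⟨τ, σ⟩, h1⟩ := e
          obtain ⟨⟨τ2, σ2⟩, h2⟩ := e'
          obtain rfl : τ = τ2 := hτ
          have := (t τ).hdis _ (Finset.mem_univ _) (hne' _ _ h1.1 h1.2) _ (Finset.mem_univ _)
            (hne' _ _ h2.1 h2.2) a ha a' ha' he
          have h3 : σ = σ2 := congrArg Subtype.val this
          subst h3; rfl
        · exfalso
          have h1 := (t e.1.1).hO ⟨e.1.2, e.2.1⟩ (Finset.mem_univ _) (hne' _ _ e.2.1 e.2.2) a (Ioo_subset_Icc_self ha)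
          have h2 := (t e'.1.1).hO ⟨e'.1.2, e'.2.1⟩ (Finset.mem_univ _) (hne' _ _ e'.2.1 e'.2.2) a' (Ioo_subset_Icc_self ha')
          rw [← he] at h2
          obtain ⟨σ', h3⟩ := F2 _ _ _ hτ h1 h2
          exact hsegC _ _ e.2.1 e.2.2 a ha σ' h3 }
  obtain ⟨Cf, h1, h2⟩ := P.thicken
  exact ⟨root, par, rk, hroot, hparrk, Cf, fun e => congrFun h1 e, fun e => congrFun h2 e⟩
end SurfUB

namespace SurfUB
open Set Filter Topology

section comb
variable {V E : Type} [Fintype V] [Fintype E]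

/-- even row -/
def EvenRow (u w : E → V) (x : E → ZMod 2) : Prop :=
  open Classical in ∀ v, ∑ e with u e = v ∨ w e = v, x e = 0

theorem zmod2_one {a : ZMod 2} (h : a ≠ 0) : a = 1 := by
  revert a; decide

theorem EvenRow.other {u w : E → V} {x : E → ZMod 2} (hx : EvenRow u w x) {e : E} (he : x e ≠ 0)
    {v : V} (hv : v ∈ s(u e, w e)) : ∃ e', e' ≠ e ∧ x e' ≠ 0 ∧ v ∈ s(u e', w e') := by
  classical
  by_contra hcon
  push Not at hcon
  have h := hx v
  rw [Finset.sum_eq_single e] at h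
  · exact he h
  · intro e' he' hne
    by_contra h0
    apply hcon e' hne h0
    have := (Finset.mem_filter.1 he').2
    rw [Sym2.mem_iff]; tauto
  · intro h1
    exfalso; apply h1
    rw [Sym2.mem_iff] at hv
    simp; tauto

variable {u w : E → V} (hloop : ∀ e, u e ≠ w e)
  (hsimp : ∀ e e', s(u e, w e) = s(u e', w e') → e = e')

theorem EvenRow.three (hloop : ∀ e, u e ≠ w e)
    (hsimp : ∀ e e', s(u e, w e) = s(u e', w e') → e = e') {x : E → ZMod 2}
    (hx : EvenRow u w x) (h0 : x ≠ 0) :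
    open Classical in 3 ≤ (Finset.univ.filter fun e => x e ≠ 0).card := by
  classical
  obtain ⟨e, he⟩ := Function.ne_iff.1 h0
  obtain ⟨e', h1, h2, h3⟩ := hx.other he (v := u e) (by simp)
  obtain ⟨e'', h4, h5, h6⟩ := hx.other he (v := w e) (by simp)
  have hne : e' ≠ e'' := by
    rintro rfl
    exact h1 (hsimp _ _ (((Sym2.mem_and_mem_iff (hloop e)).1 ⟨h3, h6⟩)))
  have : ({e, e', e''} : Finset E).card = 3 := by
    rw [Finset.card_eq_three]; exact ⟨e, e', e'', h1.symm, h4.symm, hne, rfl⟩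
  rw [← this]
  apply Finset.card_le_card
  intro f hf
  simp only [Finset.mem_insert, Finset.mem_singleton] at hf
  simp only [Finset.mem_filter, Finset.mem_univ, true_and]
  rcases hf with rfl | rfl | rfl
  · exact he
  · exact h2
  · exact h5

/-- indicator of an edge given by endpoints -/
noncomputable def dlt (u w : E → V) (p : Sym2 V) : E → ZMod 2 :=
  open Classical in fun e => if s(u e, w e) = p then 1 else 0

theorem EvenRow.tri (hloop : ∀ e, u e ≠ w e)
    (hsimp : ∀ e e', s(u e, w e) = s(u e', w e') → e = e') {x : E → ZMod 2}
    (hx : EvenRow u w x)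
    (h3 : open Classical in (Finset.univ.filter fun e => x e ≠ 0).card = 3)
    {e : E} (he : x e ≠ 0) {a b : V} (hab : s(u e, w e) = s(a, b)) :
    ∃ d, d ≠ a ∧ d ≠ b ∧ x = dlt u w s(a,b) + dlt u w s(b,d) + dlt u w s(a,d) ∧
      (∃ e', x e' ≠ 0 ∧ s(u e', w e') = s(b,d)) ∧ ∃ e', x e' ≠ 0 ∧ s(u e', w e') = s(a,d) := by
  classical
  have hl : ∀ e a, s(u e, w e) ≠ s(a,a) := by
    intro e a h
    have h1 : u e ∈ s(a,a) := by rw [← h]; simp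
    have h2 : w e ∈ s(a,a) := by rw [← h]; simp
    simp at h1 h2
    exact hloop e (h1.trans h2.symm)
  have hne : a ≠ b := by rintro rfl; exact hl _ _ hab
  obtain ⟨e', h1, h2, hb⟩ := hx.other he (v := b) (by rw [hab]; simp)
  obtain ⟨e'', h4, h5, ha⟩ := hx.other he (v := a) (by rw [hab]; simp)
  obtain ⟨d, hd⟩ := Sym2.mem_iff_exists.1 hb
  obtain ⟨d', hd'⟩ := Sym2.mem_iff_exists.1 ha
  have hdb : d ≠ b := by rintro rfl; exact hl _ _ hd
  have hda : d ≠ a := by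
    rintro rfl; exact h1 (hsimp _ _ (by rw [hd, hab, Sym2.eq_swap]))
  have hda' : d' ≠ a := by rintro rfl; exact hl _ _ hd'
  have hne' : e' ≠ e'' := by
    rintro rfl
    apply h1; apply hsimp; rw [hab]
    exact (Sym2.mem_and_mem_iff hne).1 ⟨ha, hb⟩
  have hsub : ({e, e', e''} : Finset E) = Finset.univ.filter fun e => x e ≠ 0 := by
    apply Finset.eq_of_subset_of_card_le
    · intro f hf
      simp only [Finset.mem_insert, Finset.mem_singleton] at hf
      simp only [Finset.mem_filter, Finset.mem_univ, true_and]
      rcases hf with rfl | rfl | rfl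
      · exact he
      · exact h2
      · exact h5
    · have : ({e, e', e''} : Finset E).card = 3 := by
        rw [Finset.card_eq_three]; exact ⟨e, e', e'', h1.symm, h4.symm, hne', rfl⟩
      rw [this, h3]
  have hs : ∀ f, x f ≠ 0 ↔ f = e ∨ f = e' ∨ f = e'' := by
    intro f
    have : f ∈ ({e, e', e''} : Finset E) ↔ f ∈ Finset.univ.filter fun e => x e ≠ 0 := by rw [hsub]
    simpa using this.symm
  obtain ⟨f, hf1, hf2, hf3⟩ := hx.other h2 (v := d) (by rw [hd]; simp)
  have hdd : d = d' := by
    rcases (hs f).1 hf2 with rfl | rfl | rfl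
    · rw [hab] at hf3; simp at hf3; tauto
    · exact absurd rfl hf1
    · rw [hd'] at hf3; simp at hf3; tauto
  subst hdd
  refine ⟨d, hda, hdb, ?_, ⟨e', h2, hd⟩, ⟨e'', h5, hd'⟩⟩
  funext f
  have i1 : (s(u f, w f) = s(a,b)) ↔ f = e := ⟨fun h => hsimp _ _ (h.trans hab.symm), fun h => h ▸ hab⟩
  have i2 : (s(u f, w f) = s(b,d)) ↔ f = e' := ⟨fun h => hsimp _ _ (h.trans hd.symm), fun h => h ▸ hd⟩
  have i3 : (s(u f, w f) = s(a,d)) ↔ f = e'' := ⟨fun h => hsimp _ _ (h.trans hd'.symm), fun h => h ▸ hd'⟩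
  simp only [Pi.add_apply, dlt, i1, i2, i3]
  by_cases hxf : x f = 0
  · have := (hs f).not.1 (by simpa using hxf)
    push Not at this
    simp [this, hxf]
  · rw [zmod2_one hxf]
    rcases (hs f).1 hxf with rfl | rfl | rfl
    · simp [h1.symm, h4.symm]
    · simp [h1, hne']
    · simp [h4, hne'.symm]

theorem row_count {b : Finset (E → ZMod 2)} (c : (E → ZMod 2) → ℕ)
    (h2 : open Classical in ∀ e, (b.filter fun x => x e ≠ 0).card ≤ 2)
    (hc : open Classical in ∀ x ∈ b, c x ≤ (Finset.univ.filter fun e => x e ≠ 0).card) :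
    ∑ x ∈ b, c x ≤ 2 * Fintype.card E := by
  classical
  calc ∑ x ∈ b, c x ≤ ∑ x ∈ b, (Finset.univ.filter fun e => x e ≠ 0).card := Finset.sum_le_sum hc
    _ = ∑ e : E, (b.filter fun x => x e ≠ 0).card := by
        simp only [Finset.card_filter]
        exact Finset.sum_comm
    _ ≤ ∑ e : E, 2 := Finset.sum_le_sum fun e _ => h2 e
    _ = 2 * Fintype.card E := by simp [mul_comm]

theorem bound3 (hloop : ∀ e, u e ≠ w e)
    (hsimp : ∀ e e', s(u e, w e) = s(u e', w e') → e = e') {N : ℕ} (hP : PlanarLike u w N) :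
    Fintype.card E ≤ 3 * (Fintype.card V + N) := by
  classical
  obtain ⟨b, hb, hb2, hbe, hbc⟩ := hP
  have := row_count (b := b) (fun _ => 3) (by convert hb2) (fun x hx => by
    have := EvenRow.three hloop hsimp (x := x) (fun v => by convert hbe x hx v) (fun h => by
      exact hb.ne_zero (⟨x, hx⟩ : b) h)
    convert this)
  simp at this
  omega

/-- the improved bound when shared-edge triangles live in a K4 -/
theorem bound83 (hloop : ∀ e, u e ≠ w e)
    (hsimp : ∀ e e', s(u e, w e) = s(u e', w e') → e = e')
    (hK : ∀ a b c d₁ d₂ : V, (∃ e, s(u e, w e) = s(a,b)) → (∃ e, s(u e, w e) = s(b,c)) →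
      (∃ e, s(u e, w e) = s(a,c)) → (∃ e, s(u e, w e) = s(b,d₁)) → (∃ e, s(u e, w e) = s(a,d₁)) →
      (∃ e, s(u e, w e) = s(c,d₂)) → (∃ e, s(u e, w e) = s(b,d₂)) → d₁ ≠ c → d₂ ≠ a → d₁ = d₂)
    {N : ℕ} (hP : PlanarLike u w N) :
    3 * Fintype.card E ≤ 8 * (Fintype.card V + N) := by
  classical
  obtain ⟨b, hb, hb2', hbe', hbc⟩ := hP
  have hb2 : ∀ e, (b.filter fun x => x e ≠ 0).card ≤ 2 := fun e => by convert hb2' e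
  have hbe : ∀ x ∈ b, EvenRow u w x := fun x hx v => by convert hbe' x hx v
  have h3 : ∀ x ∈ b, 3 ≤ (Finset.univ.filter fun e => x e ≠ 0).card := fun x hx => by
    have := EvenRow.three hloop hsimp (hbe x hx) (fun h => hb.ne_zero (⟨x, hx⟩ : b) h)
    convert this
  set B := b.filter fun x => (Finset.univ.filter fun e => x e ≠ 0).card = 3 with hB
  have hBb : B ⊆ b := Finset.filter_subset _ _
  have hBc : ∀ x ∈ B, (Finset.univ.filter fun e => x e ≠ 0).card = 3 := fun x hx => (Finset.mem_filter.1 hx).2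
  have hBtri : ∀ x ∈ B, ∀ e, x e ≠ 0 → ∀ a b, s(u e, w e) = s(a,b) →
    ∃ d, d ≠ a ∧ d ≠ b ∧ x = dlt u w s(a,b) + dlt u w s(b,d) + dlt u w s(a,d) ∧
      (∃ e', x e' ≠ 0 ∧ s(u e', w e') = s(b,d)) ∧ ∃ e', x e' ≠ 0 ∧ s(u e', w e') = s(a,d) := by
    intro x hx e he a b' hab
    exact EvenRow.tri hloop hsimp (hbe x (hBb hx)) (by convert hBc x hx) he hab
  -- private edges
  have hpriv : ∀ x ∈ B, ∃ e, x e ≠ 0 ∧ ∀ y ∈ B, y e ≠ 0 → y = x := by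
    intro x hx
    by_contra hcon
    push Not at hcon
    obtain ⟨e1, he1⟩ : ∃ e, x e ≠ 0 := Function.ne_iff.1 (fun h => hb.ne_zero (⟨x, hBb hx⟩ : b) h)
    obtain ⟨c, hca, hcb, hxe, ⟨e2, he2, h2⟩, ⟨e3, he3, h3⟩⟩ := hBtri x hx e1 he1 (u e1) (w e1) rfl
    generalize hu : u e1 = a at *
    generalize hw : w e1 = b' at *
    have h1 : s(u e1, w e1) = s(a,b') := by rw [hu, hw]
    obtain ⟨y1, hy1, hy1e, hy1x⟩ := hcon e1 he1
    obtain ⟨y2, hy2, hy2e, hy2x⟩ := hcon e2 he2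
    obtain ⟨y3, hy3, hy3e, hy3x⟩ := hcon e3 he3
    obtain ⟨d1, d1a, d1b, hd1, ⟨f1, -, hf1⟩, ⟨g1, -, hg1⟩⟩ := hBtri y1 hy1 e1 hy1e a b' h1
    obtain ⟨d2, d2a, d2b, hd2, ⟨f2, -, hf2⟩, ⟨g2, -, hg2⟩⟩ := hBtri y2 hy2 e2 hy2e b' c h2
    obtain ⟨d3, d3a, d3b, hd3, ⟨f3, -, hf3⟩, ⟨g3, -, hg3⟩⟩ := hBtri y3 hy3 e3 hy3e a c h3
    have n1 : d1 ≠ c := by rintro rfl; exact hy1x (hd1.trans hxe.symm)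
    have sw : s(c, b') = s(b', c) := Sym2.eq_swap
    have n2 : d2 ≠ a := by
      rintro rfl; apply hy2x; rw [hd2, hxe, Sym2.eq_swap (a := c), Sym2.eq_swap (a := b') (b := d2)]
      abel
    have n3 : d3 ≠ b' := by
      rintro rfl; apply hy3x; rw [hd3, hxe, Sym2.eq_swap (a := c)]
      abel
    have e12 : d1 = d2 := hK a b' c d1 d2 ⟨_, h1⟩ ⟨_, h2⟩ ⟨_, h3⟩ ⟨_, hf1⟩ ⟨_, hg1⟩ ⟨_, hf2⟩ ⟨_, hg2⟩ n1 n2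
    have e13 : d1 = d3 := hK b' a c d1 d3 ⟨_, h1.trans Sym2.eq_swap⟩ ⟨_, h3⟩ ⟨_, h2⟩ ⟨_, hg1⟩ ⟨_, hf1⟩ ⟨_, hf3⟩ ⟨_, hg3⟩ n1 n3
    subst e12 e13
    have hsum : x = y1 + y2 + y3 := by
      rw [hd1, hd2, hd3, hxe]
      funext e
      simp only [Pi.add_apply]
      generalize dlt u w s(a,b') e = p1
      generalize dlt u w s(b',c) e = p2
      generalize dlt u w s(a,c) e = p3
      generalize dlt u w s(b',d1) e = p4
      generalize dlt u w s(a,d1) e = p5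
      generalize dlt u w s(c,d1) e = p6
      revert p1 p2 p3 p4 p5 p6; decide
    have hns := linearIndependent_iff_notMem_span.1 hb ⟨x, hBb hx⟩
    apply hns
    have hmem : ∀ y ∈ B, y ≠ x → y ∈ Submodule.span (ZMod 2)
        ((Subtype.val : b → E → ZMod 2) '' (univ \ {⟨x, hBb hx⟩})) := by
      intro y hy hyx
      exact Submodule.subset_span ⟨⟨y, hBb hy⟩, by simpa using hyx, rfl⟩
    have hfin := add_mem (add_mem (hmem _ hy1 hy1x) (hmem _ hy2 hy2x)) (hmem _ hy3 hy3x)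
    rw [← hsum] at hfin
    exact hfin
  have hN3 : 2 * B.card ≤ Fintype.card E := by
    have k1 : ∑ e : E, (B.filter fun x => x e ≠ 0).card = 3 * B.card := by
      have : ∑ x ∈ B, (Finset.univ.filter fun e => x e ≠ 0).card = 3 * B.card := by
        rw [Finset.sum_congr rfl hBc]; simp [mul_comm]
      rw [← this]
      simp only [Finset.card_filter]
      exact Finset.sum_comm
    have k2 : B.card ≤ (Finset.univ.filter fun e => (B.filter fun x => x e ≠ 0).card = 1).card := by
      rcases B.eq_empty_or_nonempty with h | ⟨x0, hx0⟩
      · rw [h]; simp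
      have : Nonempty E := ⟨(hpriv x0 hx0).choose⟩
      choose! f hf1 hf2 using hpriv
      apply Finset.card_le_card_of_injOn f
      · intro x hx
        have hx : x ∈ B := hx
        simp only [Finset.coe_filter, Finset.mem_univ, true_and, mem_ofPred_eq]
        rw [Finset.card_eq_one]
        refine ⟨x, ?_⟩
        ext y
        simp only [Finset.mem_filter, Finset.mem_singleton]
        refine ⟨fun h => hf2 x hx y h.1 h.2, fun h => ?_⟩
        rw [h]; exact ⟨hx, hf1 x hx⟩
      · intro x hx y hy hxy
        exact hf2 y hy x hx (hxy ▸ hf1 x hx)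
    have k3 : ∀ e, (B.filter fun x => x e ≠ 0).card +
        (if (B.filter fun x => x e ≠ 0).card = 1 then 1 else 0) ≤ 2 := by
      intro e
      have : (B.filter fun x => x e ≠ 0).card ≤ 2 :=
        (Finset.card_le_card (Finset.filter_subset_filter _ hBb)).trans (hb2 e)
      split_ifs <;> omega
    have k4 := Finset.sum_le_sum fun e (_ : e ∈ (Finset.univ : Finset E)) => k3 e
    rw [Finset.sum_add_distrib, k1, ← Finset.card_filter] at k4
    simp at k4 k2
    omega
  have := row_count (b := b) (fun x => if (Finset.univ.filter fun e => x e ≠ 0).card = 3 then 3 else 4)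
    (by convert hb2) (fun x hx => by
      have := h3 x hx
      split_ifs with h
      · rw [← h]
      · have : 4 ≤ (Finset.univ.filter fun e => x e ≠ 0).card := by omega
        convert this)
  rw [Finset.sum_ite] at this
  have hsplit := Finset.card_filter_add_card_filter_not (s := b) (fun x => (Finset.univ.filter fun e => x e ≠ 0).card = 3)
  simp only [Finset.sum_const, smul_eq_mul] at this
  rw [← hB] at this hsplit
  omega

end comb
end SurfUB

namespace SurfUB
open Set Filter Topology

theorem inter_eq {α : Type} [DecidableEq α] {k : ℕ} {a b τ : Finset α} (ha : a.card = k + 1) (hb : b.card = k + 1)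
    (hτ : τ.card = k) (hab : a ≠ b) (h1 : τ ⊆ a) (h2 : τ ⊆ b) : a ∩ b = τ := by
  symm
  apply Finset.eq_of_subset_of_card_le (Finset.subset_inter h1 h2)
  rw [hτ]
  by_contra hc
  push Not at hc
  have i1 : a ∩ b = a := Finset.eq_of_subset_of_card_le Finset.inter_subset_left (by omega)
  have i2 : a ∩ b = b := Finset.eq_of_subset_of_card_le Finset.inter_subset_right (by omega)
  exact hab (i1.symm.trans i2)

theorem comb_final {α : Type} [DecidableEq α] {k : ℕ} (hk : 2 ≤ k) (T S : Finset (Finset α))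
    (hT : ∀ τ ∈ T, τ.card = k) (hS : ∀ σ ∈ S, σ.card = k + 1)
    (hTS : ∀ σ ∈ S, ∀ τ, τ ⊆ σ → τ.card = k → τ ∈ T)
    (root : T → S) (par : T → S → S) (rk : T → S → ℕ) (hroot : ∀ τ, τ.1 ⊆ (root τ).1)
    (hpar : ∀ τ σ, τ.1 ⊆ σ.1 → σ ≠ root τ → τ.1 ⊆ (par τ σ).1 ∧ rk τ (par τ σ) < rk τ σ)
    [Fintype {q : T × S // q.1.1 ⊆ q.2.1 ∧ q.2 ≠ root q.1}]
    (N : ℕ) (u w : {q : T × S // q.1.1 ⊆ q.2.1 ∧ q.2 ≠ root q.1} → S)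
    (hu : ∀ e, u e = par e.1.1 e.1.2) (hw : ∀ e, w e = e.1.2) (hP : PlanarLike u w N) :
    S.card ≤ 3 * T.card + 8 * N := by
  classical
  have hrk : ∀ e, rk e.1.1 (u e) < rk e.1.1 (w e) := fun e => by
    rw [hu, hw]; exact (hpar _ _ e.2.1 e.2.2).2
  have hue : ∀ e, e.1.1.1 ⊆ (u e).1 := fun e => by
    rw [hu]; exact (hpar _ _ e.2.1 e.2.2).1
  have hwe : ∀ e, e.1.1.1 ⊆ (w e).1 := fun e => by
    rw [hw]; exact e.2.1
  have hloop : ∀ e, u e ≠ w e := fun e h => by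
    have := hrk e; rw [h] at this; exact lt_irrefl _ this
  have hdet : ∀ e e', e.1.1 = e'.1.1 → w e = w e' → e = e' := by
    intro e e' h1 h2
    rw [hw, hw] at h2
    exact Subtype.ext (Prod.ext h1 h2)
  have hcol : ∀ e a b, s(u e, w e) = s(a,b) → a.1 ∩ b.1 = e.1.1.1 := by
    intro e a b h
    have h0 : (u e).1 ∩ (w e).1 = e.1.1.1 := inter_eq (hS _ (u e).2) (hS _ (w e).2) (hT _ e.1.1.2)
      (fun h => hloop e (Subtype.ext h)) (hue e) (hwe e)
    rcases Sym2.eq_iff.1 h with ⟨rfl, rfl⟩ | ⟨rfl, rfl⟩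
    · exact h0
    · rw [Finset.inter_comm]; exact h0
  have hsimp : ∀ e e', s(u e, w e) = s(u e', w e') → e = e' := by
    intro e e' h
    have h1 : e.1.1 = e'.1.1 := Subtype.ext ((hcol e _ _ rfl).symm.trans (hcol e' _ _ h.symm))
    rcases Sym2.eq_iff.1 h with ⟨h2, h3⟩ | ⟨h2, h3⟩
    · exact hdet _ _ h1 h3
    · have i1 := hrk e
      have i2 := hrk e'
      rw [h2, h3, h1] at i1
      omega
  -- highest-rank endpoint
  have hmax : ∀ e a b, s(u e, w e) = s(a,b) → rk e.1.1 b ≤ rk e.1.1 a → w e = a := by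
    intro e a b h hle
    rcases Sym2.eq_iff.1 h with ⟨h2, h3⟩ | ⟨h2, h3⟩
    · have := hrk e; rw [h2, h3] at this; omega
    · exact h3
  have hneq : ∀ e a b, s(u e, w e) = s(a,b) → a ≠ b := by
    rintro e a b h rfl
    rcases Sym2.eq_iff.1 h with ⟨h2, h3⟩ | ⟨h2, h3⟩ <;> exact hloop e (h2.trans h3.symm)
  have hswap : ∀ e a b, s(u e, w e) = s(a,b) → s(u e, w e) = s(b,a) := fun e a b h => h.trans Sym2.eq_swap
  have hmono : ∀ e₁ e₂ e₃ a b d, s(u e₁, w e₁) = s(a,b) → s(u e₂, w e₂) = s(b,d) → s(u e₃, w e₃) = s(a,d) →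
      e₁.1.1 = e₂.1.1 → e₁.1.1 = e₃.1.1 → False := by
    intro e₁ e₂ e₃ a b d h1 h2 h3 c1 c2
    have hab := hneq _ _ _ h1
    have hbd := hneq _ _ _ h2
    have had := hneq _ _ _ h3
    have key : ∀ e e' x y z, s(u e, w e) = s(x,y) → s(u e', w e') = s(x,z) → y ≠ z → e.1.1 = e'.1.1 →
        rk e.1.1 y ≤ rk e.1.1 x → rk e.1.1 z ≤ rk e.1.1 x → False := by
      intro e e' x y z g1 g2 hyz hc l1 l2
      have := hdet e e' hc ((hmax e x y g1 l1).trans (hmax e' x z g2 (hc ▸ l2)).symm)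
      subst this
      rw [g1] at g2
      have := Sym2.congr_right.1 g2
      exact hyz this
    set τ := e₁.1.1 with hτ
    by_cases i1 : rk τ b ≤ rk τ a ∧ rk τ d ≤ rk τ a
    · exact key e₁ e₃ a b d h1 h3 hbd c2 i1.1 i1.2
    by_cases i2 : rk τ a ≤ rk τ b ∧ rk τ d ≤ rk τ b
    · exact key e₁ e₂ b a d (hswap _ _ _ h1) h2 had c1 i2.1 i2.2
    · refine key e₃ e₂ d a b (hswap _ _ _ h3) (hswap _ _ _ h2) hab (c2.symm.trans c1) ?_ ?_ <;>
        (have : e₃.1.1 = τ := c2.symm; rw [this]; omega)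
  -- triangles live in a (k+2)-set
  have hW : ∀ a b d : S, (∃ e, s(u e, w e) = s(a,b)) → (∃ e, s(u e, w e) = s(b,d)) →
      (∃ e, s(u e, w e) = s(a,d)) → d.1 ⊆ a.1 ∪ b.1 := by
    rintro a b d ⟨e₁, h1⟩ ⟨e₂, h2⟩ ⟨e₃, h3⟩ z hz
    by_contra hzn
    rw [Finset.mem_union, not_or] at hzn
    have cd := hS _ d.2
    have ce : (d.1.erase z).card = k := by rw [Finset.card_erase_of_mem hz, cd]; rfl
    have q2 : e₂.1.1.1 = d.1.erase z := by
      apply Finset.eq_of_subset_of_card_le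
      · rw [← hcol _ _ _ h2]
        intro y hy
        rw [Finset.mem_inter] at hy
        exact Finset.mem_erase.2 ⟨fun h => hzn.2 (h ▸ hy.1), hy.2⟩
      · rw [ce, hT _ e₂.1.1.2]
    have q3 : e₃.1.1.1 = d.1.erase z := by
      apply Finset.eq_of_subset_of_card_le
      · rw [← hcol _ _ _ h3]
        intro y hy
        rw [Finset.mem_inter] at hy
        exact Finset.mem_erase.2 ⟨fun h => hzn.1 (h ▸ hy.1), hy.2⟩
      · rw [ce, hT _ e₃.1.1.2]
    have q1 : e₁.1.1.1 = d.1.erase z := by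
      rw [← hcol _ _ _ h1]
      apply inter_eq (hS _ a.2) (hS _ b.2) ce (fun h => hneq _ _ _ h1 (Subtype.ext h))
      · rw [← q3, ← hcol _ _ _ h3]; exact Finset.inter_subset_left
      · rw [← q2, ← hcol _ _ _ h2]; exact Finset.inter_subset_left
    exact hmono e₁ e₂ e₃ a b d h1 h2 h3 (Subtype.ext (q1.trans q2.symm)) (Subtype.ext (q1.trans q3.symm))
  -- edge count
  have hcount : (k + 1) * S.card ≤ Fintype.card {q : T × S // q.1.1 ⊆ q.2.1 ∧ q.2 ≠ root q.1} + T.card := by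
    set I := (Finset.univ : Finset (T × S)).filter (fun q => q.1.1 ⊆ q.2.1) with hI
    have c1 : I.card = (k + 1) * S.card := by
      rw [Finset.card_eq_sum_card_fiberwise (f := Prod.snd) (t := Finset.univ) (by simp)]
      have : ∀ σ ∈ (Finset.univ : Finset S), (I.filter fun q => q.2 = σ).card = k + 1 := by
        intro σ _
        have hc : (Finset.powersetCard k σ.1).card = k + 1 := by
          rw [Finset.card_powersetCard, hS _ σ.2]; simp
        rw [← hc]
        apply Finset.card_bij (fun q _ => q.1.1)
        · intro q hq
          simp only [hI, Finset.mem_filter, Finset.mem_univ, true_and] at hq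
          rw [Finset.mem_powersetCard]
          exact ⟨hq.2 ▸ hq.1, hT _ q.1.2⟩
        · intro q hq q' hq' h
          simp only [hI, Finset.mem_filter, Finset.mem_univ, true_and] at hq hq'
          exact Prod.ext (Subtype.ext h) (hq.2.trans hq'.2.symm)
        · intro τ hτ
          rw [Finset.mem_powersetCard] at hτ
          refine ⟨(⟨τ, hTS _ σ.2 τ hτ.1 hτ.2⟩, σ), ?_, rfl⟩
          simp [hI, hτ.1]
      rw [Finset.sum_congr rfl this]
      simp [mul_comm]
    have c2 : Fintype.card {q : T × S // q.1.1 ⊆ q.2.1 ∧ q.2 ≠ root q.1} = (I.filter fun q => q.2 ≠ root q.1).card := by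
      rw [hI, Finset.filter_filter]
      rw [← Fintype.card_subtype]
    have c3 : (I.filter fun q => ¬ q.2 ≠ root q.1).card ≤ T.card := by
      have : T.card = (Finset.univ : Finset T).card := by simp
      rw [this]
      apply Finset.card_le_card_of_injOn Prod.fst (by simp)
      intro q hq q' hq' h
      simp only [Finset.coe_filter, mem_ofPred_eq, not_not] at hq hq'
      exact Prod.ext h (by rw [hq.2, hq'.2, h])
    have c4 := Finset.card_filter_add_card_filter_not (s := I) (fun q => q.2 ≠ root q.1)
    rw [c2, ← c1, ← c4]
    omega
  have hVc : Fintype.card S = S.card := by simp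
  rcases Nat.lt_or_ge 2 k with h | h
  · have := bound3 hloop hsimp hP
    rw [hVc] at this
    have : 4 * S.card ≤ (k+1) * S.card := Nat.mul_le_mul_right _ (by omega)
    omega
  · obtain rfl : k = 2 := by omega
    have hK : ∀ a b c d₁ d₂ : S, (∃ e, s(u e, w e) = s(a,b)) → (∃ e, s(u e, w e) = s(b,c)) →
      (∃ e, s(u e, w e) = s(a,c)) → (∃ e, s(u e, w e) = s(b,d₁)) → (∃ e, s(u e, w e) = s(a,d₁)) →
      (∃ e, s(u e, w e) = s(c,d₂)) → (∃ e, s(u e, w e) = s(b,d₂)) → d₁ ≠ c → d₂ ≠ a → d₁ = d₂ := by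
      intro a b c d₁ d₂ hab hbc hac hbd1 had1 hcd2 hbd2 n1 n2
      have w1 := hW a b c hab hbc hac
      have w2 := hW a b d₁ hab hbd1 had1
      have w3 := hW b c d₂ hbc hcd2 hbd2
      have w3' : d₂.1 ⊆ a.1 ∪ b.1 := w3.trans (Finset.union_subset Finset.subset_union_right w1)
      have m1 : a ≠ b := by obtain ⟨e, he⟩ := hab; exact hneq _ _ _ he
      have m2 : b ≠ c := by obtain ⟨e, he⟩ := hbc; exact hneq _ _ _ he
      have m3 : a ≠ c := by obtain ⟨e, he⟩ := hac; exact hneq _ _ _ he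
      have m4 : b ≠ d₁ := by obtain ⟨e, he⟩ := hbd1; exact hneq _ _ _ he
      have m5 : a ≠ d₁ := by obtain ⟨e, he⟩ := had1; exact hneq _ _ _ he
      have m6 : c ≠ d₂ := by obtain ⟨e, he⟩ := hcd2; exact hneq _ _ _ he
      have m7 : b ≠ d₂ := by obtain ⟨e, he⟩ := hbd2; exact hneq _ _ _ he
      by_contra hne
      have hcardW : (a.1 ∪ b.1).card = 4 := by
        obtain ⟨e, he⟩ := hab
        have i1 := hcol _ _ _ he
        have i2 := Finset.card_union_add_card_inter a.1 b.1
        rw [i1, hT _ e.1.1.2, hS _ a.2, hS _ b.2] at i2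
        omega
      have hp : (Finset.powersetCard 3 (a.1 ∪ b.1)).card = 4 := by
        rw [Finset.card_powersetCard, hcardW]; rfl
      have hsub : (({a, b, c, d₁, d₂} : Finset S).image Subtype.val) ⊆ Finset.powersetCard 3 (a.1 ∪ b.1) := by
        intro z hz
        obtain ⟨y, hy, rfl⟩ := Finset.mem_image.1 hz
        rw [Finset.mem_powersetCard]
        refine ⟨?_, hS _ y.2⟩
        simp only [Finset.mem_insert, Finset.mem_singleton] at hy
        rcases hy with rfl | rfl | rfl | rfl | rfl
        · exact Finset.subset_union_left
        · exact Finset.subset_union_right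
        · exact w1
        · exact w2
        · exact w3'
      have := Finset.card_le_card hsub
      rw [hp, Finset.card_image_of_injective _ Subtype.val_injective] at this
      have h5 : ({a, b, c, d₁, d₂} : Finset S).card = 5 := by
        rw [Finset.card_insert_of_notMem (by simp [m1, m3, m5, n2.symm]),
          Finset.card_insert_of_notMem (by simp [m2, m4, m7]),
          Finset.card_insert_of_notMem (by simp [n1.symm, m6]),
          Finset.card_pair hne]
      omega
    have := bound83 hloop hsimp hK hP
    rw [hVc] at this
    omega
end SurfUB

namespace SurfUB
open Set Filter Topology

theorem final_count {M : Type*} [TopologicalSpace M] [T2Space M] (hM : Surf M) {k : ℕ} (hk : 2 ≤ k) (N : ℕ)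
    (hN : ∀ {V E : Type} [Fintype V] [Fintype E] (C : Config M V E), PlanarLike C.u C.w N)
    {n : ℕ} (A : Fin n → Set M) (hf : fNum A (k + 1) = 0)
    (hyp : ∀ σ : Finset (Fin n), σ.card = k ∨ σ.card = k + 1 →
          (⋂ i ∈ σ, A i) = ∅ ∨ (∃ p, (⋂ i ∈ σ, A i) = {p}) ∨
            (IsOpen (⋂ i ∈ σ, A i) ∧ IsPathConnected (⋂ i ∈ σ, A i))) :
    fNum A k ≤ 4 * fInd A (k - 1) + 8 * N := by
  classical
  let I : Finset (Fin n) → Set M := fun σ => ⋂ i ∈ σ, A i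
  have memI : ∀ σ x, x ∈ I σ ↔ ∀ i ∈ σ, x ∈ A i := fun σ x => by simp [I]
  have hI : ∀ σ, (⋂ i ∈ σ, A i) = I σ := fun _ => rfl
  simp only [hI] at hyp
  have Imono : ∀ {ρ σ}, ρ ⊆ σ → I σ ⊆ I ρ := fun h x hx => by
    rw [memI] at *; exact fun i hi => hx i (h hi)
  have Iunion : ∀ ρ σ, I (ρ ∪ σ) = I ρ ∩ I σ := fun ρ σ => by
    ext x
    simp only [mem_inter_iff, memI, Finset.mem_union]
    exact ⟨fun h => ⟨fun i hi => h i (Or.inl hi), fun i hi => h i (Or.inr hi)⟩,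
      fun h i hi => hi.elim (h.1 i) (h.2 i)⟩
  have hcard : ∀ ρ x, x ∈ I ρ → ρ.card ≤ k + 1 := by
    intro ρ x hx
    by_contra hc
    push Not at hc
    obtain ⟨ρ', h1, h2⟩ := Finset.exists_subset_card_eq (show k + 2 ≤ ρ.card by omega)
    unfold fNum at hf
    rw [Nat.card_eq_zero] at hf
    rcases hf with hf | hf
    · exact hf.elim ⟨ρ', by omega, x, Imono h1 hx⟩
    · exact hf.not_finite inferInstance
  have hcup : ∀ ρ σ x, σ.card = k + 1 → x ∈ I ρ → x ∈ I σ → ρ ⊆ σ := by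
    intro ρ σ x hσ h1 h2
    have h3 := hcard (ρ ∪ σ) x (by rw [Iunion]; exact ⟨h1, h2⟩)
    have : σ = ρ ∪ σ := Finset.eq_of_subset_of_card_le Finset.subset_union_right (by omega)
    rw [this]; exact Finset.subset_union_left
  let good : Finset (Fin n) → Prop := fun σ => ∀ τ, τ ⊆ σ → τ.card = k → IsOpen (I τ) ∧ IsPathConnected (I τ)
  let Sall : Finset (Finset (Fin n)) := Finset.univ.filter fun σ => σ.card = k + 1 ∧ (I σ).Nonempty
  let Tall : Finset (Finset (Fin n)) := Finset.univ.filter fun τ => τ.card = k ∧ (I τ).Nonempty ∧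
    ∃ σ : Finset (Fin n), τ ⊂ σ ∧ σ.card = k + 1 ∧ (I σ).Nonempty
  let S := Sall.filter good
  let T : Finset (Finset (Fin n)) := Finset.univ.filter fun τ => τ.card = k ∧ ∃ σ ∈ S, τ ⊆ σ
  have mSall : ∀ σ, σ ∈ Sall ↔ σ.card = k + 1 ∧ (I σ).Nonempty := fun σ => by simp [Sall]
  have mTall : ∀ τ, τ ∈ Tall ↔ τ.card = k ∧ (I τ).Nonempty ∧
    ∃ σ : Finset (Fin n), τ ⊂ σ ∧ σ.card = k + 1 ∧ (I σ).Nonempty := fun σ => by simp [Tall]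
  have mS : ∀ σ, σ ∈ S ↔ (σ.card = k + 1 ∧ (I σ).Nonempty) ∧ good σ := fun σ => by
    rw [← mSall]; exact Finset.mem_filter
  have mT : ∀ τ, τ ∈ T ↔ τ.card = k ∧ ∃ σ ∈ S, τ ⊆ σ := fun τ => by simp [T]
  have e1 : fNum A k = Sall.card := by
    unfold fNum
    rw [Nat.card_eq_fintype_card, Fintype.card_subtype]
  have e2 : fInd A (k - 1) = Tall.card := by
    obtain ⟨j, rfl⟩ : ∃ j, k = j + 1 := ⟨k - 1, by omega⟩
    unfold fInd
    rw [Nat.card_eq_fintype_card, Fintype.card_subtype]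
    rfl
  have hssub : ∀ τ σ : Finset (Fin n), τ.card = k → σ.card = k + 1 → τ ⊆ σ → τ ⊂ σ := by
    intro τ σ h1 h2 h3
    refine Finset.ssubset_iff_subset_ne.2 ⟨h3, ?_⟩
    rintro rfl; omega
  have hTT : T ⊆ Tall := by
    intro τ hτ
    obtain ⟨h1, σ, h2, h3⟩ := (mT τ).1 hτ
    have h4 := ((mS σ).1 h2).1
    exact (mTall τ).2 ⟨h1, h4.2.mono (Imono h3), σ, hssub _ _ h1 h4.1 h3, h4⟩
  have hbad : (Sall.filter fun σ => ¬ good σ).card ≤ Tall.card := by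
    have hb : ∀ σ ∈ Sall.filter (fun σ => ¬ good σ), ∃ τ, τ ∈ Tall ∧ τ ⊆ σ ∧ ∃ p, I τ = {p} := by
      intro σ hσ
      obtain ⟨h1, h2⟩ := Finset.mem_filter.1 hσ
      have h1 := (mSall σ).1 h1
      simp only [good] at h2
      push Not at h2
      obtain ⟨τ, h3, h4, h5⟩ := h2
      have h6 := h1.2.mono (Imono h3)
      refine ⟨τ, (mTall τ).2 ⟨h4, h6, σ, hssub _ _ h4 h1.1 h3, h1⟩, h3, ?_⟩
      rcases hyp τ (Or.inl h4) with h | h | h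
      · rw [h] at h6; simp at h6
      · exact h
      · exact absurd h.2 (h5 h.1)
    choose! f hf1 hf2 hf3 using hb
    apply Finset.card_le_card_of_injOn f (fun σ hσ => hf1 σ hσ)
    intro σ hσ σ' hσ' h
    have g := (mSall σ).1 (Finset.mem_filter.1 hσ).1
    have g' := (mSall σ').1 (Finset.mem_filter.1 hσ').1
    obtain ⟨p, hp⟩ := hf3 σ hσ
    obtain ⟨x, hx⟩ := g.2
    obtain ⟨x', hx'⟩ := g'.2
    have i1 : x ∈ I (f σ) := Imono (hf2 σ hσ) hx
    have i2 : x' ∈ I (f σ) := by rw [h]; exact Imono (hf2 σ' hσ') hx'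
    rw [hp] at i1 i2
    have : x = x' := Eq.trans i1 (Eq.symm i2)
    subst this
    exact Finset.Subset.antisymm (hcup _ _ _ g'.1 hx hx') (hcup _ _ _ g.1 hx' hx)
  have hSo : ∀ σ ∈ S, IsOpen (I σ) ∧ IsPathConnected (I σ) := by
    intro σ hσ
    obtain ⟨⟨h1, h2⟩, h3⟩ := (mS σ).1 hσ
    have ho : IsOpen (I σ) := by
      obtain ⟨i, hi, j, hj, hij⟩ := Finset.one_lt_card.1 (show 1 < σ.card by omega)
      have : σ = σ.erase i ∪ σ.erase j := by
        ext l
        simp only [Finset.mem_union, Finset.mem_erase]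
        constructor
        · intro hl
          by_cases h : l = i
          · exact Or.inr ⟨fun h' => hij (h.symm.trans h'), hl⟩
          · exact Or.inl ⟨h, hl⟩
        · tauto
      rw [this, Iunion]
      exact (h3 _ (Finset.erase_subset _ _) (by rw [Finset.card_erase_of_mem hi]; omega)).1.inter
        (h3 _ (Finset.erase_subset _ _) (by rw [Finset.card_erase_of_mem hj]; omega)).1
    refine ⟨ho, ?_⟩
    rcases hyp σ (Or.inr h1) with h | ⟨p, h⟩ | h
    · rw [h] at h2; simp at h2
    · rw [h]; exact isPathConnected_singleton p
    · exact h.2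
  have hTo : ∀ τ ∈ T, IsOpen (I τ) ∧ IsPathConnected (I τ) := by
    intro τ hτ
    obtain ⟨h1, σ, h2, h3⟩ := (mT τ).1 hτ
    exact ((mS σ).1 h2).2 τ h3 h1
  have hSc : ∀ σ ∈ S, σ.card = k + 1 := fun σ hσ => ((mS σ).1 hσ).1.1
  have hTc : ∀ τ ∈ T, τ.card = k := fun τ hτ => ((mT τ).1 hτ).1
  let Z : Inc M T S :=
    { inc := fun τ σ => τ.1 ⊆ σ.1
      A := fun τ => I τ.1
      D := fun σ => I σ.1
      hAo := fun τ => (hTo _ τ.2).1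
      hAp := fun τ => (hTo _ τ.2).2
      hDo := fun σ => (hSo _ σ.2).1
      hDp := fun σ => (hSo _ σ.2).2
      hDd := fun σ σ' x h h' => Subtype.ext (Finset.Subset.antisymm
        (hcup _ _ _ (hSc _ σ'.2) h h') (hcup _ _ _ (hSc _ σ.2) h' h))
      hin := fun τ σ h => Imono h
      hnin := fun τ σ x h h' => hcup _ _ _ (hSc _ σ.2) h' h
      hmeet := by
        intro τ τ' x hne h h'
        have hx : x ∈ I (τ.1 ∪ τ'.1) := by rw [Iunion]; exact ⟨h, h'⟩
        have c1 := hcard _ x hx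
        have c2 : (τ.1 ∪ τ'.1).card = k + 1 := by
          by_contra hc
          have t1 := hTc _ τ.2
          have t2 := hTc _ τ'.2
          have u1 : τ.1 = τ.1 ∪ τ'.1 := Finset.eq_of_subset_of_card_le Finset.subset_union_left (by omega)
          have u2 : τ'.1 = τ.1 ∪ τ'.1 := Finset.eq_of_subset_of_card_le Finset.subset_union_right (by omega)
          exact hne (Subtype.ext (u1.trans u2.symm))
        refine ⟨⟨τ.1 ∪ τ'.1, (mS _).2 ⟨⟨c2, x, hx⟩, ?_⟩⟩, hx⟩
        intro ρ hρ hρc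
        have hxρ := Imono hρ hx
        rcases hyp ρ (Or.inl hρc) with h1 | ⟨p, h1⟩ | h1
        · rw [h1] at hxρ; exact hxρ.elim
        · exfalso
          have ho : IsOpen (I (τ.1 ∪ τ'.1)) := by
            rw [Iunion]; exact (hTo _ τ.2).1.inter (hTo _ τ'.2).1
          have hs : I (τ.1 ∪ τ'.1) = {p} :=
            (Set.Nonempty.subset_singleton_iff ⟨x, hx⟩).1 (h1 ▸ Imono hρ)
          rw [hs, isOpen_singleton_iff_punctured_nhds] at ho
          exact (hM.neBot p).ne ho
        · exact h1
      hne := fun τ => by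
        obtain ⟨h1, σ, h2, h3⟩ := (mT τ.1).1 τ.2
        exact ⟨⟨σ, h2⟩, h3⟩ }
  obtain ⟨root, par, rk, hroot, hpar, C, hCu, hCw⟩ := Z.build hM
  have fin : S.card ≤ 3 * T.card + 8 * N :=
    comb_final hk T S hTc hSc (fun σ hσ τ h1 h2 => (mT τ).2 ⟨h2, σ, hσ, h1⟩)
      root par rk hroot hpar N C.u C.w hCu hCw (hN C)
  have hsplit := Finset.card_filter_add_card_filter_not (s := Sall) good
  have hTle := Finset.card_le_card hTT
  have : (Sall.filter good).card = S.card := rfl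
  rw [e1, e2]
  omega

end SurfUB

/-- **Theorem (surfaces, b = 1).** Let `M` be a surface (a compact two-dimensional real
manifold) and `k ≥ 2`. There are constants `c₁ > 0, c₂ ≥ 0`, depending only on `k` and
`M`, such that for every finite family `𝒜` of subsets of `M` with (i) `f_{k+1}(𝒜) = 0`
and (ii) each `k`-wise and `(k+1)`-wise intersection empty, a single point, or both
open and path-connected, one has `f_k(𝒜) ≤ c₁·f_{k-1}^{ind}(𝒜) + c₂`. -/
theorem surface_upper_bound_path_connected (M : Type*) [TopologicalSpace M] [T2Space M]
    [CompactSpace M] [ChartedSpace (EuclideanSpace ℝ (Fin 2)) M]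
    (k : ℕ) (hk : 2 ≤ k) :
    ∃ c₁ c₂ : ℝ, 0 < c₁ ∧ 0 ≤ c₂ ∧
      ∀ (n : ℕ) (A : Fin n → Set M),
        fNum A (k + 1) = 0 →
        (∀ σ : Finset (Fin n), σ.card = k ∨ σ.card = k + 1 →
          (⋂ i ∈ σ, A i) = ∅ ∨ (∃ p, (⋂ i ∈ σ, A i) = {p}) ∨
            (IsOpen (⋂ i ∈ σ, A i) ∧ IsPathConnected (⋂ i ∈ σ, A i))) →
        (fNum A k : ℝ) ≤ c₁ * fInd A (k - 1) + c₂ := by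
  classical
  have hM := SurfUB.surf_of_charted M
  obtain ⟨N, hN⟩ := SurfUB.planar_of_config M hM
  refine ⟨4, 8 * N, by norm_num, by positivity, ?_⟩
  intro n A hf hyp
  exact_mod_cast SurfUB.final_count hM hk N (fun C => hN C) A hf hyp
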